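/- arXiv:1308.2211 — 2 statements merged into one kernel-verified Lean document; each statement's English description precedes it below -/
import Mathlib

section
/- Let G be a finite simple robust graph. If v is a vertex of G with d(v) = k for some k ∈ {7, 8, 9}, and v has more than k − 4 neighbors of degree at most 6, then G has a reducible vertex set. -/
open SimpleGraph

variable {V : Type*}

/-- `S` is a set of pairwise edge-disjoint triangles of `G` (two triangles, viewed as
3-element vertex sets, are edge-disjoint iff they share at most one vertex). -/
def EdgeDisjointTriangles [DecidableEq V] (G : SimpleGraph V) (S : Finset (Finset V)) : Prop :=
  (∀ t ∈ S, G.IsNClique 3 t) ∧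
    ∀ t₁ ∈ S, ∀ t₂ ∈ S, t₁ ≠ t₂ → (t₁ ∩ t₂).card ≤ 1

/-- `G` is robust: for every vertex `v`, every connected component of the subgraph induced
by the neighborhood of `v` has at least 5 vertices. -/
def Robust (G : SimpleGraph V) : Prop :=
  ∀ (v : V) (c : (G.induce (G.neighborSet v)).ConnectedComponent), 5 ≤ c.supp.ncard

/-- `V₀` is a reducible vertex set of `G`. -/
def ReducibleVertexSet [DecidableEq V] (G : SimpleGraph V) (V₀ : Finset V) : Prop :=
  V₀.Nonempty ∧
    ∃ (S : Finset (Finset V)) (X : Finset (Sym2 V)),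
      EdgeDisjointTriangles G S ∧ ↑X ⊆ G.edgeSet ∧ X.card ≤ 2 * S.card ∧
      (∀ t : Finset V, (G.deleteEdges ↑X).IsNClique 3 t → ∀ x ∈ V₀, x ∉ t) ∧
      (∀ t ∈ S, ∀ u ∈ t, ∀ v ∈ t, u ≠ v → u ∉ V₀ → v ∉ V₀ → s(u, v) ∈ X)


def Lk (G : SimpleGraph V) (u x y : V) : Prop := G.Adj u x ∧ G.Adj u y ∧ G.Adj x y

lemma Lk.symm' {G : SimpleGraph V} {u x y : V} (h : Lk G u x y) : Lk G u y x :=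
  ⟨h.2.1, h.1, h.2.2.symm⟩

lemma core1 [DecidableEq V] (G : SimpleGraph V) (u : V) (M : Finset (Sym2 V)) (Q : Finset V)
    (hM : ∀ a b, s(a,b) ∈ M → Lk G u a b)
    (hdis : ∀ e ∈ M, ∀ f ∈ M, ∀ a, a ∈ e → a ∈ f → e = f)
    (hQ : Q.card ≤ M.card)
    (hcov : ∀ z t, Lk G u z t → z ∈ Q ∨ t ∈ Q ∨ s(z,t) ∈ M) :
    ∃ V₀ : Finset V, ReducibleVertexSet G V₀ := by
  classical
  have huM : ∀ e ∈ M, u ∉ e := by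
    intro e he
    induction e with | _ a b =>
    have := hM a b he
    simp only [Sym2.mem_iff, not_or]
    exact ⟨this.1.ne, this.2.1.ne⟩
  have hinj : Set.InjOn (fun e : Sym2 V => insert u e.toFinset) M := by
    intro e he f hf h
    have h' : insert u e.toFinset = insert u f.toFinset := h
    have h1 := huM e he
    have h2 := huM f hf
    apply Sym2.ext
    intro x
    have := congrArg (fun s => x ∈ s) h'
    simp only [Finset.mem_insert, Sym2.mem_toFinset, eq_iff_iff] at this
    by_cases hx : x = u
    · subst hx; simp [h1, h2]
    · simpa [hx] using this
  refine ⟨{u}, by simp, M.image (fun e => insert u e.toFinset),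
    (M ∪ Q.image (fun q => s(u,q))).filter (fun e => e ∈ G.edgeSet), ⟨?_, ?_⟩, ?_, ?_, ?_, ?_⟩
  · intro t ht
    obtain ⟨e, he, rfl⟩ := Finset.mem_image.1 ht
    induction e with | _ a b =>
    have := hM a b he
    rw [Sym2.toFinset_mk_eq, SimpleGraph.is3Clique_iff]
    exact ⟨u, a, b, this.1, this.2.1, this.2.2, rfl⟩
  · intro t₁ h1 t₂ h2 hne
    obtain ⟨e, he, rfl⟩ := Finset.mem_image.1 h1
    obtain ⟨f, hf, rfl⟩ := Finset.mem_image.1 h2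
    have : (insert u e.toFinset ∩ insert u f.toFinset) ⊆ {u} := by
      intro x hx
      simp only [Finset.mem_inter, Finset.mem_insert, Sym2.mem_toFinset, Finset.mem_singleton] at hx ⊢
      by_contra hxu
      have h3 := hdis e he f hf x (by tauto) (by tauto)
      subst h3; exact hne rfl
    simpa using Finset.card_le_card this
  · intro e he
    simp at he
    exact he.2
  · rw [Finset.card_image_of_injOn hinj]
    refine (Finset.card_filter_le _ _).trans ((Finset.card_union_le _ _).trans ?_)
    have : (Q.image (fun q => s(u,q))).card ≤ Q.card := Finset.card_image_le
    omega
  · intro t ht x hx hxt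
    simp only [Finset.mem_singleton] at hx
    subst hx
    have hcl := ht.1
    have hc3 := ht.2
    have hc2 : (t.erase x).card = 2 := by rw [Finset.card_erase_of_mem hxt, hc3]
    obtain ⟨a, b, hab, h⟩ := Finset.card_eq_two.1 hc2
    have ha : a ∈ t.erase x := by simp [h]
    have hb : b ∈ t.erase x := by simp [h]
    rw [Finset.mem_erase] at ha hb
    have A1 := hcl hxt ha.2 ha.1.symm
    have A2 := hcl hxt hb.2 hb.1.symm
    have A3 := hcl ha.2 hb.2 hab
    rw [SimpleGraph.deleteEdges_adj] at A1 A2 A3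
    rcases hcov a b ⟨A1.1, A2.1, A3.1⟩ with h | h | h
    · apply A1.2
      simp only [Finset.coe_filter, Set.mem_ofPred_eq, Finset.mem_union, Finset.mem_image]
      exact ⟨Or.inr ⟨a, h, rfl⟩, A1.1⟩
    · apply A2.2
      simp only [Finset.coe_filter, Set.mem_ofPred_eq, Finset.mem_union, Finset.mem_image]
      exact ⟨Or.inr ⟨b, h, rfl⟩, A2.1⟩
    · apply A3.2
      simp only [Finset.coe_filter, Set.mem_ofPred_eq, Finset.mem_union, Finset.mem_image]
      exact ⟨Or.inl h, A3.1⟩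
  · intro t ht a ha b hb hab hau hbu
    obtain ⟨e, he, rfl⟩ := Finset.mem_image.1 ht
    simp only [Finset.mem_singleton, Finset.mem_insert, Sym2.mem_toFinset] at *
    have ha' : a ∈ e := by tauto
    have hb' : b ∈ e := by tauto
    have : e = s(a,b) := (Sym2.mem_and_mem_iff hab).1 ⟨ha', hb'⟩
    subst this
    simp only [Finset.mem_filter, Finset.mem_union]
    exact ⟨Or.inl he, (hM a b he).2.2⟩

lemma irr1 [DecidableEq V] (G : SimpleGraph V) (hno : ¬ ∃ V₀ : Finset V, ReducibleVertexSet G V₀)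
    (u : V) : ∀ x y q, Lk G u x y → ∃ z t, Lk G u z t ∧ ¬(z = x ∧ t = y) ∧ ¬ (z = y ∧ t = x) ∧
      z ≠ q ∧ t ≠ q := by
  intro x y q h
  by_contra hcon
  push Not at hcon
  refine hno (core1 G u {s(x,y)} {q} ?_ ?_ ?_ ?_)
  · intro a b hab
    simp only [Finset.mem_singleton, Sym2.eq_iff] at hab
    rcases hab with ⟨rfl, rfl⟩ | ⟨rfl, rfl⟩
    exacts [h, h.symm']
  · intro e he f hf
    simp only [Finset.mem_singleton] at he hf
    simp [he, hf]
  · simp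
  · intro z t hzt
    have := hcon z t hzt
    simp only [Finset.mem_singleton, Sym2.eq_iff]
    tauto

lemma irr2 [DecidableEq V] (G : SimpleGraph V) (hno : ¬ ∃ V₀ : Finset V, ReducibleVertexSet G V₀)
    (u : V) : ∀ x y x' y' q q', Lk G u x y → Lk G u x' y' → x ≠ x' → x ≠ y' → y ≠ x' → y ≠ y' →
      ∃ z t, Lk G u z t ∧ ¬(z = x ∧ t = y) ∧ ¬ (z = y ∧ t = x) ∧
      ¬(z = x' ∧ t = y') ∧ ¬ (z = y' ∧ t = x') ∧
      z ≠ q ∧ t ≠ q ∧ z ≠ q' ∧ t ≠ q' := by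
  intro x y x' y' q q' h h' n1 n2 n3 n4
  by_contra hcon
  push Not at hcon
  refine hno (core1 G u {s(x,y), s(x',y')} {q,q'} ?_ ?_ ?_ ?_)
  · intro a b hab
    simp only [Finset.mem_singleton, Finset.mem_insert, Sym2.eq_iff] at hab
    rcases hab with (⟨rfl, rfl⟩ | ⟨rfl, rfl⟩) | (⟨rfl, rfl⟩ | ⟨rfl, rfl⟩)
    exacts [h, h.symm', h', h'.symm']
  · intro e he f hf a hae haf
    simp only [Finset.mem_singleton, Finset.mem_insert] at he hf
    rcases he with rfl | rfl <;> rcases hf with rfl | rfl <;> 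
      simp only [Sym2.mem_iff] at hae haf <;> grind
  · have : ({s(x,y), s(x',y')} : Finset (Sym2 V)).card = 2 :=
      Finset.card_pair (by simp only [ne_eq, Sym2.eq_iff]; tauto)
    rw [this]
    exact Finset.card_le_two
  · intro z t hzt
    have := hcon z t hzt
    simp only [Finset.mem_singleton, Finset.mem_insert, Sym2.eq_iff]
    tauto

lemma irr3 [DecidableEq V] (G : SimpleGraph V) (hno : ¬ ∃ V₀ : Finset V, ReducibleVertexSet G V₀)
    (u : V) : ∀ x y x' y' x'' y'' q q' q'', Lk G u x y → Lk G u x' y' → Lk G u x'' y'' →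
      x ≠ x' → x ≠ y' → y ≠ x' → y ≠ y' →
      x ≠ x'' → x ≠ y'' → y ≠ x'' → y ≠ y'' →
      x' ≠ x'' → x' ≠ y'' → y' ≠ x'' → y' ≠ y'' →
      ∃ z t, Lk G u z t ∧ ¬(z = x ∧ t = y) ∧ ¬ (z = y ∧ t = x) ∧
      ¬(z = x' ∧ t = y') ∧ ¬ (z = y' ∧ t = x') ∧
      ¬(z = x'' ∧ t = y'') ∧ ¬ (z = y'' ∧ t = x'') ∧
      z ≠ q ∧ t ≠ q ∧ z ≠ q' ∧ t ≠ q' ∧ z ≠ q'' ∧ t ≠ q'' := by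
  intro x y x' y' x'' y'' q q' q'' h h' h'' n1 n2 n3 n4 m1 m2 m3 m4 k1 k2 k3 k4
  by_contra hcon
  push Not at hcon
  refine hno (core1 G u {s(x,y), s(x',y'), s(x'',y'')} {q,q',q''} ?_ ?_ ?_ ?_)
  · intro a b hab
    simp only [Finset.mem_singleton, Finset.mem_insert, Sym2.eq_iff] at hab
    rcases hab with (⟨rfl, rfl⟩ | ⟨rfl, rfl⟩) | (⟨rfl, rfl⟩ | ⟨rfl, rfl⟩) | (⟨rfl, rfl⟩ | ⟨rfl, rfl⟩)
    exacts [h, h.symm', h', h'.symm', h'', h''.symm']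
  · intro e he f hf a hae haf
    simp only [Finset.mem_singleton, Finset.mem_insert] at he hf
    rcases he with rfl | rfl | rfl <;> rcases hf with rfl | rfl | rfl <;> 
      simp only [Sym2.mem_iff] at hae haf <;> grind
  · have : ({s(x,y), s(x',y'), s(x'',y'')} : Finset (Sym2 V)).card = 3 := by
      refine Finset.card_eq_three.2 ⟨s(x,y), s(x',y'), s(x'',y''), ?_, ?_, ?_, rfl⟩
      all_goals simp only [ne_eq, Sym2.eq_iff]; tauto
    rw [this]
    exact Finset.card_le_three
  · intro z t hzt
    have := hcon z t hzt
    simp only [Finset.mem_singleton, Finset.mem_insert, Sym2.eq_iff]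
    clear hno hcon n1 n2 n3 n4 m1 m2 m3 m4 k1 k2 k3 k4
    grind

lemma conn_of_robust [Fintype V] [DecidableEq V] (G : SimpleGraph V) (hrob : Robust G) (u : V)
    (A : Finset V) (hA : A.Nonempty) (hAu : ∀ x ∈ A, G.Adj u x) (hc : A.card ≤ 4) :
    ∃ x ∈ A, ∃ y, y ∉ A ∧ Lk G u x y := by
  by_contra hcon
  push Not at hcon
  obtain ⟨a, ha⟩ := hA
  let a' : G.neighborSet u := ⟨a, hAu a ha⟩
  have h5 := hrob u ((G.induce (G.neighborSet u)).connectedComponentMk a')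
  set c := (G.induce (G.neighborSet u)).connectedComponentMk a'
  have key : ∀ y : G.neighborSet u, (G.induce (G.neighborSet u)).Reachable a' y → (y : V) ∈ A := by
    intro y hy
    rw [SimpleGraph.reachable_iff_reflTransGen] at hy
    induction hy with
    | refl => exact ha
    | tail _ hbc ih =>
      rename_i b c _
      by_contra hcA
      exact hcon b ih c hcA ⟨b.2, c.2, hbc⟩
  have hsub : (Subtype.val '' c.supp) ⊆ (A : Set V) := by
    rintro _ ⟨y, hy, rfl⟩
    have hy' : (G.induce (G.neighborSet u)).Reachable y a' := SimpleGraph.ConnectedComponent.exact hy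
    exact key y hy'.symm
  have h1 := Set.ncard_le_ncard hsub A.finite_toSet
  rw [Set.ncard_image_of_injective _ Subtype.val_injective, Set.ncard_coe_finset] at h1
  omega

lemma transfer [DecidableEq V] (G : SimpleGraph V) {n : ℕ} (f : Fin n → V)
    (hf : Function.Injective f) (V0 : Finset (Fin n)) (S0 : Finset (Finset (Fin n)))
    (X0 : Finset (Sym2 (Fin n))) (N0 : Fin n → Finset (Fin n))
    (hV : V0.Nonempty) (hS : ∀ t ∈ S0, t.card = 3)
    (hS2 : ∀ t₁ ∈ S0, ∀ t₂ ∈ S0, t₁ ≠ t₂ → (t₁ ∩ t₂).card ≤ 1)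
    (hX : X0.card ≤ 2 * S0.card)
    (hcov : ∀ x ∈ V0, ∀ i ∈ N0 x, ∀ j ∈ N0 x, i ≠ j → s(x,i) ∈ X0 ∨ s(x,j) ∈ X0 ∨ s(i,j) ∈ X0)
    (h3 : ∀ t ∈ S0, ∀ i ∈ t, ∀ j ∈ t, i ≠ j → i ∉ V0 → j ∉ V0 → s(i,j) ∈ X0)
    (hadj : ∀ t ∈ S0, ∀ i ∈ t, ∀ j ∈ t, i < j → G.Adj (f i) (f j))
    (hN : ∀ x ∈ V0, ∀ y, G.Adj (f x) y → ∃ i ∈ N0 x, f i = y) :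
    ∃ V₀ : Finset V, ReducibleVertexSet G V₀ := by
  classical
  have hadj' : ∀ t ∈ S0, ∀ i ∈ t, ∀ j ∈ t, i ≠ j → G.Adj (f i) (f j) := by
    intro t ht i hi j hj hij
    rcases lt_or_gt_of_ne hij with h | h
    · exact hadj t ht i hi j hj h
    · exact (hadj t ht j hj i hi h).symm
  refine ⟨V0.image f, by simpa using hV, S0.image (fun t => t.image f),
    (X0.image (Sym2.map f)).filter (fun e => e ∈ G.edgeSet), ⟨?_, ?_⟩, ?_, ?_, ?_, ?_⟩
  · intro t ht0
    obtain ⟨t, ht, rfl⟩ := Finset.mem_image.1 ht0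
    refine ⟨?_, by rw [Finset.card_image_of_injective _ hf, hS t ht]⟩
    intro x hx y hy hxy
    simp only [Finset.coe_image, Set.mem_image, Finset.mem_coe] at hx hy
    obtain ⟨i, hi, rfl⟩ := hx
    obtain ⟨j, hj, rfl⟩ := hy
    exact hadj' t ht i hi j hj (fun h => hxy (by rw [h]))
  · intro t₁ h10 t₂ h20 hne
    obtain ⟨t₁, h1, rfl⟩ := Finset.mem_image.1 h10
    obtain ⟨t₂, h2, rfl⟩ := Finset.mem_image.1 h20
    rw [← Finset.image_inter _ _ hf, Finset.card_image_of_injective _ hf]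
    exact hS2 t₁ h1 t₂ h2 (fun h => hne (by rw [h]))
  · intro e he
    simp only [Finset.coe_filter, Set.mem_ofPred_eq] at he
    exact he.2
  · rw [Finset.card_image_of_injective _ (Finset.image_injective hf)]
    exact (Finset.card_filter_le _ _).trans (Finset.card_image_le.trans hX)
  · intro t ht x hx0 hxt
    obtain ⟨x, hx, rfl⟩ := Finset.mem_image.1 hx0
    have hcl := ht.1
    have hc3 := ht.2
    have hc2 : (t.erase (f x)).card = 2 := by rw [Finset.card_erase_of_mem hxt, hc3]
    obtain ⟨a, b, hab, h⟩ := Finset.card_eq_two.1 hc2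
    have ha : a ∈ t.erase (f x) := by simp [h]
    have hb : b ∈ t.erase (f x) := by simp [h]
    rw [Finset.mem_erase] at ha hb
    have A1 := hcl hxt ha.2 ha.1.symm
    have A2 := hcl hxt hb.2 hb.1.symm
    have A3 := hcl ha.2 hb.2 hab
    rw [SimpleGraph.deleteEdges_adj] at A1 A2 A3
    obtain ⟨i, hi, rfl⟩ := hN x hx a A1.1
    obtain ⟨j, hj, rfl⟩ := hN x hx b A2.1
    have aux : ∀ p q, s(p,q) ∈ X0 → G.Adj (f p) (f q) → s(f p, f q) ∈
        (((X0.image (Sym2.map f)).filter (fun e => e ∈ G.edgeSet) : Finset (Sym2 V)) : Set (Sym2 V)) := by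
      intro p q hpq hA
      simp only [Finset.coe_filter, Set.mem_ofPred_eq, Finset.mem_image]
      exact ⟨⟨_, hpq, rfl⟩, hA⟩
    rcases hcov x hx i hi j hj (fun h => hab (by rw [h])) with h | h | h
    · exact A1.2 (aux _ _ h A1.1)
    · exact A2.2 (aux _ _ h A2.1)
    · exact A3.2 (aux _ _ h A3.1)
  · intro t ht0 a ha b hb hab hau hbu
    obtain ⟨t, ht, rfl⟩ := Finset.mem_image.1 ht0
    obtain ⟨i, hi, rfl⟩ := Finset.mem_image.1 ha
    obtain ⟨j, hj, rfl⟩ := Finset.mem_image.1 hb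
    have hij : i ≠ j := fun h => hab (by rw [h])
    simp only [Finset.mem_filter, Finset.mem_image]
    refine ⟨⟨_, h3 t ht i hi j hj hij (fun h => hau (Finset.mem_image_of_mem _ h))
      (fun h => hbu (Finset.mem_image_of_mem _ h)), rfl⟩, hadj' t ht i hi j hj hij⟩

structure Irr (L : V → V → Prop) : Prop where
  symm : ∀ x y, L x y → L y x
  irrefl : ∀ x, ¬ L x x
  h1 : ∀ x y q, L x y → ∃ z t, L z t ∧ ¬(z = x ∧ t = y) ∧ ¬ (z = y ∧ t = x) ∧ z ≠ q ∧ t ≠ q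
  h2 : ∀ x y x' y' q q', L x y → L x' y' → x ≠ x' → x ≠ y' → y ≠ x' → y ≠ y' →
      ∃ z t, L z t ∧ ¬(z = x ∧ t = y) ∧ ¬ (z = y ∧ t = x) ∧
      ¬(z = x' ∧ t = y') ∧ ¬ (z = y' ∧ t = x') ∧
      z ≠ q ∧ t ≠ q ∧ z ≠ q' ∧ t ≠ q'
  h3 : ∀ x y x' y' x'' y'' q q' q'', L x y → L x' y' → L x'' y'' →
      x ≠ x' → x ≠ y' → y ≠ x' → y ≠ y' →
      x ≠ x'' → x ≠ y'' → y ≠ x'' → y ≠ y'' →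
      x' ≠ x'' → x' ≠ y'' → y' ≠ x'' → y' ≠ y'' →
      ∃ z t, L z t ∧ ¬(z = x ∧ t = y) ∧ ¬ (z = y ∧ t = x) ∧
      ¬(z = x' ∧ t = y') ∧ ¬ (z = y' ∧ t = x') ∧
      ¬(z = x'' ∧ t = y'') ∧ ¬ (z = y'' ∧ t = x'') ∧
      z ≠ q ∧ t ≠ q ∧ z ≠ q' ∧ t ≠ q' ∧ z ≠ q'' ∧ t ≠ q''

structure C5 (N : Finset V) (a b c d e : V) : Prop where
  nd : [a, b, c, d, e].Nodup
  en : ∀ x, x ∈ N ↔ x = a ∨ x = b ∨ x = c ∨ x = d ∨ x = e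

structure C6 (N : Finset V) (a b c d e f : V) : Prop where
  nd : [a, b, c, d, e, f].Nodup
  en : ∀ x, x ∈ N ↔ x = a ∨ x = b ∨ x = c ∨ x = d ∨ x = e ∨ x = f

lemma claim5 [DecidableEq V] (L : V → V → Prop) (I : Irr L) (N : Finset V)
    (hN : ∀ x y, L x y → x ∈ N ∧ y ∈ N)
    (hc1 : ∀ x ∈ N, ∃ y, L x y) (a b c d e : V) (C : C5 N a b c d e) :
    L a b ∨ L a c := by
  have hs := I.symm
  have hi := I.irrefl
  obtain ⟨nd, en⟩ := C
  simp only [List.nodup_cons, List.mem_cons, List.not_mem_nil, not_or, or_false] at nd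
  have key : ∀ x y x' y', L x y → L x' y' → x ≠ x' → x ≠ y' → y ≠ x' → y ≠ y' →
    ((x = b ∧ y = c) ∨ ¬ L b c) → L a b ∨ L a c := by
    intro x y x' y' h h' n1 n2 n3 n4 hh
    obtain ⟨z, t, hz⟩ := I.h2 x y x' y' d e h h' n1 n2 n3 n4
    have hzN := (en z).1 (hN z t hz.1).1
    have htN := (en t).1 (hN z t hz.1).2
    grind
  have star : ∀ d' e', (d' = d ∧ e' = e ∨ d' = e ∧ e' = d) → L a d' → ¬ L b c → L d' b → L d' c →
     L a b ∨ L a c := by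
    intro d' e' hde h1 h2 h3 h4
    by_cases hea : L e' a
    · exact key e' a d' b hea h3 (by grind) (by grind) (by grind) (by grind) (Or.inr h2)
    by_cases heb : L e' b
    · exact key e' b d' c heb h4 (by grind) (by grind) (by grind) (by grind) (Or.inr h2)
    by_cases hec : L e' c
    · exact key e' c d' b hec h3 (by grind) (by grind) (by grind) (by grind) (Or.inr h2)
    obtain ⟨z, t, hz⟩ := I.h1 a d' d' h1
    have hzN := (en z).1 (hN z t hz.1).1
    have htN := (en t).1 (hN z t hz.1).2
    grind
  have mem : ∀ x, L a x → L a b ∨ L a c ∨ L a d ∨ L a e := by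
    intro x hx
    have := (en x).1 (hN a x hx).2
    grind
  obtain ⟨x, hx⟩ := hc1 a (by grind)
  have nb : ∀ x, (x = b ∨ x = c) → ¬ L b c → L a b ∨ L a c ∨ L x d ∨ L x e := by
    intro x hx hbc
    obtain ⟨y, hy⟩ := hc1 x (by grind)
    have := (en y).1 (hN x y hy).2
    grind
  by_contra hcon
  by_cases hbc : L b c
  · rcases mem x hx with h | h | h | h
    · tauto
    · tauto
    · exact hcon (key b c a d hbc h (by grind) (by grind) (by grind) (by grind) (by grind))
    · exact hcon (key b c a e hbc h (by grind) (by grind) (by grind) (by grind) (by grind))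
  · have k1 := nb b (by grind) hbc
    have k2 := nb c (by grind) hbc
    have kk : ∀ x y z w, L x y → L z w → x ≠ z → x ≠ w → y ≠ z → y ≠ w → False :=
      fun x y z w h h' n1 n2 n3 n4 => hcon (key x y z w h h' n1 n2 n3 n4 (Or.inr hbc))
    rcases mem x hx with h | h | h | h
    · tauto
    · tauto
    · have u1 := kk a d b e h
      have u2 := kk a d c e h
      refine hcon (star d e (by grind) h hbc ?_ ?_) <;> grind
    · have u1 := kk a e b d h
      have u2 := kk a e c d h
      refine hcon (star e d (by grind) h hbc ?_ ?_) <;> grind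

lemma C6.K0 {L : V → V → Prop} (I : Irr L) {N : Finset V}
    (hN : ∀ x y, L x y → x ∈ N ∧ y ∈ N) {a b c d e f : V} (C : C6 N a b c d e f)
    (h : L a b) : L b c ∨ L b d ∨ L b e ∨ L b f ∨ L c d ∨ L c e ∨ L c f ∨ L d e ∨ L d f ∨ L e f := by
  have hs := I.symm
  have hi := I.irrefl
  obtain ⟨nd, en⟩ := C
  simp only [List.nodup_cons, List.mem_cons, List.not_mem_nil, not_or, or_false] at nd
  obtain ⟨z, t, hz⟩ := I.h1 a b a h
  have hzN := (en z).1 (hN z t hz.1).1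
  have htN := (en t).1 (hN z t hz.1).2
  grind

lemma C6.K1 {L : V → V → Prop} (I : Irr L) {N : Finset V}
    (hN : ∀ x y, L x y → x ∈ N ∧ y ∈ N) {a b c d e f : V} (C : C6 N a b c d e f)
    (h : L a b) (h' : L c d) : L b d ∨ L b e ∨ L b f ∨ L d e ∨ L d f ∨ L e f := by
  have hs := I.symm
  have hi := I.irrefl
  obtain ⟨nd, en⟩ := C
  simp only [List.nodup_cons, List.mem_cons, List.not_mem_nil, not_or, or_false] at nd
  obtain ⟨z, t, hz⟩ := I.h2 a b c d a c h h' (by grind) (by grind) (by grind) (by grind)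
  have hzN := (en z).1 (hN z t hz.1).1
  have htN := (en t).1 (hN z t hz.1).2
  grind

lemma C6.K2 {L : V → V → Prop} (I : Irr L) {N : Finset V}
    (hN : ∀ x y, L x y → x ∈ N ∧ y ∈ N) {a b c d e f : V} (C : C6 N a b c d e f)
    (h : L a b) (h' : L c d) : L b c ∨ L b d ∨ L b f ∨ L c f ∨ L d f := by
  have hs := I.symm
  have hi := I.irrefl
  obtain ⟨nd, en⟩ := C
  simp only [List.nodup_cons, List.mem_cons, List.not_mem_nil, not_or, or_false] at nd
  obtain ⟨z, t, hz⟩ := I.h2 a b c d a e h h' (by grind) (by grind) (by grind) (by grind)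
  have hzN := (en z).1 (hN z t hz.1).1
  have htN := (en t).1 (hN z t hz.1).2
  grind

lemma C6.K3 {L : V → V → Prop} (I : Irr L) {N : Finset V}
    (hN : ∀ x y, L x y → x ∈ N ∧ y ∈ N) {a b c d e f : V} (C : C6 N a b c d e f)
    (h : L a b) (h' : L c d) (h'' : L e f) : L a c ∨ L b c := by
  have hs := I.symm
  have hi := I.irrefl
  obtain ⟨nd, en⟩ := C
  simp only [List.nodup_cons, List.mem_cons, List.not_mem_nil, not_or, or_false] at nd
  obtain ⟨z, t, hz⟩ := I.h3 a b c d e f d e f h h' h'' (by grind) (by grind) (by grind) (by grind)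
    (by grind) (by grind) (by grind) (by grind) (by grind) (by grind) (by grind) (by grind)
  have hzN := (en z).1 (hN z t hz.1).1
  have htN := (en t).1 (hN z t hz.1).2
  grind

lemma C6.K4 {L : V → V → Prop} (I : Irr L) {N : Finset V}
    (hN : ∀ x y, L x y → x ∈ N ∧ y ∈ N) {a b c d e f a' b' c' d' e' f' : V}
    (C' : C6 N a' b' c' d' e' f')
    (h : L a' b') (h' : L c' d') (h'' : L e' f')
    (C : C6 N a b c d e f) :
    L a b ∨ L a c ∨ L b c := by
  have hs := I.symm
  have hi := I.irrefl
  obtain ⟨nd, en⟩ := C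
  obtain ⟨nd', en'⟩ := C'
  simp only [List.nodup_cons, List.mem_cons, List.not_mem_nil, not_or, or_false] at nd nd'
  obtain ⟨z, t, hz⟩ := I.h3 a' b' c' d' e' f' d e f h h' h'' (by grind) (by grind) (by grind) (by grind)
    (by grind) (by grind) (by grind) (by grind) (by grind) (by grind) (by grind) (by grind)
  have hzN := (en z).1 (hN z t hz.1).1
  have htN := (en t).1 (hN z t hz.1).2
  clear en en' hN nd' 
  grind

lemma C6.K5 [DecidableEq V] {L : V → V → Prop} {N : Finset V}
    (hN : ∀ x y, L x y → x ∈ N ∧ y ∈ N) 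
    (hconn : ∀ A : Finset V, A ⊆ N → A.Nonempty → A.card ≤ 4 → ∃ x ∈ A, ∃ y, y ∉ A ∧ L x y) 
    {a b c d e f : V} (C : C6 N a b c d e f) :
    L a d ∨ L a e ∨ L a f ∨ L b d ∨ L b e ∨ L b f ∨ L c d ∨ L c e ∨ L c f := by
  obtain ⟨nd, en⟩ := C
  obtain ⟨x, hx, y, hy, hxy⟩ := hconn {a,b,c} (by intro x; simp [en]; grind) (by simp)
    (Finset.card_le_three.trans (by norm_num))
  have hyN := (en y).1 (hN x y hxy).2
  simp only [Finset.mem_insert, Finset.mem_singleton] at hx hy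
  grind

lemma C6.K6 {L : V → V → Prop} {N : Finset V} (I : Irr L)
    (hN : ∀ x y, L x y → x ∈ N ∧ y ∈ N) 
    (hconn : ∀ A : Finset V, A ⊆ N → A.Nonempty → A.card ≤ 4 → ∃ x ∈ A, ∃ y, y ∉ A ∧ L x y) 
    {a b c d e f : V} (C : C6 N a b c d e f) :
    L a b ∨ L a c ∨ L a d ∨ L a e ∨ L a f := by
  have hi := I.irrefl
  obtain ⟨nd, en⟩ := C
  obtain ⟨x, hx, y, hy, hxy⟩ := hconn {a} (by intro x; simp [en]; grind) (by simp)
    (by simp)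
  have hyN := (en y).1 (hN x y hxy).2
  simp only [Finset.mem_singleton] at hx hy
  grind


lemma C6.perm {N : Finset V} {a b c d e f a' b' c' d' e' f' : V} (C : C6 N a b c d e f)
    (h0 : ({a'} + {b'} + {c'} + {d'} + {e'} + {f'} : Multiset V) = {a} + {b} + {c} + {d} + {e} + {f}) :
    C6 N a' b' c' d' e' f' := by
  have h : [a', b', c', d', e', f'].Perm [a, b, c, d, e, f] := by
    rw [← Multiset.coe_eq_coe]
    simp only [← Multiset.cons_coe, Multiset.coe_nil, ← Multiset.singleton_add, add_zero]
    simpa only [add_assoc] using h0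
  obtain ⟨nd, en⟩ := C
  refine ⟨h.nodup_iff.2 nd, fun x => ?_⟩
  have := h.mem_iff (a := x)
  simp only [List.mem_cons, List.not_mem_nil, or_false] at this
  rw [en, this]

section six
variable [DecidableEq V] {L : V → V → Prop} {N : Finset V}

lemma pmC1 (I : Irr L) (hN : ∀ x y, L x y → x ∈ N ∧ y ∈ N)
    (hpm : ∀ a b c d e f, C6 N a b c d e f → L a b → L c d → L e f → False)
    {a b c d e f : V} (C : C6 N a b c d e f) (ab : L a b) (cd : L c d) (ea : L e a) (fa : L f a) :
    False := by
  have hs := I.symm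
  have n1 : ¬ L e f := hpm a b c d e f C ab cd
  have n2 : ¬ L e b := fun h => hpm e b f a c d (C.perm (by abel)) h fa cd
  have n3 : ¬ L f b := fun h => hpm f b e a c d (C.perm (by abel)) h ea cd
  have n4 := hpm e c f d a b (C.perm (by abel))
  have n5 := hpm e d f c a b (C.perm (by abel))
  have m1 := hpm e a b d c f (C.perm (by abel)) ea
  have m2 := hpm e a b c d f (C.perm (by abel)) ea
  have m3 := hpm f a b d c e (C.perm (by abel)) fa
  have m4 := hpm f a b c d e (C.perm (by abel)) fa
  have k1 := C.K1 I hN ab cd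
  have k2 := (C.perm (by abel) : C6 N a b d c e f).K1 I hN ab (hs _ _ cd)
  have k3 := C.K2 I hN ab cd
  have k4 := (C.perm (by abel) : C6 N a b c d f e).K2 I hN ab cd
  have k5 := (C.perm (by abel) : C6 N a e c d b f).K2 I hN (hs _ _ ea) cd
  clear hpm hN
  have r1 := hs b d
  have r2 := hs b e
  have r3 := hs b f
  have r4 := hs d e
  have r5 := hs e d
  have r6 := hs d f
  have r7 := hs f d
  have r8 := hs c e
  have r9 := hs e c
  have r10 := hs c f
  have r11 := hs f c
  clear hs I C
  grind

lemma pmC2 (I : Irr L) (hN : ∀ x y, L x y → x ∈ N ∧ y ∈ N)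
    (hconn : ∀ A : Finset V, A ⊆ N → A.Nonempty → A.card ≤ 4 → ∃ x ∈ A, ∃ y, y ∉ A ∧ L x y) 
    (hpm : ∀ a b c d e f, C6 N a b c d e f → L a b → L c d → L e f → False)
    {a b c d e f : V} (C : C6 N a b c d e f) (ab : L a b) (cd : L c d) (ea : L e a) (fc : L f c) :
    False := by
  have hs := I.symm
  have n1 : ¬ L e f := hpm a b c d e f C ab cd
  have n2 : ¬ L e c := fun h => pmC1 I hN hpm (C.perm (by abel) : C6 N c d a b e f) cd ab h fc
  have n3 : ¬ L f a := fun h => pmC1 I hN hpm C ab cd ea h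
  have n4 : ¬ L e d := fun h => hpm e d f c a b (C.perm (by abel)) h fc ab
  have n5 : ¬ L f b := fun h => hpm e a f b c d (C.perm (by abel)) ea h cd
  have n6 : ¬ L b d := fun h => hpm e a b d c f (C.perm (by abel)) ea h (hs _ _ fc)
  have m1 := hpm e b a d c f (C.perm (by abel))
  have m2 := hpm e a b c d f (C.perm (by abel)) ea
  have m3 := hpm e b a c d f (C.perm (by abel))
  have k1 := C.K1 I hN ab cd
  have k2 := (C.perm (by abel) : C6 N c d a b e f).K2 I hN cd ab
  have k3 := (C.perm (by abel) : C6 N a b c d f e).K2 I hN ab cd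
  have k5 := (C.perm (by abel) : C6 N a b e c d f).K5 hN hconn
  clear hpm hN hconn
  have r1 := hs b e
  have r2 := hs b f
  have r3 := hs d e
  have r4 := hs d f
  have r5 := hs f d
  have r6 := hs c f
  have r7 := hs f c
  have r8 := hs d a
  have r9 := hs d b
  have r10 := hs a f
  have r11 := hs b c
  have r12 := hs c b
  have r13 := hs c e
  clear hs I C
  grind

lemma pmC3 (I : Irr L) (hN : ∀ x y, L x y → x ∈ N ∧ y ∈ N)
    (hconn : ∀ A : Finset V, A ⊆ N → A.Nonempty → A.card ≤ 4 → ∃ x ∈ A, ∃ y, y ∉ A ∧ L x y) 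
    (hpm : ∀ a b c d e f, C6 N a b c d e f → L a b → L c d → L e f → False)
    {a b c d e f : V} (C : C6 N a b c d e f) (ab : L a b) (cd : L c d) :
    False := by
  have hs := I.symm
  have n1 : ¬ L e f := hpm a b c d e f C ab cd
  have main : ∀ a b c d, C6 N a b c d e f → L a b → L c d → L e a → False := by
    intro a b c d C ab cd ea
    rcases (C.perm (by abel) : C6 N f a b c d e).K6 I hN hconn with h | h | h | h | h
    · exact pmC1 I hN hpm C ab cd ea h
    · exact hpm e a f b c d (C.perm (by abel)) ea h cd
    · exact pmC2 I hN hconn hpm C ab cd ea h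
    · exact pmC2 I hN hconn hpm (C.perm (by abel) : C6 N a b d c e f) ab (hs _ _ cd) ea h
    · exact n1 (hs _ _ h)
  rcases (C.perm (by abel) : C6 N e a b c d f).K6 I hN hconn with h | h | h | h | h
  · exact main a b c d C ab cd h
  · exact main b a c d (C.perm (by abel)) (hs _ _ ab) cd h
  · exact main c d a b (C.perm (by abel)) cd ab h
  · exact main d c a b (C.perm (by abel)) (hs _ _ cd) ab h
  · exact n1 h

lemma pm4 (I : Irr L) (hN : ∀ x y, L x y → x ∈ N ∧ y ∈ N)
    (hconn : ∀ A : Finset V, A ⊆ N → A.Nonempty → A.card ≤ 4 → ∃ x ∈ A, ∃ y, y ∉ A ∧ L x y) 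
    (hpm : ∀ a b c d e f, C6 N a b c d e f → L a b → L c d → L e f → False)
    {a b c d e f : V} (C : C6 N a b c d e f) : False := by
  have hs := I.symm
  have h2 : ∀ a b c d e f, C6 N a b c d e f → L a b → L c d → False :=
    fun a b c d e f C => pmC3 I hN hconn hpm C
  have star : ∀ a b c d e f, C6 N a b c d e f → L a b → L c a → False := by
    intro a b c d e f C ab ca
    have k0 := C.K0 I hN ab
    have k1 := (C.perm (by abel) : C6 N a c b d e f).K0 I hN (hs _ _ ca)
    have q1 := h2 a b c d e f C ab
    have q2 := h2 a b c e d f (C.perm (by abel)) ab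
    have q3 := h2 a b c f d e (C.perm (by abel)) ab
    have q4 := h2 a b d e c f (C.perm (by abel)) ab
    have q5 := h2 a b d f c e (C.perm (by abel)) ab
    have q6 := h2 a b e f c d (C.perm (by abel)) ab
    have q7 := h2 c a b d e f (C.perm (by abel)) ca
    have q8 := h2 c a b e d f (C.perm (by abel)) ca
    have q9 := h2 c a b f d e (C.perm (by abel)) ca
    have bc : L b c := by clear h2 hpm hN hconn; grind
    rcases (C.perm (by abel) : C6 N d a b c e f).K6 I hN hconn with h | h | h | h | h
    · exact h2 d a b c e f (C.perm (by abel)) h bc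
    · exact q7 (hs _ _ h)
    · exact q1 (hs _ _ h)
    · exact q4 h
    · exact q5 h
  have main : ∀ a b c d e f, C6 N a b c d e f → L a b → False := by
    intro a b c d e f C ab
    rcases (C.perm (by abel) : C6 N c a b d e f).K6 I hN hconn with h | h | h | h | h
    · exact star a b c d e f C ab h
    · exact star b a c d e f (C.perm (by abel)) (hs _ _ ab) h
    · exact h2 a b c d e f C ab h
    · exact h2 a b c e d f (C.perm (by abel)) ab h
    · exact h2 a b c f d e (C.perm (by abel)) ab h
  rcases C.K6 I hN hconn with h | h | h | h | h
  · exact main a b c d e f C h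
  · exact main a c b d e f (C.perm (by abel)) h
  · exact main a d b c e f (C.perm (by abel)) h
  · exact main a e b c d f (C.perm (by abel)) h
  · exact main a f b c d e (C.perm (by abel)) h

lemma claim6 (I : Irr L) (hN : ∀ x y, L x y → x ∈ N ∧ y ∈ N)
    (hconn : ∀ A : Finset V, A ⊆ N → A.Nonempty → A.card ≤ 4 → ∃ x ∈ A, ∃ y, y ∉ A ∧ L x y) 
    (a b c d e f : V) (C : C6 N a b c d e f) : L a b ∨ L a c := by
  have hs := I.symm
  have hpm : ∃ a b c d e f, C6 N a b c d e f ∧ L a b ∧ L c d ∧ L e f := by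
    by_contra hcon
    exact pm4 I hN hconn (fun a b c d e f C h1 h2 h3 => hcon ⟨a, b, c, d, e, f, C, h1, h2, h3⟩) C
  obtain ⟨a', b', c', d', e', f', C', e1, e2, e3⟩ := hpm
  have noI : ∀ a b c d e f, C6 N a b c d e f → L a b ∨ L a c ∨ L b c :=
    fun a b c d e f C => C6.K4 I hN C' e1 e2 e3 C
  have K3 : ∀ a b c d e f, C6 N a b c d e f → L a b → L c d → L e f → L a c ∨ L b c :=
    fun a b c d e f C => C.K3 I hN
  clear e1 e2 e3 C'
  by_contra hcon
  push Not at hcon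
  obtain ⟨ab, ac⟩ := hcon
  have bc : L b c := by
    have := noI a b c d e f C
    tauto
  have main : ∀ d e f, C6 N a b c d e f → L a d → L a e → False := by
    intro d e f C ad ae
    have x1 := K3 b c a d e f (C.perm (by abel)) bc ad
    have x2 := K3 b c a e d f (C.perm (by abel)) bc ae
    have x3 := K3 b c a f d e (C.perm (by abel)) bc
    have hsba := hs b a
    have hsca := hs c a
    have ef : ¬ L e f := by tauto
    have df : ¬ L d f := by tauto
    have de : L d e := by
      have := noI d e f a b c (C.perm (by abel))
      tauto
    have af : ¬ L a f := by tauto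
    have bf : L b f := by
      have := noI a b f c d e (C.perm (by abel))
      tauto
    have cf : L c f := by
      have := noI a c f b d e (C.perm (by abel))
      tauto
    have hsfa := hs f a
    have y1 := K3 b f a d c e (C.perm (by abel)) bf ad
    have y2 := K3 b f a e c d (C.perm (by abel)) bf ae
    have y3 := K3 c f a d b e (C.perm (by abel)) cf ad
    have y4 := K3 c f a e b d (C.perm (by abel)) cf ae
    have z := (C.perm (by abel) : C6 N b c f a d e).K5 hN hconn
    have hse := hs f e
    have hsd := hs f d
    clear noI K3 hN hconn hs I C
    grind
  have two : ∀ d e f, C6 N a b c d e f → L a d → False := by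
    intro d e f C ad
    by_cases ae : L a e
    · exact main d e f C ad ae
    by_cases af : L a f
    · exact main d f e (C.perm (by abel)) ad af
    have ef := noI a e f b c d (C.perm (by abel))
    have x1 := K3 b c a d e f (C.perm (by abel)) bc ad
    have hsba := hs b a
    have hsca := hs c a
    tauto
  rcases C.K6 I hN hconn with h | h | h | h | h
  · exact ab h
  · exact ac h
  · exact two d e f C h
  · exact two e d f (C.perm (by abel)) h
  · exact two f d e (C.perm (by abel)) h

end six

lemma transfer2 [DecidableEq V] (G : SimpleGraph V) {n : ℕ} (f : Fin (n+2) → V)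
    (S0 : Finset (Finset (Fin (n+2))))
    (X0 : Finset (Sym2 (Fin (n+2)))) (NU NW : Finset (Fin (n+2))) (E0 : List (Fin (n+2) × Fin (n+2)))
    (hS : ∀ t ∈ S0, t.card = 3)
    (hS2 : ∀ t₁ ∈ S0, ∀ t₂ ∈ S0, t₁ ≠ t₂ → (t₁ ∩ t₂).card ≤ 1)
    (hX : X0.card ≤ 2 * S0.card)
    (hcu : ∀ i ∈ NU, ∀ j ∈ NU, i ≠ j → s(0,i) ∈ X0 ∨ s(0,j) ∈ X0 ∨ s(i,j) ∈ X0)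
    (hcw : ∀ i ∈ NW, ∀ j ∈ NW, i ≠ j → s(1,i) ∈ X0 ∨ s(1,j) ∈ X0 ∨ s(i,j) ∈ X0)
    (h3 : ∀ t ∈ S0, ∀ i ∈ t, ∀ j ∈ t, i ≠ j → i ∉ ({0,1} : Finset (Fin (n+2))) →
      j ∉ ({0,1} : Finset (Fin (n+2))) → s(i,j) ∈ X0)
    (hE : ∀ t ∈ S0, ∀ i ∈ t, ∀ j ∈ t, i < j → (i,j) ∈ E0)
    (hf : (List.ofFn f).Nodup)
    (hadj : ∀ p ∈ E0, G.Adj (f p.1) (f p.2))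
    (hNU : ∀ y, G.Adj (f 0) y → ∃ i ∈ NU, f i = y)
    (hNW : ∀ y, G.Adj (f 1) y → ∃ i ∈ NW, f i = y) :
    ∃ V₀ : Finset V, ReducibleVertexSet G V₀ := by
  have h10 : (1 : Fin (n+2)) ≠ 0 := by simp
  refine transfer G f (List.nodup_ofFn.1 hf) {0,1} S0 X0 (fun i => if i = 0 then NU else NW)
    (by simp) hS hS2 hX ?_ h3 (fun t ht i hi j hj hij => hadj _ (hE t ht i hi j hj hij)) ?_
  · intro x hx
    simp only [Finset.mem_insert, Finset.mem_singleton] at hx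
    rcases hx with rfl | rfl
    · simpa using hcu
    · simpa [h10] using hcw
  · intro x hx
    simp only [Finset.mem_insert, Finset.mem_singleton] at hx
    rcases hx with rfl | rfl
    · simpa using hNU
    · simpa [h10] using hNW

set_option maxRecDepth 100000 in
lemma case5 [DecidableEq V] (G : SimpleGraph V) (u w a b c d x : V)
    (nd : [u, w, a, b, c, d, x].Nodup) (uw : G.Adj u w)
    (hu : ∀ y ∈ [a, b, c, d, x], G.Adj u y) (hw : ∀ y ∈ [a, b, c, d, x], G.Adj w y)
    (ac : G.Adj a c) (ad : G.Adj a d) (bc : G.Adj b c) (bd : G.Adj b d)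
    (hNu : ∀ y, G.Adj u y → y ∈ [w, a, b, c, d, x])
    (hNw : ∀ y, G.Adj w y → y ∈ [u, a, b, c, d, x]) :
    ∃ V₀ : Finset V, ReducibleVertexSet G V₀ := by
  simp only [List.mem_cons, List.not_mem_nil, or_false] at hu hw hNu hNw
  refine transfer2 G (n := 5) ![u, w, a, b, c, d, x]
    {{0,1,6},{0,2,4},{0,3,5},{1,3,4},{1,2,5}}
    {s(0,1),s(0,6),s(1,6),s(2,3),s(2,4),s(2,5),s(3,4),s(3,5),s(4,5)}
    {1,2,3,4,5,6} {0,2,3,4,5,6}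
    [(0,1),(0,6),(1,6),(0,2),(0,4),(2,4),(0,3),(0,5),(3,5),(1,3),(1,4),(3,4),(1,2),(1,5),(2,5)]
    (by decide) (by decide) (by decide) (by decide) (by decide) (by decide) (by decide)
    (by simpa [List.ofFn_succ] using nd) ?_ ?_ ?_
  · simp; grind [SimpleGraph.Adj.symm]
  · intro y hy; have := hNu y hy; simp; grind
  · intro y hy; have := hNw y hy; simp; grind

set_option maxRecDepth 100000 in
lemma case4a [DecidableEq V] (G : SimpleGraph V) (u w a b c d : V)
    (nd : [u, w, a, b, c, d].Nodup)
    (hu : ∀ y ∈ [a, b, c, d], G.Adj u y) (hw : ∀ y ∈ [a, b, c, d], G.Adj w y)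
    (ac : G.Adj a c) (ad : G.Adj a d) (bc : G.Adj b c) (bd : G.Adj b d)
    (hNu : ∀ y, G.Adj u y → y ∈ [w, a, b, c, d])
    (hNw : ∀ y, G.Adj w y → y ∈ [u, a, b, c, d]) :
    ∃ V₀ : Finset V, ReducibleVertexSet G V₀ := by
  simp only [List.mem_cons, List.not_mem_nil, or_false] at hu hw hNu hNw
  refine transfer2 G (n := 4) ![u, w, a, b, c, d]
    {{0,2,4},{0,3,5},{1,3,4},{1,2,5}}
    {s(0,1),s(2,3),s(2,4),s(2,5),s(3,4),s(3,5),s(4,5)}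
    {1,2,3,4,5} {0,2,3,4,5}
    [(0,2),(0,4),(2,4),(0,3),(0,5),(3,5),(1,3),(1,4),(3,4),(1,2),(1,5),(2,5)]
    (by decide) (by decide) (by decide) (by decide) (by decide) (by decide) (by decide)
    (by simpa [List.ofFn_succ] using nd) ?_ ?_ ?_
  · simp; grind [SimpleGraph.Adj.symm]
  · intro y hy; have := hNu y hy; simp; grind
  · intro y hy; have := hNw y hy; simp; grind

set_option maxRecDepth 100000 in
lemma case4b [DecidableEq V] (G : SimpleGraph V) (u w a b c d p : V)
    (nd : [u, w, a, b, c, d, p].Nodup)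
    (hu : ∀ y ∈ [a, b, c, d], G.Adj u y) (hw : ∀ y ∈ [a, b, c, d], G.Adj w y)
    (ac : G.Adj a c) (ad : G.Adj a d) (bc : G.Adj b c) (bd : G.Adj b d)
    (hNu : ∀ y, G.Adj u y → y ∈ [w, a, b, c, d, p])
    (hNw : ∀ y, G.Adj w y → y ∈ [u, a, b, c, d]) :
    ∃ V₀ : Finset V, ReducibleVertexSet G V₀ := by
  simp only [List.mem_cons, List.not_mem_nil, or_false] at hu hw hNu hNw
  refine transfer2 G (n := 5) ![u, w, a, b, c, d, p]
    {{0,2,4},{0,3,5},{1,3,4},{1,2,5}}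
    {s(0,1),s(0,6),s(2,3),s(2,4),s(2,5),s(3,4),s(3,5),s(4,5)}
    {1,2,3,4,5,6} {0,2,3,4,5}
    [(0,2),(0,4),(2,4),(0,3),(0,5),(3,5),(1,3),(1,4),(3,4),(1,2),(1,5),(2,5)]
    (by decide) (by decide) (by decide) (by decide) (by decide) (by decide) (by decide)
    (by simpa [List.ofFn_succ] using nd) ?_ ?_ ?_
  · simp; grind [SimpleGraph.Adj.symm]
  · intro y hy; have := hNu y hy; simp; grind
  · intro y hy; have := hNw y hy; simp; grind

set_option maxRecDepth 100000 in
lemma case4c [DecidableEq V] (G : SimpleGraph V) (u w a b c d p r : V)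
    (nd : [u, w, a, b, c, d, p, r].Nodup) (uw : G.Adj u w)
    (hu : ∀ y ∈ [a, b, c, d, p], G.Adj u y) (hw : ∀ y ∈ [a, b, c, d, r], G.Adj w y)
    (db : G.Adj d b) (dc : G.Adj d c) (pb : G.Adj p b) (rc : G.Adj r c)
    (hNu : ∀ y, G.Adj u y → y ∈ [w, a, b, c, d, p])
    (hNw : ∀ y, G.Adj w y → y ∈ [u, a, b, c, d, r]) :
    ∃ V₀ : Finset V, ReducibleVertexSet G V₀ := by
  simp only [List.mem_cons, List.not_mem_nil, or_false] at hu hw hNu hNw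
  refine transfer2 G (n := 6) ![u, w, a, b, c, d, p, r]
    {{0,1,2},{0,3,6},{0,4,5},{1,4,7},{1,3,5}}
    {s(0,1),s(0,6),s(1,7),s(0,2),s(1,2),s(3,6),s(4,5),s(4,7),s(3,5),s(3,4)}
    {1,2,3,4,5,6} {0,2,3,4,5,7}
    [(0,1),(0,2),(1,2),(0,3),(0,6),(3,6),(0,4),(0,5),(4,5),(1,4),(1,7),(4,7),(1,3),(1,5),(3,5)]
    (by decide) (by decide) (by decide) (by decide) (by decide) (by decide) (by decide)
    (by simpa [List.ofFn_succ] using nd) ?_ ?_ ?_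
  · simp; grind [SimpleGraph.Adj.symm]
  · intro y hy; have := hNu y hy; simp; grind
  · intro y hy; have := hNw y hy; simp; grind

set_option maxRecDepth 100000 in
lemma case3 [DecidableEq V] (G : SimpleGraph V) (u w a b c p r : V)
    (nd : [u, w, a, b, c, p, r].Nodup)
    (hu : ∀ y ∈ [a, b, c, p], G.Adj u y) (hw : ∀ y ∈ [a, b, c, r], G.Adj w y)
    (bc : G.Adj c b) (ac : G.Adj c a) (pa : G.Adj p a) (rb : G.Adj r b)
    (hNu : ∀ y, G.Adj u y → y ∈ [w, a, b, c, p])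
    (hNw : ∀ y, G.Adj w y → y ∈ [u, a, b, c, r]) :
    ∃ V₀ : Finset V, ReducibleVertexSet G V₀ := by
  simp only [List.mem_cons, List.not_mem_nil, or_false] at hu hw hNu hNw
  refine transfer2 G (n := 5) ![u, w, a, b, c, p, r]
    {{0,2,5},{0,3,4},{1,3,6},{1,2,4}}
    {s(0,1),s(0,5),s(1,6),s(2,3),s(3,4),s(2,4),s(2,5),s(3,6)}
    {1,2,3,4,5} {0,2,3,4,6}
    [(0,2),(0,5),(2,5),(0,3),(0,4),(3,4),(1,3),(1,6),(3,6),(1,2),(1,4),(2,4)]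
    (by decide) (by decide) (by decide) (by decide) (by decide) (by decide) (by decide)
    (by simpa [List.ofFn_succ] using nd) ?_ ?_ ?_
  · simp; grind [SimpleGraph.Adj.symm]
  · intro y hy; have := hNu y hy; simp; grind
  · intro y hy; have := hNw y hy; simp; grind

lemma irr_of [DecidableEq V] (G : SimpleGraph V) (hno : ¬ ∃ V₀ : Finset V, ReducibleVertexSet G V₀)
    (u : V) : Irr (Lk G u) where
  symm := fun _ _ h => h.symm'
  irrefl := fun x h => G.loopless.irrefl x h.2.2
  h1 := irr1 G hno u
  h2 := irr2 G hno u
  h3 := irr3 G hno u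

lemma low_card [Fintype V] [DecidableEq V] (G : SimpleGraph V) (hrob : Robust G) (u : V)
    (N : Finset V) (hN : ∀ x, x ∈ N ↔ G.Adj u x) (hne : N.Nonempty) : 5 ≤ N.card := by
  by_contra hlt
  obtain ⟨x, hx, y, hy, h⟩ := conn_of_robust G hrob u N hne (fun x => (hN x).1) (by omega)
  exact hy ((hN y).2 h.2.1)

lemma low_matching [Fintype V] [DecidableEq V] (G : SimpleGraph V) (hrob : Robust G)
    (hno : ¬ ∃ V₀ : Finset V, ReducibleVertexSet G V₀) (u : V)
    (N : Finset V) (hN : ∀ x, x ∈ N ↔ G.Adj u x) (hc : N.card ≤ 6)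
    (a b c : V) (ha : a ∈ N) (hb : b ∈ N) (hcN : c ∈ N) (hab : a ≠ b) (hac : a ≠ c) (hbc : b ≠ c) :
    G.Adj a b ∨ G.Adj a c := by
  have h5 := low_card G hrob u N hN ⟨a, ha⟩
  have I := irr_of G hno u
  have hL : ∀ x y, Lk G u x y → x ∈ N ∧ y ∈ N := fun x y h => ⟨(hN x).2 h.1, (hN y).2 h.2.1⟩
  have hconn : ∀ A : Finset V, A ⊆ N → A.Nonempty → A.card ≤ 4 → ∃ x ∈ A, ∃ y, y ∉ A ∧ Lk G u x y :=
    fun A h1 h2 h3 => conn_of_robust G hrob u A h2 (fun x hx => (hN x).1 (h1 hx)) h3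
  have hsub : ({a,b,c} : Finset V) ⊆ N := by
    intro x; simp; rintro (rfl | rfl | rfl) <;> assumption
  have h3 : ({a,b,c} : Finset V).card = 3 := Finset.card_eq_three.2 ⟨a, b, c, hab, hac, hbc, rfl⟩
  have hsd := Finset.card_sdiff_add_card_eq_card hsub
  have hmem : ∀ x, x ∈ N ↔ x = a ∨ x = b ∨ x = c ∨ x ∈ N \ {a,b,c} := by
    intro x; simp only [Finset.mem_sdiff, Finset.mem_insert, Finset.mem_singleton]; grind
  have hnm : ∀ x ∈ N \ {a,b,c}, x ≠ a ∧ x ≠ b ∧ x ≠ c := by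
    intro x; simp
  have key : Lk G u a b ∨ Lk G u a c := by
    have : N.card = 5 ∨ N.card = 6 := by omega
    rcases this with h | h
    · obtain ⟨d, e, hde, heq⟩ := Finset.card_eq_two.1 (show (N \ {a,b,c}).card = 2 by omega)
      rw [heq] at hmem hnm
      simp only [Finset.mem_insert, Finset.mem_singleton] at hmem hnm
      refine claim5 (Lk G u) I N hL ?_ a b c d e ⟨by simp; grind, hmem⟩
      intro x hx
      obtain ⟨x', hx', y, hy, h⟩ := hconn {x} (by simpa using hx) (by simp) (by simp)
      simp at hx'
      subst hx'
      exact ⟨y, h⟩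
    · obtain ⟨d, e, f, hde, hdf, hef, heq⟩ := Finset.card_eq_three.1 (show (N \ {a,b,c}).card = 3 by omega)
      rw [heq] at hmem hnm
      simp only [Finset.mem_insert, Finset.mem_singleton] at hmem hnm
      exact claim6 I hL hconn a b c d e f ⟨by simp; grind, hmem⟩
  exact key.imp (fun h => h.2.2) (fun h => h.2.2)

lemma quad [DecidableEq V] (G : SimpleGraph V) (C : Finset V) (hc : C.card = 4)
    (h : ∀ x ∈ C, ∀ y ∈ C, ∀ z ∈ C, x ≠ y → x ≠ z → y ≠ z → G.Adj x y ∨ G.Adj x z) :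
    ∃ a b c d, C = {a, b, c, d} ∧ [a, b, c, d].Nodup ∧ G.Adj a c ∧ G.Adj a d ∧ G.Adj b c ∧
      G.Adj b d := by
  obtain ⟨a, b, c, d, h1, h2, h3, h4, h5, h6, rfl⟩ := Finset.card_eq_four.1 hc
  have sy : ∀ x y, G.Adj x y → G.Adj y x := fun x y h => h.symm
  have key : (G.Adj a c ∧ G.Adj a d ∧ G.Adj b c ∧ G.Adj b d) ∨
      (G.Adj a b ∧ G.Adj a d ∧ G.Adj c b ∧ G.Adj c d) ∨
      (G.Adj a b ∧ G.Adj a c ∧ G.Adj d b ∧ G.Adj d c) := by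
    have i1 := h a (by simp) b (by simp) c (by simp) h1 h2 h4
    have i2 := h a (by simp) b (by simp) d (by simp) h1 h3 h5
    have i3 := h a (by simp) c (by simp) d (by simp) h2 h3 h6
    have i4 := h b (by simp) a (by simp) c (by simp) h1.symm h4 h2
    have i5 := h b (by simp) a (by simp) d (by simp) h1.symm h5 h3
    have i6 := h b (by simp) c (by simp) d (by simp) h4 h5 h6
    have i7 := h c (by simp) a (by simp) b (by simp) h2.symm h4.symm h1
    have i8 := h c (by simp) a (by simp) d (by simp) h2.symm h6 h3
    have i9 := h c (by simp) b (by simp) d (by simp) h4.symm h6 h5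
    have j7 := h d (by simp) a (by simp) b (by simp) h3.symm h5.symm h1
    have j8 := h d (by simp) a (by simp) c (by simp) h3.symm h6.symm h2
    have j9 := h d (by simp) b (by simp) c (by simp) h5.symm h6.symm h4
    rw [G.adj_comm b a] at *
    rw [G.adj_comm c a] at *
    rw [G.adj_comm c b] at *
    rw [G.adj_comm d a, G.adj_comm d b] at *
    rw [G.adj_comm d c] at *
    clear h sy
    grind
  rcases key with k | k | k
  · exact ⟨a, b, c, d, rfl, by simp; grind, k⟩
  · exact ⟨a, c, b, d, by ext x; simp; grind, by simp; grind, k⟩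
  · exact ⟨a, d, b, c, by ext x; simp; grind, by simp; grind, k⟩

lemma adj_low [Fintype V] [DecidableEq V] (G : SimpleGraph V) (hrob : Robust G)
    (hno : ¬ ∃ V₀ : Finset V, ReducibleVertexSet G V₀) (u w : V)
    (Nu : Finset V) (hNu : ∀ x, x ∈ Nu ↔ G.Adj u x) (hcu : Nu.card ≤ 6)
    (Nw : Finset V) (hNw : ∀ x, x ∈ Nw ↔ G.Adj w x) (hcw : Nw.card ≤ 6) (uw : G.Adj u w) :
    False := by
  have mu := low_matching G hrob hno u Nu hNu hcu
  have mw := low_matching G hrob hno w Nw hNw hcw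
  have h5u := low_card G hrob u Nu hNu ⟨w, (hNu w).2 uw⟩
  have h5w := low_card G hrob w Nw hNw ⟨u, (hNw u).2 uw.symm⟩
  have uu : u ∉ Nu := fun h => G.loopless.irrefl u ((hNu u).1 h)
  have ww : w ∉ Nw := fun h => G.loopless.irrefl w ((hNw w).1 h)
  have wu : w ∈ Nu := (hNu w).2 uw
  have uw' : u ∈ Nw := (hNw u).2 uw.symm
  have hne : u ≠ w := uw.ne
  obtain ⟨C, hC⟩ : ∃ C, C = Nu ∩ Nw := ⟨_, rfl⟩
  obtain ⟨P, hP⟩ : ∃ P, P = (Nu \ Nw).erase w := ⟨_, rfl⟩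
  obtain ⟨R, hR⟩ : ∃ R, R = (Nw \ Nu).erase u := ⟨_, rfl⟩
  have c1 : Nu.card = C.card + P.card + 1 := by
    have := Finset.card_inter_add_card_sdiff Nu Nw
    have h2 := Finset.card_erase_add_one (show w ∈ Nu \ Nw by simp [wu, ww])
    rw [hC, hP]; omega
  have c2 : Nw.card = C.card + R.card + 1 := by
    have := Finset.card_inter_add_card_sdiff Nw Nu
    have h2 := Finset.card_erase_add_one (show u ∈ Nw \ Nu by simp [uw', uu])
    rw [Finset.inter_comm] at this
    rw [hC, hR]; omega
  have mC : ∀ x, x ∈ C ↔ x ∈ Nu ∧ x ∈ Nw := by rw [hC]; simp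
  have mP : ∀ x, x ∈ P ↔ x ≠ w ∧ x ∈ Nu ∧ x ∉ Nw := by rw [hP]; simp
  have mR : ∀ x, x ∈ R ↔ x ≠ u ∧ x ∈ Nw ∧ x ∉ Nu := by rw [hR]; simp
  have p1 : P.card ≤ 1 := by
    by_contra hlt
    obtain ⟨a, ha, b, hb, hab⟩ := Finset.one_lt_card.1 (not_le.1 hlt)
    rw [mP] at ha hb
    have := mu w a b wu ha.2.1 hb.2.1 ha.1.symm hb.1.symm hab
    rw [← hNw, ← hNw] at this
    tauto
  have r1 : R.card ≤ 1 := by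
    by_contra hlt
    obtain ⟨a, ha, b, hb, hab⟩ := Finset.one_lt_card.1 (not_le.1 hlt)
    rw [mR] at ha hb
    have := mw u a b uw' ha.2.1 hb.2.1 ha.1.symm hb.1.symm hab
    rw [← hNu, ← hNu] at this
    tauto
  have mCm : ∀ x ∈ C, ∀ y ∈ C, ∀ z ∈ C, x ≠ y → x ≠ z → y ≠ z → G.Adj x y ∨ G.Adj x z :=
    fun x hx y hy z hz => mu x y z ((mC x).1 hx).1 ((mC y).1 hy).1 ((mC z).1 hz).1
  have aP : ∀ p ∈ P, ∀ x ∈ C, G.Adj p x := by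
    intro p hp x hx
    rw [mP] at hp
    have hx' := (mC x).1 hx
    rcases mu p w x hp.2.1 wu hx'.1 hp.1 (by rintro rfl; exact hp.2.2 hx'.2)
      (by rintro rfl; exact ww hx'.2) with h | h
    · exact absurd ((hNw p).2 h.symm) hp.2.2
    · exact h
  have aR : ∀ p ∈ R, ∀ x ∈ C, G.Adj p x := by
    intro p hp x hx
    rw [mR] at hp
    have hx' := (mC x).1 hx
    rcases mw p u x hp.2.1 uw' hx'.2 hp.1 (by rintro rfl; exact hp.2.2 hx'.1)
      (by rintro rfl; exact uu hx'.1) with h | h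
    · exact absurd ((hNu p).2 h.symm) hp.2.2
    · exact h
  have uC : u ∉ C := fun h => uu ((mC u).1 h).1
  have wC : w ∉ C := fun h => ww ((mC w).1 h).2
  have eNu : ∀ x, G.Adj u x ↔ x = w ∨ x ∈ C ∨ x ∈ P := by
    intro x; rw [← hNu, mC, mP]; by_cases x = w <;> grind
  have eNw : ∀ x, G.Adj w x ↔ x = u ∨ x ∈ C ∨ x ∈ R := by
    intro x; rw [← hNw, mC, mR]; by_cases x = u <;> grind
  have dPC : ∀ p ∈ P, p ∉ C ∧ p ≠ u ∧ p ≠ w ∧ p ∉ R := by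
    intro p hp; rw [mC, mR]; rw [mP] at hp; grind
  have dRC : ∀ p ∈ R, p ∉ C ∧ p ≠ u ∧ p ≠ w := by
    intro p hp; rw [mC]; rw [mR] at hp; grind
  clear mu mw hNu hNw mC mP mR hC hP hR
  have hPd : P = ∅ ∨ ∃ p, P = {p} := by
    rcases Nat.le_one_iff_eq_zero_or_eq_one.1 p1 with h | h
    · exact Or.inl (Finset.card_eq_zero.1 h)
    · exact Or.inr (Finset.card_eq_one.1 h)
  have hRd : R = ∅ ∨ ∃ p, R = {p} := by
    rcases Nat.le_one_iff_eq_zero_or_eq_one.1 r1 with h | h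
    · exact Or.inl (Finset.card_eq_zero.1 h)
    · exact Or.inr (Finset.card_eq_one.1 h)
  apply hno
  rcases hPd with rfl | ⟨p, rfl⟩ <;> rcases hRd with rfl | ⟨r, rfl⟩ <;>
    simp only [Finset.card_empty, Finset.card_singleton] at c1 c2
  · have : C.card = 5 ∨ C.card = 4 := by omega
    rcases this with h | h
    · obtain ⟨x, hx⟩ := Finset.card_pos.1 (show 0 < C.card by omega)
      have hsub : C.erase x ⊆ C := Finset.erase_subset _ _
      obtain ⟨a, b, c, d, he, nd, k1, k2, k3, k4⟩ := quad G (C.erase x)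
        (by rw [Finset.card_erase_of_mem hx, h])
        (fun x hx y hy z hz => mCm x (hsub hx) y (hsub hy) z (hsub hz))
      have hCe : ∀ y, y ∈ C ↔ y = a ∨ y = b ∨ y = c ∨ y = d ∨ y = x := by
        intro y
        have : y ∈ C.erase x ↔ y = a ∨ y = b ∨ y = c ∨ y = d := by rw [he]; simp
        rw [Finset.mem_erase] at this
        by_cases y = x <;> grind
      have hx' : x ∉ C.erase x := by simp
      rw [he] at hx'
      simp only [hCe] at *
      simp at nd hx'
      exact case5 G u w a b c d x (by simp; grind) uw (by simp; grind) (by simp; grind) k1 k2 k3 k4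
        (by simp; grind) (by simp; grind)
    · obtain ⟨a, b, c, d, rfl, nd, k1, k2, k3, k4⟩ := quad G C h mCm
      clear mCm
      simp at *
      exact case4a G u w a b c d (by simp; grind) (by simp; grind) (by simp; grind) k1 k2 k3 k4
        (by simp; grind) (by simp; grind)
  · obtain ⟨a, b, c, d, rfl, nd, k1, k2, k3, k4⟩ := quad G C (by omega) mCm
    clear mCm
    simp at *
    exact case4b G w u a b c d r (by simp; grind) (by simp; grind) (by simp; grind) k1 k2 k3 k4
        (by simp; grind) (by simp; grind)
  · obtain ⟨a, b, c, d, rfl, nd, k1, k2, k3, k4⟩ := quad G C (by omega) mCm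
    clear mCm
    simp at *
    exact case4b G u w a b c d p (by simp; grind) (by simp; grind) (by simp; grind) k1 k2 k3 k4
        (by simp; grind) (by simp; grind)
  · have : C.card = 4 ∨ C.card = 3 := by omega
    rcases this with h | h
    · obtain ⟨a, b, c, d, rfl, nd, k1, k2, k3, k4⟩ := quad G C h mCm
      clear mCm
      simp at *
      exact case4c G u w b c d a p r (by simp; grind) uw (by simp; grind) (by simp; grind) k1 k2
        (by grind) (by grind) (by simp; grind) (by simp; grind)
    · obtain ⟨a, b, c, h1, h2, h3, rfl⟩ : ∃ a b c, a ≠ b ∧ G.Adj c b ∧ G.Adj c a ∧ C = {a, b, c} := by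
        obtain ⟨a, b, c, h1, h2, h3, rfl⟩ := Finset.card_eq_three.1 h
        have i1 := mCm a (by simp) b (by simp) c (by simp) h1 h2 h3
        have i2 := mCm b (by simp) a (by simp) c (by simp) h1.symm h3 h2
        have i3 := mCm c (by simp) a (by simp) b (by simp) h2.symm h3.symm h1
        rw [G.adj_comm b a] at i2
        rw [G.adj_comm c a, G.adj_comm c b] at i3
        by_cases q1 : G.Adj a b
        · by_cases q2 : G.Adj a c
          · exact ⟨b, c, a, h3, q2, q1, by ext x; simp; grind⟩
          · exact ⟨a, c, b, h2, by tauto, q1.symm, by ext x; simp; grind⟩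
        · have q2 : G.Adj a c := by tauto
          have q3 : G.Adj b c := by tauto
          exact ⟨a, b, c, h1, q3.symm, q2.symm, rfl⟩
      clear mCm
      have n1 := h2.ne
      have n2 := h3.ne
      simp at *
      exact case3 G u w a b c p r (by simp; grind) (by simp; grind) (by simp; grind) h2 h3
        (by grind) (by grind) (by simp; grind) (by simp; grind)

lemma fin_aux [DecidableEq V] (L : V → V → Prop) (I : Irr L) (W : Finset V) (a b c p q : V)
    (hab : a ≠ b) (hac : a ≠ c) (hbc : b ≠ c)
    (haW : a ∉ W) (hbW : b ∉ W) (hcW : c ∉ W) (hW : 4 ≤ W.card)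
    (hL : ∀ x y, L x y → (x = a ∨ x = b ∨ x = c ∨ x ∈ W) ∧ (y = a ∨ y = b ∨ y = c ∨ y ∈ W))
    (hind : ∀ x ∈ W, ∀ y ∈ W, ¬ L x y)
    (hnb : ∀ x ∈ W, L a x ∨ L b x ∨ L c x)
    (hp : p ∈ W) (hq : q ∈ W) (hpq : p ≠ q) (hcp : L c p) (hcq : L c q) : False := by
  have sy := I.symm
  have ir := I.irrefl
  have cl : ∀ s t, L s t → s ≠ c → t ≠ c → (L a b ∧ (s = a ∧ t = b ∨ s = b ∧ t = a)) ∨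
      (∃ w ∈ W, L a w ∧ (s = a ∧ t = w ∨ s = w ∧ t = a)) ∨
      (∃ w ∈ W, L b w ∧ (s = b ∧ t = w ∨ s = w ∧ t = b)) := by
    intro s t h hs ht
    obtain ⟨h1, h2⟩ := hL s t h
    rcases h1 with rfl | rfl | rfl | h1
    · rcases h2 with rfl | rfl | rfl | h2
      · exact absurd h (ir _)
      · exact Or.inl ⟨h, Or.inl ⟨rfl, rfl⟩⟩
      · exact absurd rfl ht
      · exact Or.inr (Or.inl ⟨t, h2, h, Or.inl ⟨rfl, rfl⟩⟩)
    · rcases h2 with rfl | rfl | rfl | h2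
      · exact Or.inl ⟨sy _ _ h, Or.inr ⟨rfl, rfl⟩⟩
      · exact absurd h (ir _)
      · exact absurd rfl ht
      · exact Or.inr (Or.inr ⟨t, h2, h, Or.inl ⟨rfl, rfl⟩⟩)
    · exact absurd rfl hs
    · rcases h2 with rfl | rfl | rfl | h2
      · exact Or.inr (Or.inl ⟨s, h1, sy _ _ h, Or.inr ⟨rfl, rfl⟩⟩)
      · exact Or.inr (Or.inr ⟨s, h1, sy _ _ h, Or.inr ⟨rfl, rfl⟩⟩)
      · exact absurd rfl ht
      · exact absurd h (hind _ h1 _ h2)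
  have K3 : ∀ x y z, x ∈ W → y ∈ W → z ∈ W → x ≠ y → x ≠ z → y ≠ z → L a x → L b y → L c z →
      False := by
    intro x y z hx hy hz h1 h2 h3 e1 e2 e3
    obtain ⟨s, t, h, r⟩ := I.h3 a x b y c z a b c e1 e2 e3 hab (by grind) (by grind) h1 hac
      (by grind) (by grind) h2 hbc (by grind) (by grind) h3
    have key := cl s t h (by tauto) (by tauto)
    clear cl hL hind hnb sy ir hcp hcq I hW
    grind
  have K2 : ∀ y z, y ∈ W → z ∈ W → y ≠ z → L b y → L c z → (∀ x ∈ W, ¬ L a x) → False := by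
    intro y z hy hz h3 e2 e3 hA
    obtain ⟨s, t, h, r⟩ := I.h2 b y c z b c e2 e3 hbc (by grind) (by grind) h3
    have key := cl s t h (by tauto) (by tauto)
    clear cl hL hind hnb sy ir hcp hcq I hW
    clear K3
    grind
  have K2' : ∀ y z, y ∈ W → z ∈ W → y ≠ z → L a y → L c z → (∀ x ∈ W, ¬ L b x) → False := by
    intro y z hy hz h3 e2 e3 hA
    obtain ⟨s, t, h, r⟩ := I.h2 a y c z a c e2 e3 hac (by grind) (by grind) h3
    have key := cl s t h (by tauto) (by tauto)
    clear cl hL hind hnb sy ir hcp hcq I hW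
    clear K3 K2
    grind
  have pick : ∀ x, ∃ p' ∈ W, p' ≠ x ∧ L c p' := by
    intro x
    by_cases h : p = x
    · exact ⟨q, hq, by rintro rfl; exact hpq h, hcq⟩
    · exact ⟨p, hp, h, hcp⟩
  by_cases hA : ∃ x ∈ W, L a x
  · obtain ⟨x, hx, ax⟩ := hA
    by_cases hB : ∃ y ∈ W, L b y
    · obtain ⟨y, hy, by'⟩ := hB
      have hne : ∀ x ∈ W, ∀ y ∈ W, L a x → L b y → x = y := by
        intro x hx y hy ax by'
        by_contra hxy
        by_cases hz : ∃ z ∈ W, L c z ∧ z ≠ x ∧ z ≠ y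
        · obtain ⟨z, hz, cz, n1, n2⟩ := hz
          exact K3 x y z hx hy hz hxy n1.symm n2.symm ax by' cz
        · push Not at hz
          have z1 := hz p hp hcp
          have z2 := hz q hq hcq
          have cxy : L c x ∧ L c y := by
            by_cases hpx : p = x
            · have hqy := z2 (fun hqx => hpq (hpx.trans hqx.symm))
              exact ⟨hpx ▸ hcp, hqy ▸ hcq⟩
            · have hpy := z1 hpx
              have hqx : q = x := by
                by_contra hqx
                exact hpq (hpy.trans (z2 hqx).symm)
              exact ⟨hqx ▸ hcq, hpy ▸ hcp⟩
          obtain ⟨cx, cy⟩ := cxy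
          have : ∃ l ∈ W, l ∉ ({x, y} : Finset V) := by
            by_contra hcon
            push Not at hcon
            have := Finset.card_le_card hcon
            have := Finset.card_le_two (a := x) (b := y)
            omega
          obtain ⟨l, hl, hlxy⟩ := this
          simp at hlxy
          rcases hnb l hl with h | h | h
          · exact K3 l y x hl hy hx hlxy.2 hlxy.1 (Ne.symm hxy) h by' cx
          · exact K3 x l y hx hl hy (Ne.symm hlxy.1) hxy hlxy.2 ax h cy
          · exact hlxy.2 (hz l hl h hlxy.1)
      have := hne x hx y hy ax by'
      subst this
      obtain ⟨p', hp', hpx, cp'⟩ := pick x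
      by_cases e : L a b
      · obtain ⟨s, t, h, r⟩ := I.h2 a b c p' c x e cp' hac (by grind) hbc (by grind)
        have key := cl s t h (by tauto) (by tauto)
        clear cl hL hind hnb sy ir hcp hcq I hW
        clear pick K3 K2 K2'
        grind
      · obtain ⟨s, t, h, r⟩ := I.h2 a x c p' c x ax cp' hac (by grind) (by grind) hpx.symm
        have key := cl s t h (by tauto) (by tauto)
        clear cl hL hind hnb sy ir hcp hcq I hW
        clear pick K3 K2 K2'
        grind
    · push Not at hB
      obtain ⟨p', hp', hpx, cp'⟩ := pick x
      exact K2' x p' hx hp' hpx.symm ax cp' hB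
  · push Not at hA
    by_cases hB : ∃ y ∈ W, L b y
    · obtain ⟨y, hy, by'⟩ := hB
      obtain ⟨p', hp', hpx, cp'⟩ := pick y
      exact K2 y p' hy hp' hpx.symm by' cp' hA
    · push Not at hB
      by_cases e : L a b
      · obtain ⟨s, t, h, r⟩ := I.h2 a b c p c c e hcp hac (by grind) hbc (by grind)
        have key := cl s t h (by tauto) (by tauto)
        clear cl hL hind hnb sy ir hcp hcq I hW
        clear pick K3 K2 K2'
        grind
      · obtain ⟨s, t, h, r⟩ := I.h1 c p c hcp
        have key := cl s t h (by tauto) (by tauto)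
        clear cl hL hind hnb sy ir hcp hcq I hW
        clear pick K3 K2 K2'
        grind

/-- In a robust graph, if `v` is a vertex of degree `k ∈ {7, 8, 9}` with more than
`k - 4` neighbors of degree at most 6, then `G` has a reducible vertex set. -/
theorem many_low_neighbors_reducible [Fintype V] [DecidableEq V] (G : SimpleGraph V)
    (hrob : Robust G) (v : V) (k : ℕ) (hk : k = 7 ∨ k = 8 ∨ k = 9)
    (hdeg : (G.neighborSet v).ncard = k)
    (hmany : k - 4 < {x | x ∈ G.neighborSet v ∧ (G.neighborSet x).ncard ≤ 6}.ncard) :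
    ∃ V₀ : Finset V, ReducibleVertexSet G V₀ := by
  classical
  by_contra hno
  let N : V → Finset V := fun x => Finset.univ.filter (fun y => G.Adj x y)
  have hN : ∀ x y, y ∈ N x ↔ G.Adj x y := by intro x y; simp [N]
  have hNs : ∀ x, (G.neighborSet x).ncard = (N x).card := by
    intro x
    rw [← Set.ncard_coe_finset]
    congr 1
    ext y; simp [N]
  let Lo : Finset V := (N v).filter (fun x => (N x).card ≤ 6)
  have hLo : {x | x ∈ G.neighborSet v ∧ (G.neighborSet x).ncard ≤ 6}.ncard = Lo.card := by
    rw [← Set.ncard_coe_finset]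
    congr 1
    ext y; simp [Lo, hNs, hN]
  rw [hLo] at hmany
  rw [hNs] at hdeg
  obtain ⟨W, hWL, hWc⟩ := Finset.exists_subset_card_eq (show k - 3 ≤ Lo.card by omega)
  have hWN : W ⊆ N v := hWL.trans (Finset.filter_subset _ _)
  have hsd := Finset.card_sdiff_add_card_eq_card hWN
  obtain ⟨a, b, c, hab, hac, hbc, hQ⟩ := Finset.card_eq_three.1
    (show (N v \ W).card = 3 by omega)
  have hmem : ∀ x, x ∈ N v ∧ x ∉ W ↔ x = a ∨ x = b ∨ x = c := by
    intro x; rw [← Finset.mem_sdiff, hQ]; simp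
  have I := irr_of G hno v
  have haW : a ∉ W := ((hmem a).2 (by simp)).2
  have hbW : b ∉ W := ((hmem b).2 (by simp)).2
  have hcW : c ∉ W := ((hmem c).2 (by simp)).2
  have hL : ∀ x y, Lk G v x y → (x = a ∨ x = b ∨ x = c ∨ x ∈ W) ∧
      (y = a ∨ y = b ∨ y = c ∨ y ∈ W) := by
    intro x y h
    have h1 := (hN v x).2 h.1
    have h2 := (hN v y).2 h.2.1
    have h3 : ∀ z, z ∈ N v → (z = a ∨ z = b ∨ z = c ∨ z ∈ W) := by
      intro z hz
      by_cases hzW : z ∈ W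
      · exact Or.inr (Or.inr (Or.inr hzW))
      · rcases (hmem z).1 ⟨hz, hzW⟩ with h | h | h
        · exact Or.inl h
        · exact Or.inr (Or.inl h)
        · exact Or.inr (Or.inr (Or.inl h))
    exact ⟨h3 x h1, h3 y h2⟩
  have hind : ∀ x ∈ W, ∀ y ∈ W, ¬ Lk G v x y := by
    intro x hx y hy h
    exact adj_low G hrob hno x y (N x) (hN x) (Finset.mem_filter.1 (hWL hx)).2
      (N y) (hN y) (Finset.mem_filter.1 (hWL hy)).2 h.2.2
  have hnb : ∀ x ∈ W, Lk G v a x ∨ Lk G v b x ∨ Lk G v c x := by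
    intro x hx
    obtain ⟨x', hx', y, hy, h⟩ := conn_of_robust G hrob v {x} (by simp)
      (by simpa using (hN v x).1 (hWN hx)) (by simp)
    simp only [Finset.mem_singleton] at hx'
    subst hx'
    rcases (hL _ _ h).2 with rfl | rfl | rfl | h'
    · exact Or.inl h.symm'
    · exact Or.inr (Or.inl h.symm')
    · exact Or.inr (Or.inr h.symm')
    · exact absurd h (hind _ hx _ h')
  have hW4 : 4 ≤ W.card := by omega
  have hmap : ∀ x ∈ W, ∃ z ∈ ({a, b, c} : Finset V), Lk G v z x := by
    intro x hx
    rcases hnb x hx with h | h | h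
    · exact ⟨a, by simp, h⟩
    · exact ⟨b, by simp, h⟩
    · exact ⟨c, by simp, h⟩
  choose! f hf hfL using hmap
  have h3 : ({a, b, c} : Finset V).card ≤ 3 := Finset.card_le_three
  obtain ⟨p, hp, q, hq, hpq, he⟩ := Finset.exists_ne_map_eq_of_card_lt_of_maps_to
    (show ({a, b, c} : Finset V).card < W.card by omega) hf
  have hfp := hfL p hp
  have hfq := hfL q hq
  rw [← he] at hfq
  have hz := hf p hp
  simp only [Finset.mem_insert, Finset.mem_singleton] at hz
  rcases hz with hz | hz | hz <;> rw [hz] at hfp hfq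
  · exact fin_aux (Lk G v) I W c b a p q hbc.symm hac.symm hab.symm hcW hbW haW hW4
      (fun x y h => by have := hL x y h; clear * - this; tauto) hind
      (fun x hx => by have := hnb x hx; clear * - this; tauto)
      hp hq hpq hfp hfq
  · exact fin_aux (Lk G v) I W a c b p q hac hab hbc.symm haW hcW hbW hW4
      (fun x y h => by have := hL x y h; clear * - this; tauto) hind
      (fun x hx => by have := hnb x hx; clear * - this; tauto)
      hp hq hpq hfp hfq
  · exact fin_aux (Lk G v) I W a b c p q hab hac hbc haW hbW hcW hW4
      hL hind hnb hp hq hpq hfp hfq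
end

section
/- Let G be a finite simple robust graph with no reducible vertex set. If a vertex v with d(v) ≥ 10 subsumes some vertex w of degree at most 6, then at most d(v) − 6 neighbors of v have degree at most 6. -/
open SimpleGraph

variable {V : Type*}

set_option linter.all false

theorem red_of [Fintype V] [DecidableEq V] (G : SimpleGraph V) {ι : Type*} [Fintype ι]
    (V₀ : Finset V) (hne : V₀.Nonempty) (T : ι → Finset V) (Y : Finset (Sym2 V))
    (hcl : ∀ i, G.IsNClique 3 (T i))
    (hd : ∀ i j, ∀ a b, a ≠ b → a ∈ T i → b ∈ T i → a ∈ T j → b ∈ T j → i = j)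
    (hY : Y.card ≤ 2 * Fintype.card ι)
    (hkill : ∀ x ∈ V₀, ∀ y z, G.Adj x y → G.Adj x z → G.Adj y z →
      s(x, y) ∈ Y ∨ s(x, z) ∈ Y ∨ s(y, z) ∈ Y)
    (hS : ∀ i, ∀ u ∈ T i, ∀ v ∈ T i, u ≠ v → u ∉ V₀ → v ∉ V₀ → s(u, v) ∈ Y) :
    ReducibleVertexSet G V₀ := by
  classical
  have hinj : Function.Injective T := by
    intro i j hij
    have h3 := (hcl i).card_eq
    obtain ⟨a, ha, b, hb, hab⟩ := Finset.one_lt_card.1 (by omega : 1 < (T i).card)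
    exact hd i j a b hab ha hb (hij ▸ ha) (hij ▸ hb)
  refine ⟨hne, Finset.univ.image T, Y.filter (· ∈ G.edgeSet), ⟨?_, ?_⟩, ?_, ?_, ?_, ?_⟩
  · intro t ht
    obtain ⟨i, -, rfl⟩ := Finset.mem_image.1 ht
    exact hcl i
  · intro t₁ h₁ t₂ h₂ hne
    obtain ⟨i, -, rfl⟩ := Finset.mem_image.1 h₁
    obtain ⟨j, -, rfl⟩ := Finset.mem_image.1 h₂
    rw [Finset.card_le_one]
    intro a ha b hb
    by_contra hab
    rw [Finset.mem_inter] at ha hb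
    exact hne (congrArg T (hd i j a b hab ha.1 hb.1 ha.2 hb.2))
  · intro e he
    simp only [Finset.coe_filter, Set.mem_ofPred_eq] at he
    exact he.2
  · rw [Finset.card_image_of_injective _ hinj, Finset.card_univ]
    exact (Finset.card_filter_le _ _).trans hY
  · intro t ht x hx hxt
    obtain ⟨a, b, c, hab, hac, hbc, rfl⟩ := SimpleGraph.is3Clique_iff.1 ht
    simp only [SimpleGraph.deleteEdges_adj, Finset.coe_filter, Set.mem_ofPred_eq,
      SimpleGraph.mem_edgeSet] at hab hac hbc
    have k := hkill x hx
    simp only [Finset.mem_insert, Finset.mem_singleton] at hxt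
    rcases hxt with rfl | rfl | rfl
    · have := k b c hab.1 hac.1 hbc.1
      grind
    · have := k a c hab.1.symm hbc.1 hac.1
      rw [Sym2.eq_swap] at this
      grind
    · have := k a b hac.1.symm hbc.1.symm hab.1
      rw [Sym2.eq_swap, Sym2.eq_swap (a := x) (b := b)] at this
      grind
  · intro t ht u hu v hv huv hu0 hv0
    obtain ⟨i, -, rfl⟩ := Finset.mem_image.1 ht
    simp only [Finset.mem_filter, SimpleGraph.mem_edgeSet]
    exact ⟨hS i u hu v hv huv hu0 hv0, (hcl i).isClique hu hv huv⟩

theorem single [Fintype V] [DecidableEq V] (G : SimpleGraph V) {ι : Type*} [Fintype ι]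
    (hnored : ¬ ∃ V₀ : Finset V, ReducibleVertexSet G V₀) (x : V)
    (f g : ι → V) (C : Finset V)
    (hf : ∀ i, G.Adj x (f i)) (hg : ∀ i, G.Adj x (g i)) (hfg : ∀ i, G.Adj (f i) (g i))
    (hff : ∀ i j, f i = f j → i = j) (hgg : ∀ i j, g i = g j → i = j)
    (hfg' : ∀ i j, f i ≠ g j)
    (hC : C.card ≤ Fintype.card ι)
    (hcov : ∀ y z, G.Adj x y → G.Adj x z → G.Adj y z → y ∈ C ∨ z ∈ C ∨
      ∃ i, (y = f i ∧ z = g i) ∨ (z = f i ∧ y = g i)) : False := by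
  classical
  apply hnored
  refine ⟨{x}, red_of G {x} (by simp) (fun i => {x, f i, g i})
    (Finset.univ.image (fun i => s(f i, g i)) ∪ C.image (fun c => s(x, c))) ?_ ?_ ?_ ?_ ?_⟩
  · intro i
    exact SimpleGraph.is3Clique_iff.2 ⟨x, f i, g i, hf i, hg i, hfg i, rfl⟩
  · intro i j a b hab
    have h1 := (hf i).ne
    have h2 := (hg i).ne
    have h3 := (hf j).ne
    have h4 := (hg j).ne
    have h5 := hff i j
    have h6 := hgg i j
    have h7 := hfg' i j
    have h8 := hfg' j i
    simp only [Finset.mem_insert, Finset.mem_singleton]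
    grind
  · refine (Finset.card_union_le _ _).trans ?_
    have h1 := Finset.card_image_le (s := (Finset.univ : Finset ι)) (f := fun i => s(f i, g i))
    have h2 := Finset.card_image_le (s := C) (f := fun c => s(x, c))
    rw [Finset.card_univ] at h1
    omega
  · intro x' hx' y z hy hz hyz
    rw [Finset.mem_singleton] at hx'
    subst hx'
    simp only [Finset.mem_union, Finset.mem_image, Finset.mem_univ, true_and]
    rcases hcov y z hy hz hyz with h | h | ⟨i, ⟨h1, h2⟩ | ⟨h1, h2⟩⟩
    · exact Or.inl (Or.inr ⟨y, h, rfl⟩)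
    · exact Or.inr (Or.inl (Or.inr ⟨z, h, rfl⟩))
    · exact Or.inr (Or.inr (Or.inl ⟨i, by rw [h1, h2]⟩))
    · exact Or.inr (Or.inr (Or.inl ⟨i, by rw [h1, h2, Sym2.eq_swap]⟩))
  · intro i u hu v hv huv hu0 hv0
    simp only [Finset.mem_insert, Finset.mem_singleton] at hu hv hu0 hv0
    simp only [Finset.mem_union, Finset.mem_image, Finset.mem_univ, true_and]
    left
    refine ⟨i, ?_⟩
    rcases hu with rfl | rfl | rfl <;> rcases hv with rfl | rfl | rfl <;>
      simp_all [Sym2.eq_swap]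

/-- connectivity of links -/
theorem leave [Fintype V] [DecidableEq V] (G : SimpleGraph V) (hrob : Robust G) (x : V)
    (A : Finset V) (hA : A.Nonempty) (hAx : ∀ a ∈ A, G.Adj x a) (hc : A.card ≤ 4) :
    ∃ a ∈ A, ∃ b, b ∉ A ∧ G.Adj x b ∧ G.Adj a b := by
  classical
  by_contra hcon
  push Not at hcon
  obtain ⟨a, ha⟩ := hA
  let H := G.induce (G.neighborSet x)
  let a' : G.neighborSet x := ⟨a, hAx a ha⟩
  have h5 := hrob x (H.connectedComponentMk a')
  have hsub : ∀ b : G.neighborSet x, H.Reachable a' b → (b : V) ∈ A := by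
    intro b hb
    obtain ⟨p⟩ := hb
    have : ∀ (s t : G.neighborSet x) (_ : H.Walk s t), (s : V) ∈ A → (t : V) ∈ A := by
      intro s t p
      induction p with
      | nil => exact id
      | @cons u v w h p ih =>
        intro hu
        apply ih
        by_contra hv
        exact hcon u hu v hv v.2 h
    exact this _ _ p ha
  have : (H.connectedComponentMk a').supp.ncard ≤ A.card := by
    rw [← Set.ncard_coe_finset A]
    apply Set.ncard_le_ncard_of_injOn (Subtype.val : G.neighborSet x → V)
    · intro b hb
      rw [SimpleGraph.ConnectedComponent.mem_supp_iff, SimpleGraph.ConnectedComponent.eq] at hb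
      exact hsub b hb.symm
    · intro b _ c _ h
      exact Subtype.ext h
  omega

theorem pick2 [DecidableEq V] (G : SimpleGraph V) (C : Finset V) (h2 : 2 ≤ C.card)
    (hC : ∀ y ∈ C, ∀ z ∈ C, ∀ t ∈ C, y ≠ z → y ≠ t → z ≠ t → G.Adj y z ∨ G.Adj y t) :
    ∃ b ∈ C, ∃ e ∈ C, b ≠ e ∧ ∀ c ∈ C, c ≠ b → c ≠ e → G.Adj c b ∧ G.Adj c e := by
  by_cases h : ∃ b ∈ C, ∃ e ∈ C, b ≠ e ∧ ¬ G.Adj b e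
  · obtain ⟨b, hb, e, he, hbe, hn⟩ := h
    refine ⟨b, hb, e, he, hbe, fun c hc hcb hce => ?_⟩
    have h1 := hC b hb e he c hc hbe hcb.symm hce.symm
    have h2 := hC e he b hb c hc hbe.symm hce.symm hcb.symm
    have := G.adj_comm e b
    have := G.adj_comm e c
    have := G.adj_comm b c
    tauto
  · push Not at h
    obtain ⟨b, hb, e, he, hbe⟩ := Finset.one_lt_card.1 (by omega : 1 < C.card)
    exact ⟨b, hb, e, he, hbe, fun c hc h1 h2 => ⟨h c hc b hb h1, h c hc e he h2⟩⟩

theorem tri3 [DecidableEq V] (G : SimpleGraph V) {a b c : V} (h1 : G.Adj a b) (h2 : G.Adj a c)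
    (h3 : G.Adj b c) : G.IsNClique 3 {a, b, c} :=
  SimpleGraph.is3Clique_iff.2 ⟨a, b, c, h1, h2, h3, rfl⟩

set_option maxHeartbeats 1000000 in
theorem redB5_hd [DecidableEq V] (u v a b c d e : V) (hnd : [u, v, a, b, c, d, e].Nodup) (T : Fin 5 → Finset V)
    (hT : T = ![{u, v, a}, {u, b, c}, {u, d, e}, {v, b, d}, {v, c, e}]) :
    ∀ i j, ∀ x y, x ≠ y → x ∈ T i → y ∈ T i → x ∈ T j → y ∈ T j → i = j := by
  subst hT
  intro i j x y hxy h1 h2 h3 h4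
  simp only [List.nodup_cons, List.mem_cons, List.not_mem_nil, not_or] at hnd
  fin_cases i <;> fin_cases j <;>
    first
    | rfl
    | (exfalso; simp at h1 h2 h3 h4; grind)

set_option maxHeartbeats 1000000 in
theorem redB5 [Fintype V] [DecidableEq V] (G : SimpleGraph V) (u v a b c d e : V)
    (hnd : [u, v, a, b, c, d, e].Nodup)
    (hu : ∀ y, G.Adj u y → y = v ∨ y = a ∨ y = b ∨ y = c ∨ y = d ∨ y = e)
    (hv : ∀ y, G.Adj v y → y = u ∨ y = a ∨ y = b ∨ y = c ∨ y = d ∨ y = e)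
    (huv : G.Adj u v) (hua : G.Adj u a) (hub : G.Adj u b) (huc : G.Adj u c) (hud : G.Adj u d)
    (hue : G.Adj u e) (hva : G.Adj v a) (hvb : G.Adj v b) (hvc : G.Adj v c) (hvd : G.Adj v d)
    (hve : G.Adj v e) (hbc : G.Adj b c) (hde : G.Adj d e) (hbd : G.Adj b d) (hce : G.Adj c e) :
    ReducibleVertexSet G {u, v} := by
  obtain ⟨Y, hYc, kbc, kcb, kde, ked, kbd, kdb, kce, kec, kuv, kvu, kua, kau, kva, kav, kbe, keb, kcd, kdc⟩ : ∃ Y : Finset (Sym2 V), Y.card ≤ 9 ∧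
      s(b, c) ∈ Y ∧ s(c, b) ∈ Y ∧
      s(d, e) ∈ Y ∧ s(e, d) ∈ Y ∧
      s(b, d) ∈ Y ∧ s(d, b) ∈ Y ∧
      s(c, e) ∈ Y ∧ s(e, c) ∈ Y ∧
      s(u, v) ∈ Y ∧ s(v, u) ∈ Y ∧
      s(u, a) ∈ Y ∧ s(a, u) ∈ Y ∧
      s(v, a) ∈ Y ∧ s(a, v) ∈ Y ∧
      s(b, e) ∈ Y ∧ s(e, b) ∈ Y ∧
      s(c, d) ∈ Y ∧ s(d, c) ∈ Y := by
    refine ⟨[s(b, c), s(d, e), s(b, d), s(c, e), s(u, v), s(u, a), s(v, a), s(b, e), s(c, d)].toFinset, List.toFinset_card_le _, ?_⟩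
    simp only [List.mem_toFinset, List.mem_cons, Sym2.eq_iff, true_or, or_true, and_self]
  refine red_of G {u, v} (by simp)
    (![{u, v, a}, {u, b, c}, {u, d, e}, {v, b, d}, {v, c, e}] : Fin 5 → Finset V)
    Y ?_ ?_ ?_ ?_ ?_
  · intro i
    fin_cases i <;> apply tri3 <;> assumption
  · exact redB5_hd u v a b c d e hnd _ rfl
  · exact hYc.trans (by simp)
  · intro x hx y z hy hz hyz
    simp only [Finset.mem_insert, Finset.mem_singleton] at hx
    rcases hx with hx | hx
    · rw [hx] at hy hz ⊢
      rcases hu y hy with rfl | rfl | rfl | rfl | rfl | rfl <;>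
      rcases hu z hz with rfl | rfl | rfl | rfl | rfl | rfl <;>
      first
      | exact absurd hyz (G.irrefl)
      | exact Or.inl ‹_›
      | exact Or.inr (Or.inl ‹_›)
      | exact Or.inr (Or.inr ‹_›)
    · rw [hx] at hy hz ⊢
      rcases hv y hy with rfl | rfl | rfl | rfl | rfl | rfl <;>
      rcases hv z hz with rfl | rfl | rfl | rfl | rfl | rfl <;>
      first
      | exact absurd hyz (G.irrefl)
      | exact Or.inl ‹_›
      | exact Or.inr (Or.inl ‹_›)
      | exact Or.inr (Or.inr ‹_›)
  · intro i x hx y hy hxy hx0 hy0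
    simp only [Finset.mem_insert, Finset.mem_singleton, not_or] at hx0 hy0
    clear hu hv
    fin_cases i <;> simp at hx hy <;> rcases hx with hx | hx | hx <;>
      rcases hy with hy | hy | hy <;>
      first
      | exact absurd (hx.trans hy.symm) hxy
      | exact absurd hx hx0.1
      | exact absurd hx hx0.2
      | exact absurd hy hy0.1
      | exact absurd hy hy0.2
      | (rw [hx, hy]; assumption)

set_option maxHeartbeats 1000000 in
theorem redB4_hd [DecidableEq V] (u v a b c d : V) (hnd : [u, v, a, b, c, d].Nodup) (T : Fin 4 → Finset V)
    (hT : T = ![{u, a, c}, {u, b, d}, {v, a, d}, {v, b, c}]) :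
    ∀ i j, ∀ x y, x ≠ y → x ∈ T i → y ∈ T i → x ∈ T j → y ∈ T j → i = j := by
  subst hT
  intro i j x y hxy h1 h2 h3 h4
  simp only [List.nodup_cons, List.mem_cons, List.not_mem_nil, not_or] at hnd
  fin_cases i <;> fin_cases j <;>
    first
    | rfl
    | (exfalso; simp at h1 h2 h3 h4; grind)

set_option maxHeartbeats 1000000 in
theorem redB4 [Fintype V] [DecidableEq V] (G : SimpleGraph V) (u v p a b c d : V)
    (hnd : [u, v, a, b, c, d].Nodup)
    (hu : ∀ y, G.Adj u y → y = v ∨ y = p ∨ y = a ∨ y = b ∨ y = c ∨ y = d)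
    (hv : ∀ y, G.Adj v y → y = u ∨ y = a ∨ y = b ∨ y = c ∨ y = d)
    (huv : G.Adj u v) (hua : G.Adj u a) (hub : G.Adj u b) (huc : G.Adj u c) (hud : G.Adj u d)
    (hva : G.Adj v a) (hvb : G.Adj v b) (hvc : G.Adj v c) (hvd : G.Adj v d) (hac : G.Adj a c)
    (had : G.Adj a d) (hbc : G.Adj b c) (hbd : G.Adj b d) :
    ReducibleVertexSet G {u, v} := by
  obtain ⟨Y, hYc, kac, kca, kbd, kdb, kad, kda, kbc, kcb, kab, kba, kcd, kdc, kuv, kvu, kup, kpu⟩ : ∃ Y : Finset (Sym2 V), Y.card ≤ 8 ∧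
      s(a, c) ∈ Y ∧ s(c, a) ∈ Y ∧
      s(b, d) ∈ Y ∧ s(d, b) ∈ Y ∧
      s(a, d) ∈ Y ∧ s(d, a) ∈ Y ∧
      s(b, c) ∈ Y ∧ s(c, b) ∈ Y ∧
      s(a, b) ∈ Y ∧ s(b, a) ∈ Y ∧
      s(c, d) ∈ Y ∧ s(d, c) ∈ Y ∧
      s(u, v) ∈ Y ∧ s(v, u) ∈ Y ∧
      s(u, p) ∈ Y ∧ s(p, u) ∈ Y := by
    refine ⟨[s(a, c), s(b, d), s(a, d), s(b, c), s(a, b), s(c, d), s(u, v), s(u, p)].toFinset, List.toFinset_card_le _, ?_⟩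
    simp only [List.mem_toFinset, List.mem_cons, Sym2.eq_iff, true_or, or_true, and_self]
  refine red_of G {u, v} (by simp)
    (![{u, a, c}, {u, b, d}, {v, a, d}, {v, b, c}] : Fin 4 → Finset V)
    Y ?_ ?_ ?_ ?_ ?_
  · intro i
    fin_cases i <;> apply tri3 <;> assumption
  · exact redB4_hd u v a b c d hnd _ rfl
  · exact hYc.trans (by simp)
  · intro x hx y z hy hz hyz
    simp only [Finset.mem_insert, Finset.mem_singleton] at hx
    rcases hx with hx | hx
    · rw [hx] at hy hz ⊢
      rcases hu y hy with rfl | rfl | rfl | rfl | rfl | rfl <;>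
      rcases hu z hz with rfl | rfl | rfl | rfl | rfl | rfl <;>
      first
      | exact absurd hyz (G.irrefl)
      | exact Or.inl ‹_›
      | exact Or.inr (Or.inl ‹_›)
      | exact Or.inr (Or.inr ‹_›)
    · rw [hx] at hy hz ⊢
      rcases hv y hy with rfl | rfl | rfl | rfl | rfl <;>
      rcases hv z hz with rfl | rfl | rfl | rfl | rfl <;>
      first
      | exact absurd hyz (G.irrefl)
      | exact Or.inl ‹_›
      | exact Or.inr (Or.inl ‹_›)
      | exact Or.inr (Or.inr ‹_›)
  · intro i x hx y hy hxy hx0 hy0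
    simp only [Finset.mem_insert, Finset.mem_singleton, not_or] at hx0 hy0
    clear hu hv
    fin_cases i <;> simp at hx hy <;> rcases hx with hx | hx | hx <;>
      rcases hy with hy | hy | hy <;>
      first
      | exact absurd (hx.trans hy.symm) hxy
      | exact absurd hx hx0.1
      | exact absurd hx hx0.2
      | exact absurd hy hy0.1
      | exact absurd hy hy0.2
      | (rw [hx, hy]; assumption)

set_option maxHeartbeats 1000000 in
theorem redB6_hd [DecidableEq V] (u v p q a b c d : V) (hnd : [u, v, p, q, a, b, c, d].Nodup) (T : Fin 5 → Finset V)
    (hT : T = ![{u, v, a}, {u, p, b}, {u, c, d}, {v, q, c}, {v, b, d}]) :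
    ∀ i j, ∀ x y, x ≠ y → x ∈ T i → y ∈ T i → x ∈ T j → y ∈ T j → i = j := by
  subst hT
  intro i j x y hxy h1 h2 h3 h4
  simp only [List.nodup_cons, List.mem_cons, List.not_mem_nil, not_or] at hnd
  fin_cases i <;> fin_cases j <;>
    first
    | rfl
    | (exfalso; simp at h1 h2 h3 h4; grind)

set_option maxHeartbeats 1000000 in
theorem redB6 [Fintype V] [DecidableEq V] (G : SimpleGraph V) (u v p q a b c d : V)
    (hnd : [u, v, p, q, a, b, c, d].Nodup)
    (hu : ∀ y, G.Adj u y → y = v ∨ y = p ∨ y = a ∨ y = b ∨ y = c ∨ y = d)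
    (hv : ∀ y, G.Adj v y → y = u ∨ y = q ∨ y = a ∨ y = b ∨ y = c ∨ y = d)
    (huv : G.Adj u v) (hua : G.Adj u a) (hub : G.Adj u b) (huc : G.Adj u c) (hud : G.Adj u d)
    (hva : G.Adj v a) (hvb : G.Adj v b) (hvc : G.Adj v c) (hvd : G.Adj v d) (hup : G.Adj u p)
    (hvq : G.Adj v q) (hpb : G.Adj p b) (hqc : G.Adj q c) (hcd : G.Adj c d) (hbd : G.Adj b d) :
    ReducibleVertexSet G {u, v} := by
  obtain ⟨Y, hYc, kpb, kbp, kcd, kdc, kqc, kcq, kbd, kdb, kuv, kvu, kua, kau, kva, kav, kbc, kcb, kup, kpu, kvq, kqv⟩ : ∃ Y : Finset (Sym2 V), Y.card ≤ 10 ∧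
      s(p, b) ∈ Y ∧ s(b, p) ∈ Y ∧
      s(c, d) ∈ Y ∧ s(d, c) ∈ Y ∧
      s(q, c) ∈ Y ∧ s(c, q) ∈ Y ∧
      s(b, d) ∈ Y ∧ s(d, b) ∈ Y ∧
      s(u, v) ∈ Y ∧ s(v, u) ∈ Y ∧
      s(u, a) ∈ Y ∧ s(a, u) ∈ Y ∧
      s(v, a) ∈ Y ∧ s(a, v) ∈ Y ∧
      s(b, c) ∈ Y ∧ s(c, b) ∈ Y ∧
      s(u, p) ∈ Y ∧ s(p, u) ∈ Y ∧
      s(v, q) ∈ Y ∧ s(q, v) ∈ Y := by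
    refine ⟨[s(p, b), s(c, d), s(q, c), s(b, d), s(u, v), s(u, a), s(v, a), s(b, c), s(u, p), s(v, q)].toFinset, List.toFinset_card_le _, ?_⟩
    simp only [List.mem_toFinset, List.mem_cons, Sym2.eq_iff, true_or, or_true, and_self]
  refine red_of G {u, v} (by simp)
    (![{u, v, a}, {u, p, b}, {u, c, d}, {v, q, c}, {v, b, d}] : Fin 5 → Finset V)
    Y ?_ ?_ ?_ ?_ ?_
  · intro i
    fin_cases i <;> apply tri3 <;> assumption
  · exact redB6_hd u v p q a b c d hnd _ rfl
  · exact hYc.trans (by simp)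
  · intro x hx y z hy hz hyz
    simp only [Finset.mem_insert, Finset.mem_singleton] at hx
    rcases hx with hx | hx
    · rw [hx] at hy hz ⊢
      rcases hu y hy with rfl | rfl | rfl | rfl | rfl | rfl <;>
      rcases hu z hz with rfl | rfl | rfl | rfl | rfl | rfl <;>
      first
      | exact absurd hyz (G.irrefl)
      | exact Or.inl ‹_›
      | exact Or.inr (Or.inl ‹_›)
      | exact Or.inr (Or.inr ‹_›)
    · rw [hx] at hy hz ⊢
      rcases hv y hy with rfl | rfl | rfl | rfl | rfl | rfl <;>
      rcases hv z hz with rfl | rfl | rfl | rfl | rfl | rfl <;>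
      first
      | exact absurd hyz (G.irrefl)
      | exact Or.inl ‹_›
      | exact Or.inr (Or.inl ‹_›)
      | exact Or.inr (Or.inr ‹_›)
  · intro i x hx y hy hxy hx0 hy0
    simp only [Finset.mem_insert, Finset.mem_singleton, not_or] at hx0 hy0
    clear hu hv
    fin_cases i <;> simp at hx hy <;> rcases hx with hx | hx | hx <;>
      rcases hy with hy | hy | hy <;>
      first
      | exact absurd (hx.trans hy.symm) hxy
      | exact absurd hx hx0.1
      | exact absurd hx hx0.2
      | exact absurd hy hy0.1
      | exact absurd hy hy0.2
      | (rw [hx, hy]; assumption)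

set_option maxHeartbeats 1000000 in
theorem redB3_hd [DecidableEq V] (u v p q a b c : V) (hnd : [u, v, p, q, a, b, c].Nodup) (T : Fin 4 → Finset V)
    (hT : T = ![{u, a, c}, {v, b, c}, {u, p, b}, {v, q, a}]) :
    ∀ i j, ∀ x y, x ≠ y → x ∈ T i → y ∈ T i → x ∈ T j → y ∈ T j → i = j := by
  subst hT
  intro i j x y hxy h1 h2 h3 h4
  simp only [List.nodup_cons, List.mem_cons, List.not_mem_nil, not_or] at hnd
  fin_cases i <;> fin_cases j <;>
    first
    | rfl
    | (exfalso; simp at h1 h2 h3 h4; grind)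

set_option maxHeartbeats 1000000 in
theorem redB3 [Fintype V] [DecidableEq V] (G : SimpleGraph V) (u v p q a b c : V)
    (hnd : [u, v, p, q, a, b, c].Nodup)
    (hu : ∀ y, G.Adj u y → y = v ∨ y = p ∨ y = a ∨ y = b ∨ y = c)
    (hv : ∀ y, G.Adj v y → y = u ∨ y = q ∨ y = a ∨ y = b ∨ y = c)
    (huv : G.Adj u v) (hua : G.Adj u a) (hub : G.Adj u b) (huc : G.Adj u c) (hva : G.Adj v a)
    (hvb : G.Adj v b) (hvc : G.Adj v c) (hup : G.Adj u p) (hvq : G.Adj v q) (hac : G.Adj a c)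
    (hbc : G.Adj b c) (hpb : G.Adj p b) (hqa : G.Adj q a) :
    ReducibleVertexSet G {u, v} := by
  obtain ⟨Y, hYc, kac, kca, kbc, kcb, kpb, kbp, kqa, kaq, kuv, kvu, kup, kpu, kvq, kqv, kab, kba⟩ : ∃ Y : Finset (Sym2 V), Y.card ≤ 8 ∧
      s(a, c) ∈ Y ∧ s(c, a) ∈ Y ∧
      s(b, c) ∈ Y ∧ s(c, b) ∈ Y ∧
      s(p, b) ∈ Y ∧ s(b, p) ∈ Y ∧
      s(q, a) ∈ Y ∧ s(a, q) ∈ Y ∧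
      s(u, v) ∈ Y ∧ s(v, u) ∈ Y ∧
      s(u, p) ∈ Y ∧ s(p, u) ∈ Y ∧
      s(v, q) ∈ Y ∧ s(q, v) ∈ Y ∧
      s(a, b) ∈ Y ∧ s(b, a) ∈ Y := by
    refine ⟨[s(a, c), s(b, c), s(p, b), s(q, a), s(u, v), s(u, p), s(v, q), s(a, b)].toFinset, List.toFinset_card_le _, ?_⟩
    simp only [List.mem_toFinset, List.mem_cons, Sym2.eq_iff, true_or, or_true, and_self]
  refine red_of G {u, v} (by simp)
    (![{u, a, c}, {v, b, c}, {u, p, b}, {v, q, a}] : Fin 4 → Finset V)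
    Y ?_ ?_ ?_ ?_ ?_
  · intro i
    fin_cases i <;> apply tri3 <;> assumption
  · exact redB3_hd u v p q a b c hnd _ rfl
  · exact hYc.trans (by simp)
  · intro x hx y z hy hz hyz
    simp only [Finset.mem_insert, Finset.mem_singleton] at hx
    rcases hx with hx | hx
    · rw [hx] at hy hz ⊢
      rcases hu y hy with rfl | rfl | rfl | rfl | rfl <;>
      rcases hu z hz with rfl | rfl | rfl | rfl | rfl <;>
      first
      | exact absurd hyz (G.irrefl)
      | exact Or.inl ‹_›
      | exact Or.inr (Or.inl ‹_›)
      | exact Or.inr (Or.inr ‹_›)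
    · rw [hx] at hy hz ⊢
      rcases hv y hy with rfl | rfl | rfl | rfl | rfl <;>
      rcases hv z hz with rfl | rfl | rfl | rfl | rfl <;>
      first
      | exact absurd hyz (G.irrefl)
      | exact Or.inl ‹_›
      | exact Or.inr (Or.inl ‹_›)
      | exact Or.inr (Or.inr ‹_›)
  · intro i x hx y hy hxy hx0 hy0
    simp only [Finset.mem_insert, Finset.mem_singleton, not_or] at hx0 hy0
    clear hu hv
    fin_cases i <;> simp at hx hy <;> rcases hx with hx | hx | hx <;>
      rcases hy with hy | hy | hy <;>
      first
      | exact absurd (hx.trans hy.symm) hxy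
      | exact absurd hx hx0.1
      | exact absurd hx hx0.2
      | exact absurd hy hy0.1
      | exact absurd hy hy0.2
      | (rw [hx, hy]; assumption)

theorem m1 [Fintype V] [DecidableEq V] (G : SimpleGraph V)
    (hnored : ¬ ∃ V₀ : Finset V, ReducibleVertexSet G V₀) (x a b : V)
    (ha : G.Adj x a) (hb : G.Adj x b) (hab : G.Adj a b)
    (hcov : ∀ y z, G.Adj x y → G.Adj x z → G.Adj y z → y = b ∨ z = b) : False := by
  refine single G hnored x (ι := Fin 1) ![a] ![b] {b} ?_ ?_ ?_ ?_ ?_ ?_ ?_ ?_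
  · simp [ha]
  · simp [hb]
  · simp [hab]
  · intro i j _; exact Subsingleton.elim _ _
  · intro i j _; exact Subsingleton.elim _ _
  · simp [hab.ne]
  · simp
  · intro y z hy hz hyz
    have := hcov y z hy hz hyz
    simp
    tauto

theorem m2 [Fintype V] [DecidableEq V] (G : SimpleGraph V)
    (hnored : ¬ ∃ V₀ : Finset V, ReducibleVertexSet G V₀) (x a b c d c1 c2 : V)
    (hnd : [a, b, c, d].Nodup)
    (ha : G.Adj x a) (hb : G.Adj x b) (hc : G.Adj x c) (hd : G.Adj x d)
    (hab : G.Adj a b) (hcd : G.Adj c d)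
    (hcov : ∀ y z, G.Adj x y → G.Adj x z → G.Adj y z → (y = c1 ∨ y = c2) ∨ (z = c1 ∨ z = c2) ∨
      (y = a ∧ z = b) ∨ (y = b ∧ z = a) ∨ (y = c ∧ z = d) ∨ (y = d ∧ z = c)) : False := by
  simp at hnd
  refine single G hnored x (ι := Fin 2) ![a, c] ![b, d] {c1, c2} ?_ ?_ ?_ ?_ ?_ ?_ ?_ ?_
  · simp [Fin.forall_fin_succ, *]
  · simp [Fin.forall_fin_succ, *]
  · simp [Fin.forall_fin_succ, *]
  · simp [Fin.forall_fin_succ]; grind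
  · simp [Fin.forall_fin_succ]; grind
  · simp [Fin.forall_fin_succ]; grind
  · simpa using Finset.card_le_two
  · intro y z hy hz hyz
    have := hcov y z hy hz hyz
    simp [Fin.exists_fin_succ]
    grind

theorem m3 [Fintype V] [DecidableEq V] (G : SimpleGraph V)
    (hnored : ¬ ∃ V₀ : Finset V, ReducibleVertexSet G V₀) (x a b c d e f c1 c2 c3 : V)
    (hnd : [a, b, c, d, e, f].Nodup)
    (ha : G.Adj x a) (hb : G.Adj x b) (hc : G.Adj x c) (hd : G.Adj x d)
    (he : G.Adj x e) (hf : G.Adj x f)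
    (hab : G.Adj a b) (hcd : G.Adj c d) (hef : G.Adj e f)
    (hcov : ∀ y z, G.Adj x y → G.Adj x z → G.Adj y z →
      (y = c1 ∨ y = c2 ∨ y = c3) ∨ (z = c1 ∨ z = c2 ∨ z = c3) ∨
      (y = a ∧ z = b) ∨ (y = b ∧ z = a) ∨ (y = c ∧ z = d) ∨ (y = d ∧ z = c) ∨
      (y = e ∧ z = f) ∨ (y = f ∧ z = e)) : False := by
  simp at hnd
  refine single G hnored x (ι := Fin 3) ![a, c, e] ![b, d, f] {c1, c2, c3} ?_ ?_ ?_ ?_ ?_ ?_ ?_ ?_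
  · simp [Fin.forall_fin_succ, *]
  · simp [Fin.forall_fin_succ, *]
  · simp [Fin.forall_fin_succ, *]
  · simp [Fin.forall_fin_succ]; grind
  · simp [Fin.forall_fin_succ]; grind
  · simp [Fin.forall_fin_succ]; grind
  · simpa using Finset.card_le_three
  · intro y z hy hz hyz
    have := hcov y z hy hz hyz
    simp [Fin.exists_fin_succ]
    grind

structure Lk6 (G : SimpleGraph V) (x a b c d e f : V) : Prop where
  nd : [a, b, c, d, e, f].Nodup
  mem : ∀ z, G.Adj x z ↔ z = a ∨ z = b ∨ z = c ∨ z = d ∨ z = e ∨ z = f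

/-- transpositions of the listing -/
theorem Lk6.s1 {G : SimpleGraph V} {x a b c d e f : V} (h : Lk6 G x a b c d e f) :
    Lk6 G x b a c d e f :=
  ⟨by have := h.nd; simp at this ⊢; grind, fun z => by rw [h.mem]; tauto⟩
theorem Lk6.s2 {G : SimpleGraph V} {x a b c d e f : V} (h : Lk6 G x a b c d e f) :
    Lk6 G x a c b d e f :=
  ⟨by have := h.nd; simp at this ⊢; grind, fun z => by rw [h.mem]; tauto⟩
theorem Lk6.s3 {G : SimpleGraph V} {x a b c d e f : V} (h : Lk6 G x a b c d e f) :
    Lk6 G x a b d c e f :=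
  ⟨by have := h.nd; simp at this ⊢; grind, fun z => by rw [h.mem]; tauto⟩
theorem Lk6.s4 {G : SimpleGraph V} {x a b c d e f : V} (h : Lk6 G x a b c d e f) :
    Lk6 G x a b c e d f :=
  ⟨by have := h.nd; simp at this ⊢; grind, fun z => by rw [h.mem]; tauto⟩
theorem Lk6.s5 {G : SimpleGraph V} {x a b c d e f : V} (h : Lk6 G x a b c d e f) :
    Lk6 G x a b c d f e :=
  ⟨by have := h.nd; simp at this ⊢; grind, fun z => by rw [h.mem]; tauto⟩

theorem L3 [Fintype V] [DecidableEq V] {G : SimpleGraph V}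
    (hnored : ¬ ∃ V₀ : Finset V, ReducibleVertexSet G V₀) {x a b c d e f : V}
    (h : Lk6 G x a b c d e f) (hab : G.Adj a b) (hcd : G.Adj c d) (hef : G.Adj e f)
    (hac : ¬ G.Adj a c) (hae : ¬ G.Adj a e) (hce : ¬ G.Adj c e) : False := by
  have hm := h.mem
  refine m3 G hnored x a b c d e f b d f h.nd (by simp [hm]) (by simp [hm]) (by simp [hm])
    (by simp [hm]) (by simp [hm]) (by simp [hm]) hab hcd hef ?_
  intro y z hy hz hyz
  have hzy := hyz.symm
  rcases (hm y).1 hy with rfl | rfl | rfl | rfl | rfl | rfl <;>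
  rcases (hm z).1 hz with rfl | rfl | rfl | rfl | rfl | rfl <;>
  first | contradiction | exact absurd hyz G.irrefl | simp

theorem L3b [Fintype V] [DecidableEq V] {G : SimpleGraph V}
    (hnored : ¬ ∃ V₀ : Finset V, ReducibleVertexSet G V₀) {x y p q r s t : V}
    (h : Lk6 G x y p q r s t) (hpq : G.Adj p q) (hyr : G.Adj y r) (hst : G.Adj s t)
    (hyp : ¬ G.Adj y p) (hyq : ¬ G.Adj y q) : False := by
  have hm := h.mem
  refine m3 G hnored x p q y r s t r s t h.s1.s2.nd (by simp [hm]) (by simp [hm]) (by simp [hm])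
    (by simp [hm]) (by simp [hm]) (by simp [hm]) hpq hyr hst ?_
  intro y z hy hz hyz
  have hzy := hyz.symm
  rcases (hm y).1 hy with rfl | rfl | rfl | rfl | rfl | rfl <;>
  rcases (hm z).1 hz with rfl | rfl | rfl | rfl | rfl | rfl <;>
  first | contradiction | exact absurd hyz G.irrefl | simp

theorem L2 [Fintype V] [DecidableEq V] {G : SimpleGraph V}
    (hnored : ¬ ∃ V₀ : Finset V, ReducibleVertexSet G V₀) {x a b c d e f : V}
    (h : Lk6 G x a b c d e f) (hab : G.Adj a b) (hcd : G.Adj c d) (c1 c2 : V)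
    (hcov : ∀ y z, G.Adj x y → G.Adj x z → G.Adj y z → (y = c1 ∨ y = c2) ∨ (z = c1 ∨ z = c2) ∨
      (y = a ∧ z = b) ∨ (y = b ∧ z = a) ∨ (y = c ∧ z = d) ∨ (y = d ∧ z = c)) : False := by
  have hm := h.mem
  refine m2 G hnored x a b c d c1 c2 ?_ (by simp [hm]) (by simp [hm]) (by simp [hm])
    (by simp [hm]) hab hcd hcov
  have := h.nd
  simp at this ⊢
  grind

theorem Lk6.conn1 [Fintype V] [DecidableEq V] {G : SimpleGraph V} (hrob : Robust G)
    {x y p q r s t : V} (h : Lk6 G x y p q r s t) :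
    G.Adj y p ∨ G.Adj y q ∨ G.Adj y r ∨ G.Adj y s ∨ G.Adj y t := by
  have hm := h.mem
  obtain ⟨a, ha, b, hb, hxb, hab⟩ := leave G hrob x {y} (by simp) (by simp [hm]) (by simp)
  rw [Finset.mem_singleton] at ha hb
  subst ha
  rcases (hm b).1 hxb with h | h | h | h | h | h <;> simp_all

theorem Lk6.conn3 [Fintype V] [DecidableEq V] {G : SimpleGraph V} (hrob : Robust G)
    {x y p q r s t : V} (h : Lk6 G x y p q r s t)
    (h1 : ¬ G.Adj y r) (h2 : ¬ G.Adj y s) (h3 : ¬ G.Adj y t)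
    (h4 : ¬ G.Adj p r) (h5 : ¬ G.Adj p s) (h6 : ¬ G.Adj p t)
    (h7 : ¬ G.Adj q r) (h8 : ¬ G.Adj q s) (h9 : ¬ G.Adj q t) : False := by
  have hm := h.mem
  obtain ⟨a, ha, b, hb, hxb, hab⟩ := leave G hrob x {y, p, q} (by simp) (by simp [hm])
    (Finset.card_le_three.trans (by norm_num))
  simp only [Finset.mem_insert, Finset.mem_singleton, not_or] at ha hb
  rcases ha with rfl | rfl | rfl <;>
  rcases (hm b).1 hxb with rfl | rfl | rfl | rfl | rfl | rfl <;> simp_all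

set_option maxHeartbeats 1000000 in
theorem caseI [Fintype V] [DecidableEq V] {G : SimpleGraph V} (hrob : Robust G)
    (hnored : ¬ ∃ V₀ : Finset V, ReducibleVertexSet G V₀) {x y p q r s t : V}
    (h : Lk6 G x y p q r s t) (nyp : ¬ G.Adj y p) (nyq : ¬ G.Adj y q) (hpq : G.Adj p q) (hyr : G.Adj y r) (hys : G.Adj y s) (hyt : G.Adj y t) (nrs : ¬ G.Adj r s) (nrt : ¬ G.Adj r t) (nst : ¬ G.Adj s t) : False := by
  have hm := h.mem
  have frs : ¬ (G.Adj p r ∧ G.Adj q s) := by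
    rintro ⟨hpr, hqs⟩
    refine L3 hnored (h.s3.s2.s1.s2.s4.s3.s4.s5) ?_ ?_ ?_ ?_ ?_ ?_ <;>
      first | assumption | exact SimpleGraph.Adj.symm ‹_› | exact fun hh => absurd hh.symm ‹_›
  have frt : ¬ (G.Adj p r ∧ G.Adj q t) := by
    rintro ⟨hpr, hqt⟩
    refine L3 hnored (h.s3.s2.s1.s2.s5.s4.s3.s4.s5) ?_ ?_ ?_ ?_ ?_ ?_ <;>
      first | assumption | exact SimpleGraph.Adj.symm ‹_› | exact fun hh => absurd hh.symm ‹_›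
  have fsr : ¬ (G.Adj p s ∧ G.Adj q r) := by
    rintro ⟨hps, hqr⟩
    refine L3 hnored (h.s4.s3.s2.s1.s2.s4.s3.s4.s5) ?_ ?_ ?_ ?_ ?_ ?_ <;>
      first | assumption | exact SimpleGraph.Adj.symm ‹_› | exact fun hh => absurd hh.symm ‹_›
  have fst : ¬ (G.Adj p s ∧ G.Adj q t) := by
    rintro ⟨hps, hqt⟩
    refine L3 hnored (h.s4.s3.s2.s1.s2.s5.s4.s3.s4.s5) ?_ ?_ ?_ ?_ ?_ ?_ <;>
      first | assumption | exact SimpleGraph.Adj.symm ‹_› | exact fun hh => absurd hh.symm ‹_›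
  have ftr : ¬ (G.Adj p t ∧ G.Adj q r) := by
    rintro ⟨hpt, hqr⟩
    refine L3 hnored (h.s5.s4.s3.s2.s1.s2.s4.s3.s4.s5) ?_ ?_ ?_ ?_ ?_ ?_ <;>
      first | assumption | exact SimpleGraph.Adj.symm ‹_› | exact fun hh => absurd hh.symm ‹_›
  have fts : ¬ (G.Adj p t ∧ G.Adj q s) := by
    rintro ⟨hpt, hqs⟩
    refine L3 hnored (h.s5.s4.s3.s2.s1.s2.s5.s4.s3.s4.s5) ?_ ?_ ?_ ?_ ?_ ?_ <;>
      first | assumption | exact SimpleGraph.Adj.symm ‹_› | exact fun hh => absurd hh.symm ‹_›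
  have g1 : ¬ (¬ G.Adj p r ∧ ¬ G.Adj p s ∧ ¬ G.Adj p t) := by
    rintro ⟨npr, nps, npt⟩
    refine L2 hnored (h.s1.s2) (by first | assumption | exact SimpleGraph.Adj.symm ‹_›) (by first | assumption | exact SimpleGraph.Adj.symm ‹_›) y q ?_
    intro a b ha hb hab
    have hba := hab.symm
    rcases (hm a).1 ha with rfl | rfl | rfl | rfl | rfl | rfl <;>
    rcases (hm b).1 hb with rfl | rfl | rfl | rfl | rfl | rfl <;>
    first | contradiction | exact absurd hab G.irrefl | simp
  have g2 : ¬ (¬ G.Adj q r ∧ ¬ G.Adj q s ∧ ¬ G.Adj q t) := by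
    rintro ⟨nqr, nqs, nqt⟩
    refine L2 hnored (h.s1.s2) (by first | assumption | exact SimpleGraph.Adj.symm ‹_›) (by first | assumption | exact SimpleGraph.Adj.symm ‹_›) y p ?_
    intro a b ha hb hab
    have hba := hab.symm
    rcases (hm a).1 ha with rfl | rfl | rfl | rfl | rfl | rfl <;>
    rcases (hm b).1 hb with rfl | rfl | rfl | rfl | rfl | rfl <;>
    first | contradiction | exact absurd hab G.irrefl | simp
  have kr : ¬ (¬ G.Adj p s ∧ ¬ G.Adj p t ∧ ¬ G.Adj q s ∧ ¬ G.Adj q t) := by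
    rintro ⟨nps, npt, nqs, nqt⟩
    refine L2 hnored (h.s1.s2) (by first | assumption | exact SimpleGraph.Adj.symm ‹_›) (by first | assumption | exact SimpleGraph.Adj.symm ‹_›) y r ?_
    intro a b ha hb hab
    have hba := hab.symm
    rcases (hm a).1 ha with rfl | rfl | rfl | rfl | rfl | rfl <;>
    rcases (hm b).1 hb with rfl | rfl | rfl | rfl | rfl | rfl <;>
    first | contradiction | exact absurd hab G.irrefl | simp
  have ks : ¬ (¬ G.Adj p r ∧ ¬ G.Adj p t ∧ ¬ G.Adj q r ∧ ¬ G.Adj q t) := by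
    rintro ⟨npr, npt, nqr, nqt⟩
    refine L2 hnored (h.s1.s2.s4) (by first | assumption | exact SimpleGraph.Adj.symm ‹_›) (by first | assumption | exact SimpleGraph.Adj.symm ‹_›) y s ?_
    intro a b ha hb hab
    have hba := hab.symm
    rcases (hm a).1 ha with rfl | rfl | rfl | rfl | rfl | rfl <;>
    rcases (hm b).1 hb with rfl | rfl | rfl | rfl | rfl | rfl <;>
    first | contradiction | exact absurd hab G.irrefl | simp
  have kt : ¬ (¬ G.Adj p r ∧ ¬ G.Adj p s ∧ ¬ G.Adj q r ∧ ¬ G.Adj q s) := by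
    rintro ⟨npr, nps, nqr, nqs⟩
    refine L2 hnored (h.s1.s2.s5.s4) (by first | assumption | exact SimpleGraph.Adj.symm ‹_›) (by first | assumption | exact SimpleGraph.Adj.symm ‹_›) y t ?_
    intro a b ha hb hab
    have hba := hab.symm
    rcases (hm a).1 ha with rfl | rfl | rfl | rfl | rfl | rfl <;>
    rcases (hm b).1 hb with rfl | rfl | rfl | rfl | rfl | rfl <;>
    first | contradiction | exact absurd hab G.irrefl | simp
  clear hm h hrob hnored
  grind

set_option maxHeartbeats 1000000 in
theorem caseII [Fintype V] [DecidableEq V] {G : SimpleGraph V} (hrob : Robust G)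
    (hnored : ¬ ∃ V₀ : Finset V, ReducibleVertexSet G V₀) {x y p q r s t : V}
    (h : Lk6 G x y p q r s t) (nyp : ¬ G.Adj y p) (nyq : ¬ G.Adj y q) (hpq : G.Adj p q) (hyr : G.Adj y r) (hys : G.Adj y s) (nyt : ¬ G.Adj y t) (nrt : ¬ G.Adj r t) (nst : ¬ G.Adj s t) (hpt : G.Adj p t) : False := by
  have hm := h.mem
  have f1 : G.Adj q s → False := by
    intro hqs
    refine L3b hnored (h.s5.s4.s3.s2.s1.s4.s3) ?_ ?_ ?_ ?_ ?_ <;>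
      first | assumption | exact SimpleGraph.Adj.symm ‹_› | exact fun hh => absurd hh.symm ‹_›
  have f2 : G.Adj q r → False := by
    intro hqr
    refine L3b hnored (h.s5.s4.s3.s2.s1.s5.s4.s3) ?_ ?_ ?_ ?_ ?_ <;>
      first | assumption | exact SimpleGraph.Adj.symm ‹_› | exact fun hh => absurd hh.symm ‹_›
  have f3 : G.Adj q t → G.Adj p s → False := by
    intro hqt hps
    refine L3b hnored (h.s5.s4.s3.s2.s1.s4.s3.s4) ?_ ?_ ?_ ?_ ?_ <;>
      first | assumption | exact SimpleGraph.Adj.symm ‹_› | exact fun hh => absurd hh.symm ‹_›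
  have f4 : G.Adj q t → G.Adj p r → False := by
    intro hqt hpr
    refine L3b hnored (h.s5.s4.s3.s2.s1.s5.s4.s3.s4) ?_ ?_ ?_ ?_ ?_ <;>
      first | assumption | exact SimpleGraph.Adj.symm ‹_› | exact fun hh => absurd hh.symm ‹_›
  have nqs : ¬ G.Adj q s := f1
  have nqr : ¬ G.Adj q r := f2
  by_cases hqt : G.Adj q t
  · have nps := f3 hqt
    have npr := f4 hqt
    refine Lk6.conn3 hrob (h.s3.s2.s4.s3) ?_ ?_ ?_ ?_ ?_ ?_ ?_ ?_ ?_ <;>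
      first | assumption | exact fun hh => absurd hh.symm ‹_›
  · refine L2 hnored (h.s1.s5.s4.s3.s2.s4) (by first | assumption | exact SimpleGraph.Adj.symm ‹_›) (by first | assumption | exact SimpleGraph.Adj.symm ‹_›) p s ?_
    intro a b ha hb hab
    have hba := hab.symm
    rcases (hm a).1 ha with rfl | rfl | rfl | rfl | rfl | rfl <;>
    rcases (hm b).1 hb with rfl | rfl | rfl | rfl | rfl | rfl <;>
    first | contradiction | exact absurd hab G.irrefl | simp

set_option maxHeartbeats 1000000 in
theorem caseIII [Fintype V] [DecidableEq V] {G : SimpleGraph V} (hrob : Robust G)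
    (hnored : ¬ ∃ V₀ : Finset V, ReducibleVertexSet G V₀) {x y p q r s t : V}
    (h : Lk6 G x y p q r s t) (nyp : ¬ G.Adj y p) (nyq : ¬ G.Adj y q) (hpq : G.Adj p q) (hyr : G.Adj y r) (nys : ¬ G.Adj y s) (nyt : ¬ G.Adj y t) (nst : ¬ G.Adj s t) : False := by
  have hm := h.mem
  have g1 : ¬ (G.Adj p s ∧ G.Adj q t) := by
    rintro ⟨hps, hqt⟩
    refine L3 hnored (h.s3.s2.s4.s3.s5) ?_ ?_ ?_ ?_ ?_ ?_ <;>
      first | assumption | exact SimpleGraph.Adj.symm ‹_› | exact fun hh => absurd hh.symm ‹_›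
  have g2 : ¬ (G.Adj p t ∧ G.Adj q s) := by
    rintro ⟨hpt, hqs⟩
    refine L3 hnored (h.s3.s2.s4.s3.s4.s5) ?_ ?_ ?_ ?_ ?_ ?_ <;>
      first | assumption | exact SimpleGraph.Adj.symm ‹_› | exact fun hh => absurd hh.symm ‹_›
  have g3 : ¬ (¬ G.Adj p s ∧ ¬ G.Adj p t ∧ G.Adj q s) := by
    rintro ⟨nps, npt, hqs⟩
    refine L2 hnored (h.s3.s2.s3.s4) (by first | assumption | exact SimpleGraph.Adj.symm ‹_›) (by first | assumption | exact SimpleGraph.Adj.symm ‹_›) r q ?_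
    intro a b ha hb hab
    have hba := hab.symm
    rcases (hm a).1 ha with rfl | rfl | rfl | rfl | rfl | rfl <;>
    rcases (hm b).1 hb with rfl | rfl | rfl | rfl | rfl | rfl <;>
    first | contradiction | exact absurd hab G.irrefl | simp
  have g3b : ¬ (¬ G.Adj p s ∧ ¬ G.Adj p t ∧ G.Adj q t) := by
    rintro ⟨nps, npt, hqt⟩
    refine L2 hnored (h.s3.s2.s3.s5.s4) (by first | assumption | exact SimpleGraph.Adj.symm ‹_›) (by first | assumption | exact SimpleGraph.Adj.symm ‹_›) r q ?_
    intro a b ha hb hab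
    have hba := hab.symm
    rcases (hm a).1 ha with rfl | rfl | rfl | rfl | rfl | rfl <;>
    rcases (hm b).1 hb with rfl | rfl | rfl | rfl | rfl | rfl <;>
    first | contradiction | exact absurd hab G.irrefl | simp
  have g4 : ¬ (¬ G.Adj q s ∧ ¬ G.Adj q t ∧ G.Adj p s) := by
    rintro ⟨nqs, nqt, hps⟩
    refine L2 hnored (h.s3.s2.s4) (by first | assumption | exact SimpleGraph.Adj.symm ‹_›) (by first | assumption | exact SimpleGraph.Adj.symm ‹_›) r p ?_
    intro a b ha hb hab
    have hba := hab.symm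
    rcases (hm a).1 ha with rfl | rfl | rfl | rfl | rfl | rfl <;>
    rcases (hm b).1 hb with rfl | rfl | rfl | rfl | rfl | rfl <;>
    first | contradiction | exact absurd hab G.irrefl | simp
  have g4b : ¬ (¬ G.Adj q s ∧ ¬ G.Adj q t ∧ G.Adj p t) := by
    rintro ⟨nqs, nqt, hpt⟩
    refine L2 hnored (h.s3.s2.s5.s4) (by first | assumption | exact SimpleGraph.Adj.symm ‹_›) (by first | assumption | exact SimpleGraph.Adj.symm ‹_›) r p ?_
    intro a b ha hb hab
    have hba := hab.symm
    rcases (hm a).1 ha with rfl | rfl | rfl | rfl | rfl | rfl <;>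
    rcases (hm b).1 hb with rfl | rfl | rfl | rfl | rfl | rfl <;>
    first | contradiction | exact absurd hab G.irrefl | simp
  have g5 : ¬ (¬ G.Adj p s ∧ ¬ G.Adj p t ∧ ¬ G.Adj q s ∧ ¬ G.Adj q t) := by
    rintro ⟨nps, npt, nqs, nqt⟩
    refine L2 hnored (h.s1.s2) (by first | assumption | exact SimpleGraph.Adj.symm ‹_›) (by first | assumption | exact SimpleGraph.Adj.symm ‹_›) r p ?_
    intro a b ha hb hab
    have hba := hab.symm
    rcases (hm a).1 ha with rfl | rfl | rfl | rfl | rfl | rfl <;>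
    rcases (hm b).1 hb with rfl | rfl | rfl | rfl | rfl | rfl <;>
    first | contradiction | exact absurd hab G.irrefl | simp
  have g6 : ¬ (¬ G.Adj p t ∧ ¬ G.Adj q t) := by
    rintro ⟨npt, nqt⟩
    refine L2 hnored (h.s1.s2) (by first | assumption | exact SimpleGraph.Adj.symm ‹_›) (by first | assumption | exact SimpleGraph.Adj.symm ‹_›) r s ?_
    intro a b ha hb hab
    have hba := hab.symm
    rcases (hm a).1 ha with rfl | rfl | rfl | rfl | rfl | rfl <;>
    rcases (hm b).1 hb with rfl | rfl | rfl | rfl | rfl | rfl <;>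
    first | contradiction | exact absurd hab G.irrefl | simp
  have g7 : ¬ (¬ G.Adj p s ∧ ¬ G.Adj q s) := by
    rintro ⟨nps, nqs⟩
    refine L2 hnored (h.s1.s2) (by first | assumption | exact SimpleGraph.Adj.symm ‹_›) (by first | assumption | exact SimpleGraph.Adj.symm ‹_›) r t ?_
    intro a b ha hb hab
    have hba := hab.symm
    rcases (hm a).1 ha with rfl | rfl | rfl | rfl | rfl | rfl <;>
    rcases (hm b).1 hb with rfl | rfl | rfl | rfl | rfl | rfl <;>
    first | contradiction | exact absurd hab G.irrefl | simp
  clear hm h hrob hnored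
  grind

set_option maxHeartbeats 1000000 in
theorem A6a [Fintype V] [DecidableEq V] {G : SimpleGraph V} (hrob : Robust G)
    (hnored : ¬ ∃ V₀ : Finset V, ReducibleVertexSet G V₀) {x y p q r s t : V}
    (h : Lk6 G x y p q r s t) (nyp : ¬ G.Adj y p) (nyq : ¬ G.Adj y q) (hpq : G.Adj p q) : False := by
  have hm := h.mem
  have tr : G.Adj y r → G.Adj s t → False := by
    intro hyr hst
    refine L3b hnored (h) ?_ ?_ ?_ ?_ ?_ <;>
      first | assumption | exact SimpleGraph.Adj.symm ‹_› | exact fun hh => absurd hh.symm ‹_›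
  have ts : G.Adj y s → G.Adj r t → False := by
    intro hys hrt
    refine L3b hnored (h.s4) ?_ ?_ ?_ ?_ ?_ <;>
      first | assumption | exact SimpleGraph.Adj.symm ‹_› | exact fun hh => absurd hh.symm ‹_›
  have tt : G.Adj y t → G.Adj r s → False := by
    intro hyt hrs
    refine L3b hnored (h.s5.s4) ?_ ?_ ?_ ?_ ?_ <;>
      first | assumption | exact SimpleGraph.Adj.symm ‹_› | exact fun hh => absurd hh.symm ‹_›
  have c1 := h.conn1 hrob
  have nrs : G.Adj y t → ¬ G.Adj r s := tt
  have nrt : G.Adj y s → ¬ G.Adj r t := ts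
  have nst : G.Adj y r → ¬ G.Adj s t := tr
  by_cases hyr : G.Adj y r <;> by_cases hys : G.Adj y s <;> by_cases hyt : G.Adj y t
  · have mst := nst hyr
    have mrt := nrt hys
    have mrs := nrs hyt
    exact caseI hrob hnored h nyp nyq hpq hyr hys hyt mrs mrt mst
  · have mst := nst hyr
    have mrt := nrt hys
    have c2 := (h.s5.s4.s3.s2.s1.s2.s3).conn1 hrob
    have hpq' : G.Adj p t ∨ G.Adj q t := by
      rcases c2 with e | e | e | e | e
      · exact Or.inl e.symm
      · exact Or.inr e.symm
      · have := e.symm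
        contradiction
      · have := e.symm
        contradiction
      · have := e.symm
        contradiction
    rcases hpq' with hp | hp
    · exact caseII hrob hnored (h) nyp nyq hpq hyr hys hyt
        (by first | assumption | exact fun hh => absurd hh.symm ‹_›) (by first | assumption | exact fun hh => absurd hh.symm ‹_›) hp
    · exact caseII hrob hnored (h.s2) nyq nyp hpq.symm hyr hys hyt
        (by first | assumption | exact fun hh => absurd hh.symm ‹_›) (by first | assumption | exact fun hh => absurd hh.symm ‹_›) hp
  · have mst := nst hyr
    have mrs := nrs hyt
    have c2 := (h.s4.s3.s2.s1.s2.s3).conn1 hrob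
    have hpq' : G.Adj p s ∨ G.Adj q s := by
      rcases c2 with e | e | e | e | e
      · exact Or.inl e.symm
      · exact Or.inr e.symm
      · have := e.symm
        contradiction
      · have := e.symm
        contradiction
      · have := e.symm
        contradiction
    rcases hpq' with hp | hp
    · exact caseII hrob hnored (h.s5) nyp nyq hpq hyr hyt hys
        (by first | assumption | exact fun hh => absurd hh.symm ‹_›) (by first | assumption | exact fun hh => absurd hh.symm ‹_›) hp
    · exact caseII hrob hnored (h.s2.s5) nyq nyp hpq.symm hyr hyt hys
        (by first | assumption | exact fun hh => absurd hh.symm ‹_›) (by first | assumption | exact fun hh => absurd hh.symm ‹_›) hp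
  · have mst := nst hyr
    exact caseIII hrob hnored (h) nyp nyq hpq hyr hys hyt (by first | assumption | exact fun hh => absurd hh.symm ‹_›)
  · have mrt := nrt hys
    have mrs := nrs hyt
    have c2 := (h.s3.s2.s1.s2.s3).conn1 hrob
    have hpq' : G.Adj p r ∨ G.Adj q r := by
      rcases c2 with e | e | e | e | e
      · exact Or.inl e.symm
      · exact Or.inr e.symm
      · have := e.symm
        contradiction
      · have := e.symm
        contradiction
      · have := e.symm
        contradiction
    rcases hpq' with hp | hp
    · exact caseII hrob hnored (h.s4.s5) nyp nyq hpq hys hyt hyr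
        (by first | assumption | exact fun hh => absurd hh.symm ‹_›) (by first | assumption | exact fun hh => absurd hh.symm ‹_›) hp
    · exact caseII hrob hnored (h.s2.s4.s5) nyq nyp hpq.symm hys hyt hyr
        (by first | assumption | exact fun hh => absurd hh.symm ‹_›) (by first | assumption | exact fun hh => absurd hh.symm ‹_›) hp
  · have mrt := nrt hys
    exact caseIII hrob hnored (h.s4) nyp nyq hpq hys hyr hyt (by first | assumption | exact fun hh => absurd hh.symm ‹_›)
  · have mrs := nrs hyt
    exact caseIII hrob hnored (h.s5.s4) nyp nyq hpq hyt hyr hys (by first | assumption | exact fun hh => absurd hh.symm ‹_›)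
  · rcases c1 with e | e | e | e | e <;> contradiction

set_option maxHeartbeats 1000000 in
theorem A6D [Fintype V] [DecidableEq V] {G : SimpleGraph V} (hrob : Robust G)
    (hnored : ¬ ∃ V₀ : Finset V, ReducibleVertexSet G V₀) {x y p q r s t : V}
    (h : Lk6 G x y p q r s t) (nyp : ¬ G.Adj y p) (nyq : ¬ G.Adj y q) (npq : ¬ G.Adj p q) (hyr : G.Adj y r) (nys : ¬ G.Adj y s) (nyt : ¬ G.Adj y t) (nps : ¬ G.Adj p s) (npt : ¬ G.Adj p t) : False := by
  have hm := h.mem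
  have F1 : G.Adj s t → False := by
    intro hst
    refine L2 hnored (h.s3.s2.s4.s3.s5.s4) (by first | assumption | exact SimpleGraph.Adj.symm ‹_›) (by first | assumption | exact SimpleGraph.Adj.symm ‹_›) r q ?_
    intro a b ha hb hab
    have hba := hab.symm
    rcases (hm a).1 ha with rfl | rfl | rfl | rfl | rfl | rfl <;>
    rcases (hm b).1 hb with rfl | rfl | rfl | rfl | rfl | rfl <;>
    first | contradiction | exact absurd hab G.irrefl | simp
  have F2 : ¬ (¬ G.Adj s t ∧ G.Adj q s) := by
    rintro ⟨nst, hqs⟩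
    refine L2 hnored (h.s3.s2.s3.s4) (by first | assumption | exact SimpleGraph.Adj.symm ‹_›) (by first | assumption | exact SimpleGraph.Adj.symm ‹_›) r q ?_
    intro a b ha hb hab
    have hba := hab.symm
    rcases (hm a).1 ha with rfl | rfl | rfl | rfl | rfl | rfl <;>
    rcases (hm b).1 hb with rfl | rfl | rfl | rfl | rfl | rfl <;>
    first | contradiction | exact absurd hab G.irrefl | simp
  have F3 : ¬ (¬ G.Adj s t ∧ G.Adj q t) := by
    rintro ⟨nst, hqt⟩
    refine L2 hnored (h.s3.s2.s3.s5.s4) (by first | assumption | exact SimpleGraph.Adj.symm ‹_›) (by first | assumption | exact SimpleGraph.Adj.symm ‹_›) r q ?_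
    intro a b ha hb hab
    have hba := hab.symm
    rcases (hm a).1 ha with rfl | rfl | rfl | rfl | rfl | rfl <;>
    rcases (hm b).1 hb with rfl | rfl | rfl | rfl | rfl | rfl <;>
    first | contradiction | exact absurd hab G.irrefl | simp
  have F4 : ¬ (¬ G.Adj s t ∧ ¬ G.Adj q s ∧ ¬ G.Adj q t) := by
    rintro ⟨nst, nqs, nqt⟩
    refine m1 G hnored x y r (by simp [hm]) (by simp [hm]) hyr ?_
    intro a b ha hb hab
    have hba := hab.symm
    rcases (hm a).1 ha with rfl | rfl | rfl | rfl | rfl | rfl <;>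
    rcases (hm b).1 hb with rfl | rfl | rfl | rfl | rfl | rfl <;>
    first | contradiction | exact absurd hab G.irrefl | simp
  clear hm h hrob hnored
  grind

set_option maxHeartbeats 1000000 in
theorem A6E [Fintype V] [DecidableEq V] {G : SimpleGraph V} (hrob : Robust G)
    (hnored : ¬ ∃ V₀ : Finset V, ReducibleVertexSet G V₀) {x y p q r s t : V}
    (h : Lk6 G x y p q r s t) (nyp : ¬ G.Adj y p) (nyq : ¬ G.Adj y q) (npq : ¬ G.Adj p q) (hyr : G.Adj y r) (hps : G.Adj p s) (nyt : ¬ G.Adj y t) (npt : ¬ G.Adj p t) (nqt : ¬ G.Adj q t) : False := by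
  have hm := h.mem
  refine L2 hnored (h.s3.s2.s4) (by first | assumption | exact SimpleGraph.Adj.symm ‹_›) (by first | assumption | exact SimpleGraph.Adj.symm ‹_›) r s ?_
  intro a b ha hb hab
  have hba := hab.symm
  rcases (hm a).1 ha with rfl | rfl | rfl | rfl | rfl | rfl <;>
  rcases (hm b).1 hb with rfl | rfl | rfl | rfl | rfl | rfl <;>
  first | contradiction | exact absurd hab G.irrefl | simp

set_option maxHeartbeats 1000000 in
theorem A6b1 [Fintype V] [DecidableEq V] {G : SimpleGraph V} (hrob : Robust G)
    (hnored : ¬ ∃ V₀ : Finset V, ReducibleVertexSet G V₀) {x y p q r s t : V}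
    (h : Lk6 G x y p q r s t) (nyp : ¬ G.Adj y p) (nyq : ¬ G.Adj y q) (npq : ¬ G.Adj p q) (hyr : G.Adj y r) (hps : G.Adj p s) : False := by
  have hm := h.mem
  have nqp : ¬ G.Adj q p := fun hh => npq hh.symm
  have npy : ¬ G.Adj p y := fun hh => nyp hh.symm
  have nqy : ¬ G.Adj q y := fun hh => nyq hh.symm
  have lrst : G.Adj y r → G.Adj p s → G.Adj q t → False := by
    intro hyr hps hqt
    refine L3 hnored (h.s3.s2.s4) ?_ ?_ ?_ ?_ ?_ ?_ <;>
      first | assumption | exact SimpleGraph.Adj.symm ‹_› | exact fun hh => absurd hh.symm ‹_›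
  have lrts : G.Adj y r → G.Adj p t → G.Adj q s → False := by
    intro hyr hpt hqs
    refine L3 hnored (h.s3.s2.s5.s4) ?_ ?_ ?_ ?_ ?_ ?_ <;>
      first | assumption | exact SimpleGraph.Adj.symm ‹_› | exact fun hh => absurd hh.symm ‹_›
  have lsrt : G.Adj y s → G.Adj p r → G.Adj q t → False := by
    intro hys hpr hqt
    refine L3 hnored (h.s4.s3.s2.s4) ?_ ?_ ?_ ?_ ?_ ?_ <;>
      first | assumption | exact SimpleGraph.Adj.symm ‹_› | exact fun hh => absurd hh.symm ‹_›
  have lstr : G.Adj y s → G.Adj p t → G.Adj q r → False := by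
    intro hys hpt hqr
    refine L3 hnored (h.s4.s3.s2.s5.s4) ?_ ?_ ?_ ?_ ?_ ?_ <;>
      first | assumption | exact SimpleGraph.Adj.symm ‹_› | exact fun hh => absurd hh.symm ‹_›
  have ltrs : G.Adj y t → G.Adj p r → G.Adj q s → False := by
    intro hyt hpr hqs
    refine L3 hnored (h.s5.s4.s3.s2.s4) ?_ ?_ ?_ ?_ ?_ ?_ <;>
      first | assumption | exact SimpleGraph.Adj.symm ‹_› | exact fun hh => absurd hh.symm ‹_›
  have ltsr : G.Adj y t → G.Adj p s → G.Adj q r → False := by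
    intro hyt hps hqr
    refine L3 hnored (h.s5.s4.s3.s2.s5.s4) ?_ ?_ ?_ ?_ ?_ ?_ <;>
      first | assumption | exact SimpleGraph.Adj.symm ‹_› | exact fun hh => absurd hh.symm ‹_›
  have cq := (h.s2.s1).conn1 hrob
  have nqt : ¬ G.Adj q t := lrst hyr hps
  by_cases hyt : G.Adj y t
  · have nqr : ¬ G.Adj q r := ltsr hyt hps
    have hqs : G.Adj q s := by rcases cq with e | e | e | e | e <;> first | exact e | contradiction
    exact A6D hrob hnored (h.s1.s2.s4) npq npy nqy hps
      (fun hh => ltrs hyt hh hqs) (fun hh => lrts hyr hh hqs) nqr nqt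
  · by_cases hpt : G.Adj p t
    · have nqs : ¬ G.Adj q s := lrts hyr hpt
      have hqr : G.Adj q r := by rcases cq with e | e | e | e | e <;> first | exact e | contradiction
      exact A6D hrob hnored (h.s2) nyq nyp nqp hyr
        (fun hh => lstr hh hpt hqr) hyt nqs nqt
    · exact A6E hrob hnored h nyp nyq npq hyr hps hyt hpt nqt

set_option maxHeartbeats 1000000 in
theorem A6b2 [Fintype V] [DecidableEq V] {G : SimpleGraph V} (hrob : Robust G)
    (hnored : ¬ ∃ V₀ : Finset V, ReducibleVertexSet G V₀) {x y p q r s t : V}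
    (h : Lk6 G x y p q r s t) (nyp : ¬ G.Adj y p) (nyq : ¬ G.Adj y q) (npq : ¬ G.Adj p q) (hyr : G.Adj y r) : False := by
  have hm := h.mem
  have npy : ¬ G.Adj p y := fun hh => nyp hh.symm
  have nps : ¬ G.Adj p s := A6b1 hrob hnored h nyp nyq npq hyr
  have npt : ¬ G.Adj p t := A6b1 hrob hnored (h.s5) nyp nyq npq hyr
  have cp := (h.s1).conn1 hrob
  have hpr : G.Adj p r := by rcases cp with e | e | e | e | e <;> first | exact e | contradiction
  have nys : ¬ G.Adj y s := A6b1 hrob hnored (h.s1) npy npq nyq hpr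
  have nyt : ¬ G.Adj y t := A6b1 hrob hnored (h.s1.s5) npy npq nyq hpr
  exact A6D hrob hnored h nyp nyq npq hyr nys nyt nps npt

set_option maxHeartbeats 1000000 in
theorem A6 [Fintype V] [DecidableEq V] {G : SimpleGraph V} (hrob : Robust G)
    (hnored : ¬ ∃ V₀ : Finset V, ReducibleVertexSet G V₀) {x y p q r s t : V}
    (h : Lk6 G x y p q r s t) (nyp : ¬ G.Adj y p) (nyq : ¬ G.Adj y q) : False := by
  have hm := h.mem
  by_cases hpq : G.Adj p q
  · exact A6a hrob hnored h nyp nyq hpq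
  · rcases h.conn1 hrob with hh | hh | hh | hh | hh
    · exact nyp hh
    · exact nyq hh
    · exact A6b2 hrob hnored h nyp nyq hpq hh
    · exact A6b2 hrob hnored (h.s4) nyp nyq hpq hh
    · exact A6b2 hrob hnored (h.s5.s4) nyp nyq hpq hh

set_option maxHeartbeats 1000000 in
theorem A5core [Fintype V] [DecidableEq V] {G : SimpleGraph V} (hrob : Robust G)
    (hnored : ¬ ∃ V₀ : Finset V, ReducibleVertexSet G V₀) {x y p q r s : V}
    (hnd : [y, p, q, r, s].Nodup)
    (hm : ∀ z, G.Adj x z ↔ z = y ∨ z = p ∨ z = q ∨ z = r ∨ z = s)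
    (nyp : ¬ G.Adj y p) (nyq : ¬ G.Adj y q) (hyr : G.Adj y r) : False := by
  have xy : G.Adj x y := by simp [hm]
  have xp : G.Adj x p := by simp [hm]
  have xq : G.Adj x q := by simp [hm]
  have xr : G.Adj x r := by simp [hm]
  have xs : G.Adj x s := by simp [hm]
  simp at hnd
  by_cases hpq : G.Adj p q
  · refine m2 G hnored x p q y r r s (by simp; grind) xp xq xy xr hpq hyr ?_
    intro a b ha hb hab
    have hba := hab.symm
    rcases (hm a).1 ha with rfl | rfl | rfl | rfl | rfl <;>
    rcases (hm b).1 hb with rfl | rfl | rfl | rfl | rfl <;>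
    first | contradiction | exact absurd hab G.irrefl | simp
  have nps : ¬ G.Adj p s := by
    intro hps
    refine m2 G hnored x p s y r r s (by simp; grind) xp xs xy xr hps hyr ?_
    intro a b ha hb hab
    have hba := hab.symm
    rcases (hm a).1 ha with rfl | rfl | rfl | rfl | rfl <;>
    rcases (hm b).1 hb with rfl | rfl | rfl | rfl | rfl <;>
    first | contradiction | exact absurd hab G.irrefl | simp
  have nqs : ¬ G.Adj q s := by
    intro hqs
    refine m2 G hnored x q s y r r s (by simp; grind) xq xs xy xr hqs hyr ?_
    intro a b ha hb hab
    have hba := hab.symm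
    rcases (hm a).1 ha with rfl | rfl | rfl | rfl | rfl <;>
    rcases (hm b).1 hb with rfl | rfl | rfl | rfl | rfl <;>
    first | contradiction | exact absurd hab G.irrefl | simp
  have hpr : G.Adj p r := by
    obtain ⟨a, ha, b, hb, hxb, hab⟩ := leave G hrob x {p} (by simp) (by simp [xp]) (by simp)
    rw [Finset.mem_singleton] at ha hb
    rw [ha] at hab
    have hba := hab.symm
    rcases (hm b).1 hxb with rfl | rfl | rfl | rfl | rfl <;>
      first | contradiction | exact hab
  have nys : ¬ G.Adj y s := by
    intro hys
    refine m2 G hnored x y s p r r s (by simp; grind) xy xs xp xr hys hpr ?_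
    intro a b ha hb hab
    have hba := hab.symm
    rcases (hm a).1 ha with rfl | rfl | rfl | rfl | rfl <;>
    rcases (hm b).1 hb with rfl | rfl | rfl | rfl | rfl <;>
    first | contradiction | exact absurd hab G.irrefl | simp
  refine m1 G hnored x y r xy xr hyr ?_
  intro a b ha hb hab
  have hba := hab.symm
  rcases (hm a).1 ha with rfl | rfl | rfl | rfl | rfl <;>
  rcases (hm b).1 hb with rfl | rfl | rfl | rfl | rfl <;>
  first | contradiction | exact absurd hab G.irrefl | simp

theorem A5 [Fintype V] [DecidableEq V] {G : SimpleGraph V} (hrob : Robust G)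
    (hnored : ¬ ∃ V₀ : Finset V, ReducibleVertexSet G V₀) {x y p q r s : V}
    (hnd : [y, p, q, r, s].Nodup)
    (hm : ∀ z, G.Adj x z ↔ z = y ∨ z = p ∨ z = q ∨ z = r ∨ z = s)
    (nyp : ¬ G.Adj y p) (nyq : ¬ G.Adj y q) : False := by
  obtain ⟨a, ha, b, hb, hxb, hab⟩ := leave G hrob x {y} (by simp) (by simp [hm]) (by simp)
  rw [Finset.mem_singleton] at ha hb
  rw [ha] at hab
  rcases (hm b).1 hxb with h | h | h | h | h <;> rw [h] at hab
  · exact G.irrefl hab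
  · exact nyp hab
  · exact nyq hab
  · exact A5core hrob hnored hnd hm nyp nyq hab
  · refine A5core hrob hnored (x := x) (r := s) (s := r) ?_ ?_ nyp nyq hab
    · simp at hnd ⊢
      grind
    · intro z
      rw [hm]
      tauto

open Classical in
/-- the neighborhood as a finset -/
noncomputable def nb [Fintype V] (G : SimpleGraph V) (x : V) : Finset V :=
  Finset.univ.filter (fun z => G.Adj x z)

theorem mem_nb [Fintype V] (G : SimpleGraph V) (x z : V) : z ∈ nb G x ↔ G.Adj x z := by
  simp [nb]

theorem ncard_nb [Fintype V] (G : SimpleGraph V) (x : V) :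
    (G.neighborSet x).ncard = (nb G x).card := by
  rw [← Set.ncard_coe_finset]
  congr 1
  ext z
  simp [mem_nb]

theorem five_le [Fintype V] [DecidableEq V] {G : SimpleGraph V} (hrob : Robust G)
    (hnored : ¬ ∃ V₀ : Finset V, ReducibleVertexSet G V₀) (x : V) : 5 ≤ (nb G x).card := by
  by_contra hlt
  by_cases hne : (nb G x).Nonempty
  · obtain ⟨a, ha, b, hb, hxb, hab⟩ := leave G hrob x (nb G x) hne
      (fun a ha => (mem_nb G x a).1 ha) (by omega)
    exact hb ((mem_nb G x b).2 hxb)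
  · apply hnored
    refine ⟨{x}, red_of G {x} (by simp) (ι := Fin 0) (fun _ => ∅) ∅ (fun i => i.elim0)
      (fun i => i.elim0) (by simp) ?_ (fun i => i.elim0)⟩
    intro z hz y _ hy _ _
    rw [Finset.mem_singleton] at hz
    subst hz
    exact absurd ⟨y, (mem_nb G _ y).2 hy⟩ hne

theorem comatch [Fintype V] [DecidableEq V] {G : SimpleGraph V} (hrob : Robust G)
    (hnored : ¬ ∃ V₀ : Finset V, ReducibleVertexSet G V₀) (x : V) (hx : (nb G x).card ≤ 6)
    (y p q : V) (hy : G.Adj x y) (hp : G.Adj x p) (hq : G.Adj x q) (hyp : y ≠ p) (hyq : y ≠ q)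
    (hpq : p ≠ q) : G.Adj y p ∨ G.Adj y q := by
  by_contra hcon
  rw [not_or] at hcon
  have h5 := five_le hrob hnored x
  have hsub : ({y, p, q} : Finset V) ⊆ nb G x := by
    intro z hz
    simp only [Finset.mem_insert, Finset.mem_singleton] at hz
    rw [mem_nb]
    rcases hz with rfl | rfl | rfl <;> assumption
  have h3 : ({y, p, q} : Finset V).card = 3 := Finset.card_eq_three.2 ⟨y, p, q, hyp, hyq, hpq, rfl⟩
  have hsd := Finset.card_sdiff_of_subset hsub
  have hmem : ∀ z, G.Adj x z ↔ (z = y ∨ z = p ∨ z = q) ∨ z ∈ nb G x \ {y, p, q} := by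
    intro z
    rw [Finset.mem_sdiff, mem_nb]
    have := @hsub z
    rw [mem_nb] at this
    simp only [Finset.mem_insert, Finset.mem_singleton] at this ⊢
    tauto
  have hnot : ∀ z ∈ nb G x \ {y, p, q}, z ≠ y ∧ z ≠ p ∧ z ≠ q := by
    intro z hz
    simp at hz
    tauto
  rcases (by omega : (nb G x).card = 5 ∨ (nb G x).card = 6) with hc | hc
  · obtain ⟨r, s, hrs, he⟩ := Finset.card_eq_two.1 (by omega : (nb G x \ {y, p, q}).card = 2)
    rw [he] at hmem hnot
    refine A5 hrob hnored (x := x) (y := y) (p := p) (q := q) (r := r) (s := s) ?_ ?_ hcon.1 hcon.2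
    · have h1 := hnot r (by simp)
      have h2 := hnot s (by simp)
      simp
      grind
    · intro z
      rw [hmem]
      simp
      tauto
  · obtain ⟨r, s, t, hrs, hrt, hst, he⟩ :=
      Finset.card_eq_three.1 (by omega : (nb G x \ {y, p, q}).card = 3)
    rw [he] at hmem hnot
    refine A6 hrob hnored (x := x) (y := y) (p := p) (q := q) (r := r) (s := s) (t := t)
      ⟨?_, ?_⟩ hcon.1 hcon.2
    · have h1 := hnot r (by simp)
      have h2 := hnot s (by simp)
      have h3 := hnot t (by simp)
      simp
      grind
    · intro z
      rw [hmem]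
      simp
      tauto

theorem privLe [Fintype V] [DecidableEq V] {G : SimpleGraph V} (hrob : Robust G)
    (hnored : ¬ ∃ V₀ : Finset V, ReducibleVertexSet G V₀) (u v : V) (hu : (nb G u).card ≤ 6)
    (huv : G.Adj u v) : (nb G u \ insert v (nb G v)).card ≤ 1 := by
  rw [Finset.card_le_one]
  intro a ha b hb
  by_contra hab
  simp only [Finset.mem_sdiff, Finset.mem_insert, not_or, mem_nb] at ha hb
  rcases comatch hrob hnored u hu v a b huv ha.1 hb.1 (Ne.symm ha.2.1) (Ne.symm hb.2.1) hab with h | h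
  · exact ha.2.2 h
  · exact hb.2.2 h

theorem cardSplit [Fintype V] [DecidableEq V] {G : SimpleGraph V} (u v : V) (huv : G.Adj u v) :
    (nb G u).card = 1 + (nb G u ∩ nb G v).card + (nb G u \ insert v (nb G v)).card := by
  have h1 : nb G u = insert v ((nb G u ∩ nb G v) ∪ (nb G u \ insert v (nb G v))) := by
    ext z
    simp only [Finset.mem_insert, Finset.mem_union, Finset.mem_inter, Finset.mem_sdiff, mem_nb]
    by_cases hz : z = v
    · subst hz; simp [huv]
    · tauto
  have h2 : v ∉ (nb G u ∩ nb G v) ∪ (nb G u \ insert v (nb G v)) := by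
    simp [mem_nb]
  have h3 : Disjoint (nb G u ∩ nb G v) (nb G u \ insert v (nb G v)) := by
    rw [Finset.disjoint_left]
    intro z
    simp only [Finset.mem_insert, Finset.mem_inter, Finset.mem_sdiff, mem_nb]
    tauto
  conv_lhs => rw [h1]
  rw [Finset.card_insert_of_notMem h2, Finset.card_union_of_disjoint h3]
  omega

theorem memSplit [Fintype V] [DecidableEq V] {G : SimpleGraph V} (u v y : V) (hy : G.Adj u y) :
    y = v ∨ y ∈ nb G u ∩ nb G v ∨ y ∈ nb G u \ insert v (nb G v) := by
  simp only [Finset.mem_insert, Finset.mem_inter, Finset.mem_sdiff, mem_nb]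
  tauto

theorem rest [DecidableEq V] (C : Finset V) (a b : V) (ha : a ∈ C) (hb : b ∈ C) (hab : a ≠ b) :
    ((C \ {a, b}).card + 2 = C.card) ∧ (∀ c, c ∈ C ↔ c = a ∨ c = b ∨ c ∈ C \ {a, b}) ∧
      ∀ c ∈ C \ {a, b}, c ≠ a ∧ c ≠ b := by
  have hs : ({a, b} : Finset V) ⊆ C := by
    intro z hz
    simp at hz
    rcases hz with rfl | rfl <;> assumption
  have h1 := Finset.card_sdiff_add_card_eq_card hs
  rw [Finset.card_pair hab] at h1
  refine ⟨h1, fun c => ?_, fun c hc => ?_⟩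
  · simp only [Finset.mem_sdiff, Finset.mem_insert, Finset.mem_singleton]
    constructor
    · tauto
    · rintro (rfl | rfl | h)
      · exact ha
      · exact hb
      · exact h.1
  · simp at hc
    tauto

theorem lowC5 [Fintype V] [DecidableEq V] {G : SimpleGraph V} (hrob : Robust G)
    (hnored : ¬ ∃ V₀ : Finset V, ReducibleVertexSet G V₀) (u v : V) (hu : (nb G u).card ≤ 6)
    (huv : G.Adj u v) (C : Finset V) (hC : ∀ z ∈ C, G.Adj u z ∧ G.Adj v z)
    (hU : ∀ z, G.Adj u z → z = v ∨ z ∈ C) (hV : ∀ z, G.Adj v z → z = u ∨ z ∈ C)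
    (hc : C.card = 5) : False := by
  have key : ∀ y ∈ C, ∀ z ∈ C, ∀ t ∈ C, y ≠ z → y ≠ t → z ≠ t → G.Adj y z ∨ G.Adj y t :=
    fun y hy z hz t ht => comatch hrob hnored u hu y z t (hC y hy).1 (hC z hz).1 (hC t ht).1
  obtain ⟨b, hb, e, he, hbe, h1⟩ := pick2 G C (by omega) key
  obtain ⟨r1, r2, r3⟩ := rest C b e hb he hbe
  obtain ⟨c, hc', d, hd, hcd, h2⟩ := pick2 G (C \ {b, e}) (by omega) (fun y hy z hz t ht =>
    key y ((r2 y).2 (Or.inr (Or.inr hy))) z ((r2 z).2 (Or.inr (Or.inr hz)))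
      t ((r2 t).2 (Or.inr (Or.inr ht))))
  obtain ⟨q1, q2, q3⟩ := rest (C \ {b, e}) c d hc' hd hcd
  obtain ⟨a, ha⟩ := Finset.card_eq_one.1 (by omega : ((C \ {b, e}) \ {c, d}).card = 1)
  rw [ha] at q2 q3
  simp only [Finset.mem_singleton] at q2 q3
  have mem : ∀ z, z ∈ C ↔ z = b ∨ z = e ∨ z = c ∨ z = d ∨ z = a := by
    intro z
    rw [r2, q2]
  have a1 := q3 a rfl
  have a2 := r3 a ((q2 a).2 (by simp))
  have c2 := r3 c hc'
  have d2 := r3 d hd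
  have hcb := h1 c ((mem c).2 (by simp)) c2.1 c2.2
  have hdb := h1 d ((mem d).2 (by simp)) d2.1 d2.2
  have hA := hC a ((mem a).2 (by simp))
  have hB := hC b hb
  have hCc := hC c ((mem c).2 (by simp))
  have hD := hC d ((mem d).2 (by simp))
  have hE := hC e he
  refine hnored ⟨_, redB5 G u v a b c d e ?_ ?_ ?_ huv hA.1 hB.1 hCc.1 hD.1 hE.1
    hA.2 hB.2 hCc.2 hD.2 hE.2 hcb.1.symm hdb.2 hdb.1.symm hcb.2⟩
  · have := huv.ne
    have := hA.1.ne
    have := hA.2.ne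
    have := hB.1.ne
    have := hB.2.ne
    have := hCc.1.ne
    have := hCc.2.ne
    have := hD.1.ne
    have := hD.2.ne
    have := hE.1.ne
    have := hE.2.ne
    simp
    grind
  · intro y hy
    have := hU y hy
    rw [mem] at this
    tauto
  · intro y hy
    have := hV y hy
    rw [mem] at this
    tauto

theorem lowC4 [Fintype V] [DecidableEq V] {G : SimpleGraph V} (hrob : Robust G)
    (hnored : ¬ ∃ V₀ : Finset V, ReducibleVertexSet G V₀) (u v p : V) (hu : (nb G u).card ≤ 6)
    (huv : G.Adj u v) (C : Finset V) (hC : ∀ z ∈ C, G.Adj u z ∧ G.Adj v z)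
    (hU : ∀ z, G.Adj u z → z = v ∨ z = p ∨ z ∈ C) (hV : ∀ z, G.Adj v z → z = u ∨ z ∈ C)
    (hc : C.card = 4) : False := by
  have key : ∀ y ∈ C, ∀ z ∈ C, ∀ t ∈ C, y ≠ z → y ≠ t → z ≠ t → G.Adj y z ∨ G.Adj y t :=
    fun y hy z hz t ht => comatch hrob hnored u hu y z t (hC y hy).1 (hC z hz).1 (hC t ht).1
  obtain ⟨a, ha, b, hb, hab, h1⟩ := pick2 G C (by omega) key
  obtain ⟨r1, r2, r3⟩ := rest C a b ha hb hab
  obtain ⟨c, d, hcd, he⟩ := Finset.card_eq_two.1 (by omega : (C \ {a, b}).card = 2)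
  rw [he] at r2 r3
  simp only [Finset.mem_insert, Finset.mem_singleton] at r2 r3
  have c2 := r3 c (by simp)
  have d2 := r3 d (by simp)
  have hc' := (r2 c).2 (by simp)
  have hd' := (r2 d).2 (by simp)
  have hca := h1 c hc' c2.1 c2.2
  have hda := h1 d hd' d2.1 d2.2
  have hA := hC a ha
  have hB := hC b hb
  have hCc := hC c hc'
  have hD := hC d hd'
  refine hnored ⟨_, redB4 G u v p a b c d ?_ ?_ ?_ huv hA.1 hB.1 hCc.1 hD.1
    hA.2 hB.2 hCc.2 hD.2 hca.1.symm hda.1.symm hca.2.symm hda.2.symm⟩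
  · have := huv.ne
    have := hA.1.ne
    have := hA.2.ne
    have := hB.1.ne
    have := hB.2.ne
    have := hCc.1.ne
    have := hCc.2.ne
    have := hD.1.ne
    have := hD.2.ne
    simp
    grind
  · intro y hy
    have := hU y hy
    rw [r2] at this
    tauto
  · intro y hy
    have := hV y hy
    rw [r2] at this
    tauto

theorem lowC6 [Fintype V] [DecidableEq V] {G : SimpleGraph V} (hrob : Robust G)
    (hnored : ¬ ∃ V₀ : Finset V, ReducibleVertexSet G V₀) (u v p q : V) (hu : (nb G u).card ≤ 6)
    (huv : G.Adj u v) (C : Finset V) (hC : ∀ z ∈ C, G.Adj u z ∧ G.Adj v z)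
    (hU : ∀ z, G.Adj u z → z = v ∨ z = p ∨ z ∈ C) (hV : ∀ z, G.Adj v z → z = u ∨ z = q ∨ z ∈ C)
    (hup : G.Adj u p) (hvq : G.Adj v q) (hvp : ¬ G.Adj v p) (huq : ¬ G.Adj u q)
    (hpv : p ≠ v) (hqu : q ≠ u)
    (hpC : ∀ z ∈ C, G.Adj p z) (hqC : ∀ z ∈ C, G.Adj q z)
    (hc : C.card = 4 ∨ C.card = 3) : False := by
  have key : ∀ y ∈ C, ∀ z ∈ C, ∀ t ∈ C, y ≠ z → y ≠ t → z ≠ t → G.Adj y z ∨ G.Adj y t :=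
    fun y hy z hz t ht => comatch hrob hnored u hu y z t (hC y hy).1 (hC z hz).1 (hC t ht).1
  obtain ⟨a, ha, d, hd, hab, h1⟩ := pick2 G C (by omega) key
  obtain ⟨r1, r2, r3⟩ := rest C a d ha hd hab
  have hpq : p ≠ q := by
    rintro rfl
    exact hvp hvq
  have hpz : ∀ z ∈ C, p ≠ z ∧ q ≠ z ∧ u ≠ z ∧ v ≠ z := fun z hz =>
    ⟨(hpC z hz).ne, (hqC z hz).ne, (hC z hz).1.ne, (hC z hz).2.ne⟩
  have := huv.ne
  have := hup.ne
  have := hvq.ne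
  have := hpz a ha
  have := hpz d hd
  have hA := hC a ha
  have hD := hC d hd
  rcases hc with hc | hc
  · obtain ⟨b, c, hbc, he⟩ := Finset.card_eq_two.1 (by omega : (C \ {a, d}).card = 2)
    rw [he] at r2 r3
    simp only [Finset.mem_insert, Finset.mem_singleton] at r2 r3
    have b2 := r3 b (by simp)
    have c2 := r3 c (by simp)
    have hb' := (r2 b).2 (by simp)
    have hc' := (r2 c).2 (by simp)
    have hbd := h1 b hb' b2.1 b2.2
    have hcd := h1 c hc' c2.1 c2.2
    have hB := hC b hb'
    have hCc := hC c hc'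
    refine hnored ⟨_, redB6 G u v p q a b c d ?_ ?_ ?_ huv hA.1 hB.1 hCc.1 hD.1
      hA.2 hB.2 hCc.2 hD.2 hup hvq (hpC b hb') (hqC c hc') hcd.2 hbd.2⟩
    · have := hpz b hb'
      have := hpz c hc'
      clear key h1 r1 r2 r3 hpC hqC hC hpz hU hV
      simp
      grind
    · intro y hy
      have := hU y hy
      rw [r2] at this
      clear * - this
      tauto
    · intro y hy
      have := hV y hy
      rw [r2] at this
      clear * - this
      tauto
  · obtain ⟨c, he⟩ := Finset.card_eq_one.1 (by omega : (C \ {a, d}).card = 1)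
    rw [he] at r2 r3
    simp only [Finset.mem_singleton] at r2 r3
    have c2 := r3 c rfl
    have hc' := (r2 c).2 (by simp)
    have hcd := h1 c hc' c2.1 c2.2
    have hCc := hC c hc'
    refine hnored ⟨_, redB3 G u v p q a d c ?_ ?_ ?_ huv hA.1 hD.1 hCc.1
      hA.2 hD.2 hCc.2 hup hvq hcd.1.symm hcd.2.symm (hpC d hd) (hqC a ha)⟩
    · have := hpz c hc'
      clear key h1 r1 r2 r3 hpC hqC hC hpz hU hV
      simp
      grind
    · intro y hy
      have := hU y hy
      rw [r2] at this
      clear * - this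
      tauto
    · intro y hy
      have := hV y hy
      rw [r2] at this
      clear * - this
      tauto

theorem low_indep [Fintype V] [DecidableEq V] {G : SimpleGraph V} (hrob : Robust G)
    (hnored : ¬ ∃ V₀ : Finset V, ReducibleVertexSet G V₀) (u v : V) (hu : (nb G u).card ≤ 6)
    (hv : (nb G v).card ≤ 6) (huv : G.Adj u v) : False := by
  have su := cardSplit u v huv
  have sv := cardSplit v u huv.symm
  have pu := privLe hrob hnored u v hu huv
  have pv := privLe hrob hnored v u hv huv.symm
  have mu := memSplit (G := G) u v
  have mv := memSplit (G := G) v u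
  have u5 := five_le hrob hnored u
  have v5 := five_le hrob hnored v
  rw [Finset.inter_comm (nb G v)] at sv mv
  have hC : ∀ z ∈ nb G u ∩ nb G v, G.Adj u z ∧ G.Adj v z := by
    intro z hz
    rw [Finset.mem_inter, mem_nb, mem_nb] at hz
    exact hz
  have hP : ∀ z ∈ nb G u \ insert v (nb G v), G.Adj u z ∧ z ≠ v ∧ ¬ G.Adj v z := by
    intro z hz
    simpa [mem_nb] using hz
  have hQ : ∀ z ∈ nb G v \ insert u (nb G u), G.Adj v z ∧ z ≠ u ∧ ¬ G.Adj u z := by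
    intro z hz
    simpa [mem_nb] using hz
  generalize nb G u ∩ nb G v = C at *
  generalize nb G u \ insert v (nb G v) = P at *
  generalize nb G v \ insert u (nb G u) = Q at *
  rcases (by omega : P.card = 0 ∨ P.card = 1) with hp | hp <;>
  rcases (by omega : Q.card = 0 ∨ Q.card = 1) with hq | hq
  · rw [Finset.card_eq_zero] at hp hq
    subst hp hq
    simp only [Finset.notMem_empty, or_false] at mu mv
    rw [Finset.card_empty] at su sv
    rcases (by omega : C.card = 4 ∨ C.card = 5) with hc | hc
    · refine lowC4 hrob hnored u v v hu huv C hC (fun z hz => ?_) mv hc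
      rcases mu z hz with h | h
      · exact Or.inl h
      · exact Or.inr (Or.inr h)
    · exact lowC5 hrob hnored u v hu huv C hC mu mv hc
  · rw [Finset.card_eq_zero] at hp
    subst hp
    obtain ⟨q, rfl⟩ := Finset.card_eq_one.1 hq
    simp only [Finset.notMem_empty, or_false, Finset.mem_singleton] at mu mv
    simp only [Finset.card_empty, Finset.card_singleton] at *
    refine lowC4 hrob hnored v u q hv huv.symm C (fun z hz => (hC z hz).symm) (fun z hz => ?_)
      mu (by omega)
    have := mv z hz
    clear * - this
    tauto
  · rw [Finset.card_eq_zero] at hq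
    subst hq
    obtain ⟨p, rfl⟩ := Finset.card_eq_one.1 hp
    simp only [Finset.notMem_empty, or_false, Finset.mem_singleton] at mu mv
    simp only [Finset.card_empty, Finset.card_singleton] at *
    refine lowC4 hrob hnored u v p hu huv C hC (fun z hz => ?_) mv (by omega)
    have := mu z hz
    clear * - this
    tauto
  · obtain ⟨p, rfl⟩ := Finset.card_eq_one.1 hp
    obtain ⟨q, rfl⟩ := Finset.card_eq_one.1 hq
    simp only [Finset.mem_singleton, Finset.card_singleton] at *
    have hP := hP p rfl
    have hQ := hQ q rfl
    refine lowC6 hrob hnored u v p q hu huv C hC (fun z hz => ?_) (fun z hz => ?_) hP.1 hQ.1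
      hP.2.2 hQ.2.2 hP.2.1 hQ.2.1 ?_ ?_ (by omega)
    · have := mu z hz
      clear * - this
      tauto
    · have := mv z hz
      clear * - this
      tauto
    · intro z hz
      have h := hC z hz
      refine (comatch hrob hnored u hu p v z hP.1 huv h.1 hP.2.1 ?_ h.2.ne).resolve_left ?_
      · rintro rfl
        exact hP.2.2 h.2
      · exact fun h' => hP.2.2 h'.symm
    · intro z hz
      have h := hC z hz
      refine (comatch hrob hnored v hv q u z hQ.1 huv.symm h.2 hQ.2.1 ?_ h.1.ne).resolve_left ?_
      · rintro rfl
        exact hQ.2.2 h.1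
      · exact fun h' => hQ.2.2 h'.symm

theorem hallstep [Fintype V] [DecidableEq V] {G : SimpleGraph V}
    (hnored : ¬ ∃ V₀ : Finset V, ReducibleVertexSet G V₀) (v : V) (K L : Finset V)
    (hK : ∀ a ∈ K, G.Adj v a) (hL : ∀ a ∈ L, G.Adj v a) (hKL : ∀ a ∈ K, a ∉ L)
    (hcov : ∀ y z, G.Adj v y → G.Adj v z → G.Adj y z → y ∈ K ∨ z ∈ K)
    (hall : ∀ A, A ⊆ K → A.card ≤ (A.biUnion fun a => L ∩ nb G a).card) : False := by
  have hh : ∀ s : Finset K, s.card ≤ (s.biUnion fun a => L ∩ nb G a.1).card := by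
    intro s
    have h := hall (s.map (Function.Embedding.subtype _)) (by
      intro x hx
      simp only [Finset.mem_map] at hx
      obtain ⟨y, _, rfl⟩ := hx
      exact y.2)
    rw [Finset.card_map] at h
    convert h using 2
    ext x
    simp
  obtain ⟨g, gi, gm⟩ := (Finset.all_card_le_biUnion_card_iff_exists_injective _).1 hh
  simp only [Finset.mem_inter, mem_nb] at gm
  refine single G hnored v (fun a : K => a.1) g K (fun a => hK _ a.2) (fun a => hL _ (gm a).1)
    (fun a => (gm a).2) (fun a b h => Subtype.ext h) (fun a b h => gi h) ?_ (by simp) ?_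
  · intro a b h
    exact hKL a.1 a.2 (h ▸ (gm b).1)
  · intro y z hy hz hyz
    rcases hcov y z hy hz hyz with h | h
    · exact Or.inl h
    · exact Or.inr (Or.inl h)

theorem coverL [Fintype V] [DecidableEq V] {G : SimpleGraph V} (K A L : Finset V) (hA : A ⊆ K)
    (n : ℕ) (h3 : ∀ l ∈ L, n ≤ (K ∩ nb G l).card) (hc : K.card < A.card + n) :
    L.card ≤ (A.biUnion fun a => L ∩ nb G a).card := by
  apply Finset.card_le_card
  intro l hl
  obtain ⟨a, ha⟩ := Finset.inter_nonempty_of_card_lt_card_add_card hA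
    (Finset.inter_subset_left : K ∩ nb G l ⊆ K) (by have := h3 l hl; omega)
  simp only [Finset.mem_inter, mem_nb] at ha
  simp only [Finset.mem_biUnion, Finset.mem_inter, mem_nb]
  exact ⟨a, ha.1, hl, ha.2.2.symm⟩

theorem step2 [Fintype V] [DecidableEq V] {G : SimpleGraph V}
    (hnored : ¬ ∃ V₀ : Finset V, ReducibleVertexSet G V₀) (v w : V) (K L : Finset V)
    (hK : ∀ a ∈ K, G.Adj v a) (hL : ∀ a ∈ L, G.Adj v a) (hKL : ∀ a ∈ K, a ∉ L)
    (hcov : ∀ y, G.Adj v y → y ∈ K ∨ y ∈ L)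
    (hind : ∀ y ∈ L, ∀ z ∈ L, ¬ G.Adj y z) (hK5 : K.card ≤ 5) (hL5 : 5 ≤ L.card)
    (h3 : ∀ l ∈ L, 3 ≤ (K ∩ nb G l).card) (hw : w ∈ L) (h4 : 4 ≤ (K ∩ nb G w).card)
    (a : V) (ha : a ∈ K) (hal : ∀ l ∈ L, ¬ G.Adj a l) : False := by
  have hk : ∀ l ∈ L, K ∩ nb G l = K.erase a ∩ nb G l := by
    intro l hl
    ext x
    simp only [Finset.mem_inter, Finset.mem_erase, mem_nb]
    constructor
    · rintro ⟨h1, h2⟩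
      refine ⟨⟨?_, h1⟩, h2⟩
      rintro rfl
      exact hal l hl h2.symm
    · rintro ⟨⟨_, h1⟩, h2⟩
      exact ⟨h1, h2⟩
  have hc := Finset.card_erase_of_mem ha
  rw [hk w hw] at h4
  have hw4 : K.erase a ∩ nb G w = K.erase a :=
    Finset.eq_of_subset_of_card_le Finset.inter_subset_left (by omega)
  refine hallstep hnored v (K.erase a) L (fun x hx => hK x (Finset.mem_of_mem_erase hx)) hL
    (fun x hx => hKL x (Finset.mem_of_mem_erase hx)) ?_ ?_
  · intro y z hy hz hyz
    by_contra hcon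
    simp only [Finset.mem_erase, not_or, not_and] at hcon
    have hy' : y = a ∨ y ∈ L := by
      by_cases h : y = a
      · exact Or.inl h
      · exact Or.inr ((hcov y hy).resolve_left (hcon.1 h))
    have hz' : z = a ∨ z ∈ L := by
      by_cases h : z = a
      · exact Or.inl h
      · exact Or.inr ((hcov z hz).resolve_left (hcon.2 h))
    rcases hy' with rfl | hy' <;> rcases hz' with rfl | hz'
    · exact G.irrefl hyz
    · exact hal z hz' hyz
    · exact hal y hy' hyz.symm
    · exact hind y hy' z hz' hyz
  · intro A hA
    have hAc := Finset.card_le_card hA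
    rcases (by omega : A.card = 0 ∨ A.card = 1 ∨ 2 ≤ A.card) with h | h | h
    · omega
    · obtain ⟨x, rfl⟩ := Finset.card_eq_one.1 h
      rw [h, Finset.one_le_card]
      have hx : x ∈ K.erase a := hA (by simp)
      rw [← hw4, Finset.mem_inter, mem_nb] at hx
      refine ⟨w, ?_⟩
      simp [mem_nb, hw, hx.2.symm]
    · have := coverL (G := G) (K.erase a) A L hA 3 (fun l hl => by
        rw [← hk l hl]; exact h3 l hl) (by omega)
      omega

theorem step3 [Fintype V] [DecidableEq V] {G : SimpleGraph V}
    (hnored : ¬ ∃ V₀ : Finset V, ReducibleVertexSet G V₀) (v : V) (K L : Finset V)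
    (hK : ∀ a ∈ K, G.Adj v a) (hL : ∀ a ∈ L, G.Adj v a) (hKL : ∀ a ∈ K, a ∉ L)
    (hcov : ∀ y, G.Adj v y → y ∈ K ∨ y ∈ L)
    (hind : ∀ y ∈ L, ∀ z ∈ L, ¬ G.Adj y z) (hK5 : K.card ≤ 5) (hL5 : 5 ≤ L.card)
    (h3 : ∀ l ∈ L, 3 ≤ (K ∩ nb G l).card)
    (a b z : V) (ha : a ∈ K) (hb : b ∈ K) (hab : a ≠ b) (hz : z ∈ L) (haz : G.Adj a z)
    (ha' : ∀ l ∈ L, G.Adj a l → l = z) (hb' : ∀ l ∈ L, G.Adj b l → l = z) : False := by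
  obtain ⟨r1, r2, r3⟩ := rest K a b ha hb hab
  have hsub : ∀ l ∈ L, l ≠ z → K ∩ nb G l ⊆ K \ {a, b} := by
    intro l hl hlz x hx
    simp only [Finset.mem_inter, mem_nb] at hx
    simp only [Finset.mem_sdiff, Finset.mem_insert, Finset.mem_singleton, not_or]
    refine ⟨hx.1, ?_, ?_⟩
    · rintro rfl
      exact hlz (ha' l hl hx.2.symm)
    · rintro rfl
      exact hlz (hb' l hl hx.2.symm)
  have hadj : ∀ l ∈ L, l ≠ z → ∀ x ∈ K \ {a, b}, G.Adj l x := by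
    intro l hl hlz x hx
    have := h3 l hl
    rw [← Finset.eq_of_subset_of_card_le (hsub l hl hlz) (by omega)] at hx
    simp only [Finset.mem_inter, mem_nb] at hx
    exact hx.2
  have hLz := Finset.card_erase_of_mem hz
  obtain ⟨M, hM, hM3⟩ := Finset.exists_subset_card_eq (by omega : 3 ≤ (L.erase z).card)
  obtain ⟨l1, l2, l3, h12, h13, h23, rfl⟩ := Finset.card_eq_three.1 hM3
  have m1 : l1 ∈ L.erase z := hM (by simp)
  have m2 : l2 ∈ L.erase z := hM (by simp)
  have m3 : l3 ∈ L.erase z := hM (by simp)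
  rw [Finset.mem_erase] at m1 m2 m3
  have hk3 : (K \ {a, b}).card = 3 := by
    have := Finset.card_le_card (hsub l1 m1.2 m1.1)
    have := h3 l1 m1.2
    omega
  obtain ⟨c, d, e, hcd, hce, hde, he⟩ := Finset.card_eq_three.1 hk3
  rw [he] at r2 r3 hadj
  simp only [Finset.mem_insert, Finset.mem_singleton] at r2 r3 hadj
  have hc' := r3 c (by simp)
  have hd' := r3 d (by simp)
  have he' := r3 e (by simp)
  have kc : c ∈ K := (r2 c).2 (by simp)
  have kd : d ∈ K := (r2 d).2 (by simp)
  have ke : e ∈ K := (r2 e).2 (by simp)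
  have c1 := (hadj l1 m1.2 m1.1 c (by simp)).symm
  have d1 := (hadj l2 m2.2 m2.1 d (by simp)).symm
  have e1 := (hadj l3 m3.2 m3.1 e (by simp)).symm
  have hne : ∀ x ∈ K, ∀ l ∈ L, x ≠ l := by
    rintro x hx l hl rfl
    exact hKL _ hx hl
  obtain ⟨t, ht1, ht2, ht3, ht4⟩ : ∃ t, G.Adj v t ∧ G.Adj a t ∧ (t = b ∨ t = z) ∧
      (G.Adj a b → t = b) := by
    by_cases h : G.Adj a b
    · exact ⟨b, hK b hb, h, Or.inl rfl, fun _ => rfl⟩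
    · exact ⟨z, hL z hz, haz, Or.inr rfl, fun h' => absurd h' h⟩
  have htl : ∀ l ∈ L, l ≠ z → l ≠ t := by
    intro l hl hlz h
    rcases ht3 with h' | h'
    · exact hne b hb l hl (by rw [h, h'])
    · exact hlz (by rw [h, h'])
  have htk : ∀ x ∈ K, x ≠ b → x ≠ t := by
    intro x hx hxb h
    rcases ht3 with h' | h'
    · exact hxb (by rw [h, h'])
    · exact hne x hx z hz (by rw [h, h'])
  have t1 := htl l1 m1.2 m1.1
  have t2 := htl l2 m2.2 m2.1
  have t3 := htl l3 m3.2 m3.1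
  have ta := htk a ha hab
  have tc := htk c kc hc'.2
  have td := htk d kd hd'.2
  have te := htk e ke he'.2
  refine single G hnored v (ι := Fin 4) ![c, d, e, a] ![l1, l2, l3, t] {c, d, e, z}
    ?_ ?_ ?_ ?_ ?_ ?_ ?_ ?_
  · intro i
    fin_cases i
    · exact hK c kc
    · exact hK d kd
    · exact hK e ke
    · exact hK a ha
  · intro i
    fin_cases i
    · exact hL _ m1.2
    · exact hL _ m2.2
    · exact hL _ m3.2
    · exact ht1
  · intro i
    fin_cases i
    · exact c1
    · exact d1
    · exact e1
    · exact ht2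
  · intro i j
    fin_cases i <;> fin_cases j <;>
      simp [hcd, hce, hde, hcd.symm, hce.symm, hde.symm, hc'.1, hd'.1, he'.1, hc'.1.symm,
        hd'.1.symm, he'.1.symm]
  · intro i j
    fin_cases i <;> fin_cases j <;>
      simp [h12, h13, h23, h12.symm, h13.symm, h23.symm, t1, t2, t3, t1.symm, t2.symm, t3.symm]
  · intro i j
    fin_cases i <;> fin_cases j <;>
      simp [ta, tc, td, te, hne _ kc _ m1.2, hne _ kc _ m2.2, hne _ kc _ m3.2,
        hne _ kd _ m1.2, hne _ kd _ m2.2, hne _ kd _ m3.2,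
        hne _ ke _ m1.2, hne _ ke _ m2.2, hne _ ke _ m3.2,
        hne _ ha _ m1.2, hne _ ha _ m2.2, hne _ ha _ m3.2]
  · simpa using Finset.card_le_four
  · have cls : ∀ y, G.Adj v y → y ∈ ({c, d, e, z} : Finset V) ∨ y = a ∨ y = b ∨
        (y ∈ L ∧ y ≠ z) := by
      intro y hy
      simp only [Finset.mem_insert, Finset.mem_singleton]
      have := hcov y hy
      rw [r2] at this
      clear * - this
      tauto
    have hab3 : G.Adj a b → ∃ i, a = (![c, d, e, a] : Fin 4 → V) i ∧
        b = (![l1, l2, l3, t] : Fin 4 → V) i := fun h => ⟨3, rfl, (ht4 h).symm⟩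
    intro y x hy hx hyx
    rcases cls y hy with h | h
    · exact Or.inl h
    rcases cls x hx with h' | h'
    · exact Or.inr (Or.inl h')
    refine Or.inr (Or.inr ?_)
    rcases h with rfl | rfl | h <;> rcases h' with rfl | rfl | h'
    · exact absurd hyx G.irrefl
    · obtain ⟨i, hi⟩ := hab3 hyx
      exact ⟨i, Or.inl hi⟩
    · exact absurd (ha' x h'.1 hyx) h'.2
    · obtain ⟨i, hi⟩ := hab3 hyx.symm
      exact ⟨i, Or.inr hi⟩
    · exact absurd hyx G.irrefl
    · exact absurd (hb' x h'.1 hyx) h'.2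
    · exact absurd (ha' y h.1 hyx.symm) h.2
    · exact absurd (hb' y h.1 hyx.symm) h.2
    · exact absurd hyx (hind y h.1 x h'.1)

theorem combi [Fintype V] [DecidableEq V] {G : SimpleGraph V}
    (hnored : ¬ ∃ V₀ : Finset V, ReducibleVertexSet G V₀) (v w : V) (K L : Finset V)
    (hK : ∀ a ∈ K, G.Adj v a) (hL : ∀ a ∈ L, G.Adj v a) (hKL : ∀ a ∈ K, a ∉ L)
    (hcov : ∀ y, G.Adj v y → y ∈ K ∨ y ∈ L)
    (hind : ∀ y ∈ L, ∀ z ∈ L, ¬ G.Adj y z) (hK5 : K.card ≤ 5) (hL5 : 5 ≤ L.card)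
    (h3 : ∀ l ∈ L, 3 ≤ (K ∩ nb G l).card) (hw : w ∈ L) (h4 : 4 ≤ (K ∩ nb G w).card) :
    False := by
  have s2 : ∀ a ∈ K, ∃ l ∈ L, G.Adj a l := by
    intro a ha
    by_contra hcon
    push Not at hcon
    exact step2 hnored v w K L hK hL hKL hcov hind hK5 hL5 h3 hw h4 a ha hcon
  refine hallstep hnored v K L hK hL hKL ?_ ?_
  · intro y z hy hz hyz
    rcases hcov y hy with h | h
    · exact Or.inl h
    rcases hcov z hz with h' | h'
    · exact Or.inr h'
    exact absurd hyz (hind y h z h')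
  · intro A hA
    have hAc := Finset.card_le_card hA
    rcases (by omega : A.card = 0 ∨ A.card = 1 ∨ A.card = 2 ∨ 3 ≤ A.card) with h | h | h | h
    · omega
    · obtain ⟨x, rfl⟩ := Finset.card_eq_one.1 h
      rw [h, Finset.one_le_card]
      obtain ⟨l, hl, hxl⟩ := s2 x (hA (by simp))
      refine ⟨l, ?_⟩
      simp [mem_nb, hl, hxl]
    · obtain ⟨a, b, hab, rfl⟩ := Finset.card_eq_two.1 h
      have ha : a ∈ K := hA (by simp)
      have hb : b ∈ K := hA (by simp)
      by_contra hlt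
      rw [h] at hlt
      have h1 := Finset.card_le_one.1 (Nat.lt_succ_iff.1 (not_le.1 hlt))
      have hm : ∀ l ∈ L, (G.Adj a l ∨ G.Adj b l) →
          l ∈ (({a, b} : Finset V).biUnion fun a => L ∩ nb G a) := by
        intro l hl h
        simp only [Finset.mem_biUnion, Finset.mem_insert, Finset.mem_singleton, Finset.mem_inter,
          mem_nb]
        rcases h with h | h
        · exact ⟨a, Or.inl rfl, hl, h⟩
        · exact ⟨b, Or.inr rfl, hl, h⟩
      obtain ⟨z, hz, haz⟩ := s2 a ha
      exact step3 hnored v K L hK hL hKL hcov hind hK5 hL5 h3 a b z ha hb hab hz haz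
        (fun l hl h => h1 l (hm l hl (Or.inl h)) z (hm z hz (Or.inl haz)))
        (fun l hl h => h1 l (hm l hl (Or.inr h)) z (hm z hz (Or.inl haz)))
    · have := coverL (G := G) K A L hA 3 h3 (by omega)
      omega

/-- In a robust graph with no reducible vertex set, if a vertex `v` of degree at least 10
subsumes some vertex `w` of degree at most 6 (i.e. `N[w] ⊆ N[v]`), then at most
`d(v) - 6` neighbors of `v` have degree at most 6. -/
theorem big_vertex_subsumes_few_low_neighbors [Fintype V] [DecidableEq V]
    (G : SimpleGraph V) (hrob : Robust G)
    (hnored : ¬ ∃ V₀ : Finset V, ReducibleVertexSet G V₀)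
    (v w : V) (hv : 10 ≤ (G.neighborSet v).ncard)
    (hw : (G.neighborSet w).ncard ≤ 6)
    (hsub : G.neighborSet w ∪ {w} ⊆ G.neighborSet v ∪ {v}) :
    {x | x ∈ G.neighborSet v ∧ (G.neighborSet x).ncard ≤ 6}.ncard ≤
      (G.neighborSet v).ncard - 6 := by
  classical
  by_contra hlt
  have hset : {x | x ∈ G.neighborSet v ∧ (G.neighborSet x).ncard ≤ 6} =
      (((nb G v).filter fun x => (nb G x).card ≤ 6 : Finset V) : Set V) := by
    ext x
    simp [mem_nb, ncard_nb]
  rw [hset, Set.ncard_coe_finset, ncard_nb] at hlt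
  rw [ncard_nb] at hv hw
  have hsum := Finset.card_filter_add_card_filter_not (s := nb G v) (fun x => (nb G x).card ≤ 6)
  have hvw : G.Adj v w := by
    have h : w ∈ G.neighborSet v ∪ {v} := hsub (by simp)
    simp only [Set.mem_union, mem_neighborSet, Set.mem_singleton_iff] at h
    rcases h with h | h
    · exact h
    · subst h
      omega
  have hlow : ∀ l, G.Adj v l → (nb G l).card ≤ 6 →
      nb G l ∩ nb G v ⊆ ((nb G v).filter fun x => ¬ (nb G x).card ≤ 6) ∩ nb G l := by
    intro l hl hl6 x hx
    rw [Finset.mem_inter, mem_nb, mem_nb] at hx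
    rw [Finset.mem_inter, Finset.mem_filter, mem_nb, mem_nb]
    exact ⟨⟨hx.2, fun h6 => low_indep hrob hnored l x hl6 h6 hx.1⟩, hx.1⟩
  refine combi hnored v w ((nb G v).filter fun x => ¬ (nb G x).card ≤ 6)
    ((nb G v).filter fun x => (nb G x).card ≤ 6) ?_ ?_ ?_ ?_ ?_ (by omega) (by omega) ?_ ?_ ?_
  · intro a ha
    rw [Finset.mem_filter, mem_nb] at ha
    exact ha.1
  · intro a ha
    rw [Finset.mem_filter, mem_nb] at ha
    exact ha.1
  · intro a ha hb
    rw [Finset.mem_filter] at ha hb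
    exact ha.2 hb.2
  · intro y hy
    rw [Finset.mem_filter, Finset.mem_filter, mem_nb]
    by_cases h : (nb G y).card ≤ 6
    · exact Or.inr ⟨hy, h⟩
    · exact Or.inl ⟨hy, h⟩
  · intro y hy z hz
    rw [Finset.mem_filter] at hy hz
    exact low_indep hrob hnored y z hy.2 hz.2
  · intro l hl
    rw [Finset.mem_filter, mem_nb] at hl
    have h1 := Finset.card_le_card (hlow l hl.1 hl.2)
    have h2 := cardSplit l v hl.1.symm
    have h3 := privLe hrob hnored l v hl.2 hl.1.symm
    have h4 := five_le hrob hnored l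
    omega
  · rw [Finset.mem_filter, mem_nb]
    exact ⟨hvw, hw⟩
  · have h1 := Finset.card_le_card (hlow w hvw hw)
    have h2 := cardSplit w v hvw.symm
    have h4 := five_le hrob hnored w
    have h3 : nb G w \ insert v (nb G v) = ∅ := by
      rw [Finset.sdiff_eq_empty_iff_subset]
      intro x hx
      rw [mem_nb] at hx
      have h : x ∈ G.neighborSet v ∪ {v} := hsub (Or.inl hx)
      simp only [Set.mem_union, mem_neighborSet, Set.mem_singleton_iff] at h
      rw [Finset.mem_insert, mem_nb]
      exact h.symm
    rw [h3, Finset.card_empty] at h2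
    omega
end
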